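/- Refined one-arm bound when ν = 1 (consequence of (4.16)): Assume ν = 1. For every ε > 0 there exists C = C(ε) ∈ (0,∞) such that for all x ∈ G and R ≥ 3, ℙ(x ↔ B(x,R)^c in E^{≥0}) ≤ C (log log R)^{2/3 + ε} R^{−1/2}. -/

import Mathlib

open MeasureTheory ProbabilityTheory Real Filter Topology
open scoped ENNReal NNReal BigOperators Classical

noncomputable section

/-! ## Generic exponents and corrections -/

/-- The exponent `b₁`: equal to `1` if `ν = 1` and `0` otherwise. -/
def bOne (ν : ℝ) : ℝ := if ν = 1 then 1 else 0

/-- The exponent `b₂`: equal to `1` if `α = 2ν` and `0` otherwise. -/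
def bTwo (ν α : ℝ) : ℝ := if α = 2 * ν then 1 else 0

/-- The polylogarithmic correction `q(r)` from Theorem 1.1. -/
def qArm (ν α r : ℝ) : ℝ :=
  if ν = 1 then Real.log (Real.log r)
  else if ν < α / 2 then Real.log r ^ ((ν - 1) / 2) * Real.log (Real.log r) ^ ν
  else Real.log r ^ ν * Real.log (Real.log r) ^ ν

/-- `exp(-t)` for an extended nonnegative real `t`. -/
def expNegE (t : ℝ≥0∞) : ℝ≥0∞ := if t = ⊤ then 0 else ENNReal.ofReal (Real.exp (-t.toReal))

/-! ## Transient weighted graphs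

A weighted graph `𝒢 = (G, λ)`, connected and locally finite, with controlled weights,
equipped with a metric `d`, a distinguished base point `o`, and exponents `α` (volume
growth) and `ν` (Green's function decay). -/

structure WGraph where
  (V : Type) (countableV : Countable V) (o : V)
  (lam : V → V → ℝ)
  (lam_nonneg : ∀ x y, 0 ≤ lam x y)
  (lam_symm : ∀ x y, lam x y = lam y x)
  (locFin : ∀ x, (Function.support (lam x)).Finite)
  (connectedG : ∀ x y, Relation.ReflTransGen (fun u v => 0 < lam u v) x y)
  -- controlled weights: `λ_{x,y}/λ_x ≥ c₀` for all neighbours `x ∼ y`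
  (ctrl : ∃ c₀ > (0:ℝ), ∀ x y, 0 < lam x y → c₀ * (∑ᶠ z, lam x z) ≤ lam x y)
  (d : V → V → ℝ)
  (d_symm : ∀ x y, d x y = d y x)
  (d_self : ∀ x, d x x = 0)
  (d_pos : ∀ x y, x ≠ y → 0 < d x y)
  (d_triangle : ∀ x y z, d x z ≤ d x y + d y z)
  (α : ℝ) (ν : ℝ)

namespace WGraph

variable (M : WGraph)

/-- Total weight `λ_x = Σ_{y} λ_{x,y}` at a vertex. -/
def lamTot (x : M.V) : ℝ := ∑ᶠ y, M.lam x y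

/-- The (closed) ball `B(x,r)` for the metric `d`. -/
def ball (x : M.V) (r : ℝ) : Set M.V := {y | M.d x y ≤ r}

/-- One-step transition probability of the random walk on `(G,λ)`. -/
def p (x y : M.V) : ℝ := M.lam x y / M.lamTot x

/-- `n`-step transition probability of the random walk. -/
def pstep : ℕ → M.V → M.V → ℝ
  | 0, x, y => if x = y then 1 else 0
  | n + 1, x, y => ∑ᶠ z, M.p x z * pstep n z y

/-- The Green's function `g(x,y) = λ_y^{-1} Σ_{n ≥ 0} P_x[Z_n = y]` of the walk. -/
def green (x y : M.V) : ℝ := (∑' n, M.pstep n x y) / M.lamTot y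

/-- Transience of the random walk on `𝒢`. -/
def Transient : Prop := ∀ x, Summable fun n => M.pstep n x x

/-- The volume growth condition `(V_α)`. -/
def VolGrowth : Prop :=
  ∃ c > (0:ℝ), ∃ C > (0:ℝ), ∀ (x : M.V) (r : ℝ), 1 ≤ r →
    c * r ^ M.α ≤ (∑ᶠ y ∈ M.ball x r, M.lamTot y) ∧
      (∑ᶠ y ∈ M.ball x r, M.lamTot y) ≤ C * r ^ M.α

/-- The Green's function decay condition `(G_ν)`. -/
def GreenDecay : Prop :=
  ∃ c > (0:ℝ), ∃ C > (0:ℝ),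
    (∀ x : M.V, c ≤ M.green x x ∧ M.green x x ≤ C) ∧
    ∀ x y : M.V, x ≠ y →
      c * M.d x y ^ (-M.ν) ≤ M.green x y ∧ M.green x y ≤ C * M.d x y ^ (-M.ν)

/-- The standing assumptions on the graph: transience, `(V_α)` and `(G_ν)`. -/
def Standing : Prop := M.Transient ∧ M.VolGrowth ∧ M.GreenDecay

/-- The graph distance `d_gr` on `𝒢`. -/
def graphDist (x y : M.V) : ℝ :=
  sInf {r : ℝ | ∃ n : ℕ, r = n ∧ ∃ γ : Fin (n + 1) → M.V, γ 0 = x ∧ γ (Fin.last n) = y ∧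
    ∀ i : Fin n, 0 < M.lam (γ i.castSucc) (γ i.succ)}

/-- Capacity of a finite set of vertices, via the variational characterization
`cap(K) = (inf_μ Σ_{x,y} μ(x) g(x,y) μ(y))⁻¹`, the infimum being over probability
measures supported on `K`. -/
def capFinset (K : Finset M.V) : ℝ :=
  (sInf {E : ℝ | ∃ μ : M.V → ℝ, (∀ x, 0 ≤ μ x) ∧ (∀ x, x ∉ K → μ x = 0) ∧
    (∑ x ∈ K, μ x) = 1 ∧ E = ∑ x ∈ K, ∑ y ∈ K, μ x * M.green x y * μ y})⁻¹

/-- Capacity of an arbitrary set of vertices. -/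
def cap (S : Set M.V) : ℝ := ⨆ K : {K : Finset M.V // ↑K ⊆ S}, M.capFinset K.1

/-- Weight `∏_{i<n} p(x_i, x_{i+1})` of a finite random walk trajectory. -/
def pathWt {n : ℕ} (γ : Fin (n + 1) → M.V) : ℝ := ∏ i : Fin n, M.p (γ i.castSucc) (γ i.succ)

/-- `P_z[H_x < H_O]`: the probability that the random walk started at `z` hits `x`
strictly before hitting the set `O`, expressed through a first-passage path decomposition. -/
def hitBefore (z x : M.V) (O : Set M.V) : ℝ :=
  ∑' n : ℕ, ∑' γ : Fin (n + 1) → M.V,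
    if γ 0 = z ∧ γ (Fin.last n) = x ∧ x ∉ O ∧
        (∀ i : Fin (n + 1), i ≠ Fin.last n → γ i ∉ O ∧ γ i ≠ x)
      then M.pathWt γ else 0

/-- Distance from a point to a set. -/
def dSet (x : M.V) (S : Set M.V) : ℝ := sInf (M.d x '' S)

/-! ### Discrete (rooted) loops

A rooted discrete loop visiting `m + 2` vertices (`m ≥ 0`), i.e. making at least two
jumps, encoded by its skeleton `Z_0, …, Z_{n-1}` (with `Z_n = Z_0`, indices mod `n`). -/

/-- The type of rooted discrete loops on `G` making `n = m + 2 ≥ 2` jumps. -/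
abbrev DLoop : Type := Σ m : ℕ, Fin (m + 2) → M.V

/-- The mass `(1/n) ∏_{0 ≤ i < n} λ_{x_i,x_{i+1}}/λ_{x_i}` that the loop measure `μ`
assigns to a given rooted discrete loop (its discrete skeleton intensity). -/
def dloopWt (γ : M.DLoop) : ℝ≥0∞ :=
  ENNReal.ofReal ((1 / ((γ.1 : ℝ) + 2)) * ∏ i : Fin (γ.1 + 2), M.p (γ.2 i) (γ.2 (i + 1)))

/-- The set of vertices visited by a discrete loop (`range(γ) ∩ G` for the
corresponding continuous loop). -/
def dloopRange (γ : M.DLoop) : Set M.V := Set.range γ.2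

/-- The loop measure `μ` evaluated on a set of (skeletons of) loops: since the events of
interest only depend on the vertices visited by a loop, the measure under `μ` of such an
event coincides with the total mass of the corresponding discrete skeletons. -/
def loopMeas (S : Set M.DLoop) : ℝ≥0∞ := ∑' γ : S, M.dloopWt γ

end WGraph

/-! ## Graphs equipped with an approximate renormalized lattice `Λ(L)` -/

structure LGraph extends WGraph where
  (Lat : ℝ → Set V)
  (Lat_base : ∀ L : ℝ, 1 ≤ L → o ∈ Lat L)
  (Lat_cover : ∀ L : ℝ, 1 ≤ L → ∀ x, ∃ y ∈ Lat L, d y x ≤ L)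
  (Lat_disj : ∀ L : ℝ, 1 ≤ L → ∀ y ∈ Lat L, ∀ z ∈ Lat L, y ≠ z →
    ∀ w, d y w ≤ L / 2 → ¬ d z w ≤ L / 2)
  (Lat_card : ∃ CΛ > (0:ℝ), ∀ L : ℝ, 1 ≤ L → ∀ (x : V) (N : ℕ), 1 ≤ N →
    {y | y ∈ Lat L ∧ d x y ≤ L * N}.Finite ∧
      ({y | y ∈ Lat L ∧ d x y ≤ L * N}.ncard : ℝ) ≤ CΛ * (N : ℝ) ^ α)

namespace LGraph

variable (M : LGraph)

/-- A path `π = (x_i)_{1 ≤ i ≤ M}` in `Λ(L)` from the base point `0` to `A ⊆ G`. -/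
def IsLatPath (L : ℝ) (A : Set M.V) {m : ℕ} (pa : Fin (m + 1) → M.V) : Prop :=
  pa 0 = M.o ∧ pa (Fin.last m) ∈ A ∧ (∀ i, pa i ∈ M.Lat L) ∧
    ∀ i : Fin m, ∃ x y, M.d (pa i.castSucc) x ≤ L ∧ M.d (pa i.succ) y ≤ L ∧ 0 < M.lam x y

/-- `𝒪 ⊆ G` is an `(L,R,n,κ)`-good obstacle: every path in `Λ(L)` from `0` to `B_R^c`
contains at least `n` points `y` (within `B_R`) with `cap(𝒪 ∩ B(y,L)) ≥ κ`. -/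
def GoodObstacle (O : Set M.V) (L R : ℝ) (n : ℝ) (κ : ℝ) : Prop :=
  ∀ (m : ℕ) (pa : Fin (m + 1) → M.V), M.IsLatPath L {y | R < M.d M.o y} pa →
    ∃ A : Finset M.V, (∀ y ∈ A, (∃ i, pa i = y) ∧ M.d M.o y ≤ R) ∧ n ≤ (A.card : ℝ) ∧
      ∀ y ∈ A, κ ≤ M.toWGraph.cap (O ∩ {z | M.d y z ≤ L})

/-- The layer `𝒜_k ⊆ Λ(L)` of lattice points whose `L`-ball meets the interior
boundary `∂B(0, C₁ k L)`. -/
def layer (C₁ L : ℝ) (k : ℕ) : Set M.V :=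
  {x | x ∈ M.Lat L ∧ ∃ y, M.d x y ≤ L ∧ M.d M.o y ≤ C₁ * k * L ∧
    ∃ z, 0 < M.lam y z ∧ C₁ * k * L < M.d M.o z}

/-- The annulus `𝔸_k = ∪_{x ∈ 𝒜_k} B(x,L)`. -/
def annulus (C₁ L : ℝ) (k : ℕ) : Set M.V := {v | ∃ x ∈ M.layer C₁ L k, M.d x v ≤ L}

end LGraph

/-! ## The Gaussian free field and its associated bond percolation `E^{≥a}` -/

/-- A transient weighted graph together with a Gaussian free field `φ` (law `ℙ`) and,
conditionally on `φ`, independent bond percolation configurations: each edge `{x,y}` is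
retained in `E^{≥a}` (i.e. `opn a`) independently with probability
`1 - exp(-2 λ_{x,y} (φ_x - a)_+ (φ_y - a)_+)`. -/
structure Model extends WGraph where
  (Ω : Type) [mΩ : MeasurableSpace Ω] (P : Measure Ω) (Pprob : IsProbabilityMeasure P)
  (φ : Ω → V → ℝ)
  (φ_meas : ∀ x, Measurable fun ω => φ ω x)
  -- `φ` is the centered Gaussian field with covariance the Green's function `g`
  (φ_gauss : ∀ (s : Finset V) (c : V → ℝ),
    Measure.map (fun ω => ∑ x ∈ s, c x * φ ω x) P =
      gaussianReal 0 (Real.toNNReal (∑ x ∈ s, ∑ y ∈ s, c x * c y * toWGraph.green x y)))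
  (opn : ℝ → Ω → V → V → Prop)
  (opn_symm : ∀ a ω x y, opn a ω x y → opn a ω y x)
  (opn_edge : ∀ a ω x y, opn a ω x y → 0 < lam x y)
  (opn_meas : ∀ a x y, MeasurableSet {ω | opn a ω x y})
  -- conditionally on `φ`, edges are open independently with the prescribed probabilities
  (opn_law : ∀ (a : ℝ) (s t : Finset (V × V)), Disjoint s t →
    (∀ e ∈ s ∪ t, ∀ f ∈ s ∪ t, e ≠ f → e ≠ Prod.swap f) →
    ∀ B : Set (V → ℝ), MeasurableSet B →
      P ({ω | φ ω ∈ B} ∩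
          {ω | (∀ e ∈ s, opn a ω e.1 e.2) ∧ (∀ e ∈ t, ¬ opn a ω e.1 e.2)}) =
      ∫⁻ ω in {ω | φ ω ∈ B},
        ENNReal.ofReal
          ((∏ e ∈ s,
            (1 - Real.exp (-(2 * lam e.1 e.2 * max (φ ω e.1 - a) 0 * max (φ ω e.2 - a) 0)))) *
           ∏ e ∈ t,
            Real.exp (-(2 * lam e.1 e.2 * max (φ ω e.1 - a) 0 * max (φ ω e.2 - a) 0))) ∂P)

attribute [instance] Model.mΩ

namespace Model

variable (M : Model)

/-- `x` and `y` are connected by a path of open edges of `E^{≥a}`. -/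
def conn (a : ℝ) (ω : M.Ω) (x y : M.V) : Prop :=
  Relation.ReflTransGen (fun u v => M.opn a ω u v) x y

/-- The open cluster `𝒦^a` of `x` in `E^{≥a}`. -/
def cluster (a : ℝ) (ω : M.Ω) (x : M.V) : Set M.V := {y | M.conn a ω x y}

/-- The probability of an event. -/
def prob (s : Set M.Ω) : ℝ := (M.P s).toReal

/-- The one-arm event `{x ↔ B(x,R)^c}` in `E^{≥0}`. -/
def armEvent (x : M.V) (R : ℝ) : Set M.Ω := {ω | ∃ y, R < M.d x y ∧ M.conn 0 ω x y}

/-- The truncated two-point function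
`τ_a^tr(x,y) = ℙ(x ↔ y in E^{≥a}, x ↮ ∞ in E^{≥a})`. -/
def tau (a : ℝ) (x y : M.V) : ℝ :=
  M.prob {ω | M.conn a ω x y ∧ (M.cluster a ω x).Finite}

/-- The truncated expected cluster volume `𝔼[|𝒦^a| 1_{|𝒦^a| < ∞}]`. -/
def clusterVol (a : ℝ) (x : M.V) : ℝ≥0∞ :=
  ∫⁻ ω, (if (M.cluster a ω x).Finite then ((M.cluster a ω x).ncard : ℝ≥0∞) else 0) ∂M.P

end Model

/-! ## The concrete case `G = ℤ³` with unit weights and the Euclidean distance -/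

/-- The vertex set `ℤ³`. -/
abbrev Z3 : Type := Fin 3 → ℤ

/-- Euclidean distance on `ℤ³`. -/
def dZ (x y : Z3) : ℝ := Real.sqrt (∑ i, ((x i : ℝ) - (y i : ℝ)) ^ 2)

/-- Unit weights: `λ_{x,y} = 1_{|x-y| = 1}`. -/
def lamZ (x y : Z3) : ℝ := if dZ x y = 1 then 1 else 0

/-- Transition probabilities of simple random walk on `ℤ³`. -/
def pZ (x y : Z3) : ℝ := lamZ x y / 6

/-- `n`-step transition probabilities of simple random walk on `ℤ³`. -/
def pstepZ : ℕ → Z3 → Z3 → ℝ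
  | 0, x, y => if x = y then 1 else 0
  | n + 1, x, y => ∑ᶠ z, pZ x z * pstepZ n z y

/-- The Green's function of simple random walk on `ℤ³` (with the normalization
`g(x,y) = λ_y^{-1} Σ_n P_x[Z_n = y]`, `λ_y = 6`). -/
def greenZ (x y : Z3) : ℝ := (∑' n, pstepZ n x y) / 6

/-- Euclidean distance between a point of `ℝ³` and a point of `ℤ³`. -/
def dMix (u : Fin 3 → ℝ) (z : Z3) : ℝ := Real.sqrt (∑ i, (u i - (z i : ℝ)) ^ 2)

/-- The Gaussian free field on `ℤ³` together with the associated bond percolation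
configurations `E^{≥a}`. -/
structure PercZ3 where
  (Ω : Type) [mΩ : MeasurableSpace Ω] (P : Measure Ω) (Pprob : IsProbabilityMeasure P)
  (φ : Ω → Z3 → ℝ)
  (φ_meas : ∀ x, Measurable fun ω => φ ω x)
  (φ_gauss : ∀ (s : Finset Z3) (c : Z3 → ℝ),
    Measure.map (fun ω => ∑ x ∈ s, c x * φ ω x) P =
      gaussianReal 0 (Real.toNNReal (∑ x ∈ s, ∑ y ∈ s, c x * c y * greenZ x y)))
  (opn : ℝ → Ω → Z3 → Z3 → Prop)
  (opn_symm : ∀ a ω x y, opn a ω x y → opn a ω y x)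
  (opn_edge : ∀ a ω x y, opn a ω x y → 0 < lamZ x y)
  (opn_meas : ∀ a x y, MeasurableSet {ω | opn a ω x y})
  (opn_law : ∀ (a : ℝ) (s t : Finset (Z3 × Z3)), Disjoint s t →
    (∀ e ∈ s ∪ t, ∀ f ∈ s ∪ t, e ≠ f → e ≠ Prod.swap f) →
    ∀ B : Set (Z3 → ℝ), MeasurableSet B →
      P ({ω | φ ω ∈ B} ∩
          {ω | (∀ e ∈ s, opn a ω e.1 e.2) ∧ (∀ e ∈ t, ¬ opn a ω e.1 e.2)}) =
      ∫⁻ ω in {ω | φ ω ∈ B},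
        ENNReal.ofReal
          ((∏ e ∈ s,
            (1 - Real.exp (-(2 * lamZ e.1 e.2 * max (φ ω e.1 - a) 0 * max (φ ω e.2 - a) 0)))) *
           ∏ e ∈ t,
            Real.exp (-(2 * lamZ e.1 e.2 * max (φ ω e.1 - a) 0 * max (φ ω e.2 - a) 0))) ∂P)

attribute [instance] PercZ3.mΩ

namespace PercZ3

variable (M : PercZ3)

/-- Connectivity by open edges in `E^{≥a}`. -/
def conn (a : ℝ) (ω : M.Ω) (x y : Z3) : Prop :=
  Relation.ReflTransGen (fun u v => M.opn a ω u v) x y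

/-- The open cluster of `x` in `E^{≥a}`. -/
def cluster (a : ℝ) (ω : M.Ω) (x : Z3) : Set Z3 := {y | M.conn a ω x y}

/-- The truncated two-point function on `ℤ³`. -/
def tau (a : ℝ) (x y : Z3) : ℝ :=
  ((M.P {ω | M.conn a ω x y ∧ (M.cluster a ω x).Finite}).toReal)

end PercZ3

/-! ## The metric graph (cable system) `𝔾̃`, killed Green's functions and killed GFFs -/

/-- The cable system `𝔾̃` over a graph `𝒢` (with renormalized lattice), together with the
killed Green's functions `g_U` and the laws `ℙ_U` of the Gaussian free field on open sets
`U ⊆ 𝔾̃` (the field killed outside `U`). -/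
structure CableG extends LGraph where
  (Gt : Type) [topGt : TopologicalSpace Gt] [msGt : MeasurableSpace Gt]
  (ι : V → Gt) (ι_inj : Function.Injective ι)
  (gU : Set Gt → Gt → Gt → ℝ)
  (gU_symm : ∀ U x y, gU U x y = gU U y x)
  (gU_zero : ∀ U x y, x ∉ U → gU U x y = 0)
  -- the Green's function of the full cable system restricts to `g` on `G`
  (gU_univ : ∀ x y : V, gU Set.univ (ι x) (ι y) = toWGraph.green x y)
  (PU : Set Gt → Measure (Gt → ℝ))
  (PU_prob : ∀ U, IsProbabilityMeasure (PU U))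
  -- `ℙ_U` is the law of the centered Gaussian field with covariance `g_U`
  (PU_gauss : ∀ (U : Set Gt) (s : Finset Gt) (c : Gt → ℝ),
    Measure.map (fun h => ∑ q ∈ s, c q * h q) (PU U) =
      gaussianReal 0 (Real.toNNReal (∑ q ∈ s, ∑ q' ∈ s, c q * c q' * gU U q q')))

attribute [instance] CableG.topGt CableG.msGt

/-- A probability space. -/
structure ProbSpace where
  (Ω : Type) [mΩ : MeasurableSpace Ω] (P : Measure Ω) (Pprob : IsProbabilityMeasure P)

attribute [instance] ProbSpace.mΩ

/-- A cable system as above, together with the laws of the vacant sets `Ṽ^u` of random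
interlacements at level `u > 0` on `𝔾̃`, axiomatized through their characterizing
properties: `Ṽ^u` is open and `ℙ(F ⊆ Ṽ^u) = exp(-u cap(F))` for finite `F ⊆ G`. -/
structure CableRI extends CableG where
  [msSetGt : MeasurableSpace (Set Gt)]
  (RIVacant : ℝ → Measure (Set Gt))
  (RIVacant_prob : ∀ u : ℝ, 0 < u → IsProbabilityMeasure (RIVacant u))
  (RIVacant_open : ∀ u : ℝ, 0 < u → ∀ᵐ S ∂(RIVacant u), @IsOpen Gt topGt S)
  (RIVacant_cap : ∀ u : ℝ, 0 < u → ∀ F : Finset V,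
    (RIVacant u {S | ∀ x ∈ F, ι x ∈ S}).toReal =
      Real.exp (-(u * toWGraph.capFinset F)))

attribute [instance] CableRI.msSetGt

/-! ## The Markovian loop soup at intensity `1/2` on the cable system -/

/-- The Poisson loop soup `ℒ` of intensity `(1/2)μ` on the cable system `𝔾̃` of a graph
`𝒢` (with renormalized lattice), under the law `Q`.  Continuous loops are axiomatized
through their ranges in `𝔾̃` and their discrete skeletons; the intensity measure `μ` is
pinned down via its (concrete) discrete skeleton intensity, and the law of the soup via
its void probabilities `Q(ℒ ∩ S = ∅) = exp(-μ(S)/2)`. -/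
structure LoopSoup extends LGraph where
  -- the cable system
  (Gt : Type) [topGt : TopologicalSpace Gt]
  (ι : V → Gt) (ι_inj : Function.Injective ι)
  (cable : V → V → Set Gt)
  (cable_symm : ∀ x y, cable x y = cable y x)
  (cable_ends : ∀ x y, 0 < lam x y → ι x ∈ cable x y ∧ ι y ∈ cable x y)
  (cable_vertices : ∀ x y, 0 < lam x y → ∀ v : V, ι v ∈ cable x y → v = x ∨ v = y)
  (cable_cover : ∀ q : Gt, (∃ v, q = ι v) ∨ ∃ x y, 0 < lam x y ∧ q ∈ cable x y)
  -- continuous loops on the cable system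
  (CLoop : Type) [msLoop : MeasurableSpace CLoop]
  (crange : CLoop → Set Gt)
  (traceG : CLoop → Set V)
  (trace_spec : ∀ γ, traceG γ = {v | ι v ∈ crange γ})
  -- the loop measure `μ` and its discrete skeleton
  (μC : Measure CLoop)
  (skel : CLoop → Option (Σ m : ℕ, Fin (m + 2) → V))
  (skel_spec : ∀ γ dγ, skel γ = some dγ → traceG γ = Set.range dγ.2)
  (skel_trivial : ∀ γ, skel γ = none → (traceG γ).Subsingleton)
  (μC_skel : ∀ S : Set (Σ m : ℕ, Fin (m + 2) → V),
    μC {γ | ∃ dγ ∈ S, skel γ = some dγ} = toWGraph.loopMeas S)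
  -- the loop soup and its law
  (Ωq : Type) [mΩq : MeasurableSpace Ωq] (Q : Measure Ωq) (Qprob : IsProbabilityMeasure Q)
  (soup : Ωq → Set CLoop)
  (soup_void : ∀ S : Set CLoop, MeasurableSet S →
    Q {ω | ∀ γ ∈ soup ω, γ ∉ S} = expNegE (μC S / 2))

attribute [instance] LoopSoup.topGt LoopSoup.msLoop LoopSoup.mΩq

namespace LoopSoup

variable (M : LoopSoup)

/-- Two loops of the soup are linked if they can be joined by a finite chain of loops of
the soup whose ranges successively intersect. -/
def linked (ω : M.Ωq) (γ γ' : M.CLoop) : Prop :=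
  Relation.ReflTransGen
    (fun g g' => g ∈ M.soup ω ∧ g' ∈ M.soup ω ∧ (M.crange g ∩ M.crange g').Nonempty) γ γ'

/-- The trace `𝒞` on `𝔾̃` of the cluster of loops of `ℒ` containing the base point `0`. -/
def C0 (ω : M.Ωq) : Set M.Gt :=
  {q | ∃ γ ∈ M.soup ω, q ∈ M.crange γ ∧
    ∃ γ₀ ∈ M.soup ω, M.ι M.o ∈ M.crange γ₀ ∧ M.linked ω γ γ₀}

/-- A loop is big (for the parameters `δ, L`) if `cap(range(γ) ∩ G) ≥ δ L^ν (log L)^{-b₂}`. -/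
def isBig (δ L : ℝ) (γ : M.CLoop) : Prop :=
  δ * L ^ M.ν * Real.log L ^ (-(bTwo M.ν M.α)) ≤ M.toWGraph.cap (M.traceG γ)

/-- The box `B̃(x,L) ⊆ 𝔾̃`: the ball `B(x,L)` together with all cables joining
neighbouring vertices of `B(x,L)`. -/
def Btilde (x : M.V) (L : ℝ) : Set M.Gt :=
  (M.ι '' {y | M.d x y ≤ L}) ∪
    ⋃ (u : M.V) (v : M.V) (_ : 0 < M.lam u v ∧ M.d x u ≤ L ∧ M.d x v ≤ L), M.cable u v

/-- A loop belongs to (the support of) `ℒ_k^b`: it is big and its range is contained in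
`B̃(x,L)` for some `x ∈ 𝒜_k`. -/
def inLayerBig (C₁ δ L : ℝ) (k : ℕ) (γ : M.CLoop) : Prop :=
  M.isBig δ L γ ∧ ∃ x ∈ M.toLGraph.layer C₁ L k, M.crange γ ⊆ M.Btilde x L

/-- The event `𝐁_k`: the cluster `𝒞` of `0` reaches `B_R^c` but contains no big loop of
`ℒ_k^b`. -/
def Bk (C₁ δ L R : ℝ) (k : ℕ) : Set M.Ωq :=
  {ω | (∃ y : M.V, R < M.d M.o y ∧ M.ι y ∈ M.C0 ω) ∧
    ∀ γ ∈ M.soup ω, M.inLayerBig C₁ δ L k γ → ¬ M.crange γ ⊆ M.C0 ω}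

/-- The number `N` of bad annuli among `k ∈ {1, …, ℓ}`. -/
def Nbad (C₁ δ L R : ℝ) (ℓ : ℕ) (ω : M.Ωq) : ℕ :=
  ((Finset.Icc 1 ℓ).filter fun k => ω ∈ M.Bk C₁ δ L R k).card

/-- The obstacle set `𝒪 = G ∩ 𝐼̃_D^b`: all vertices visited by a big loop of the soup
contained in a box `B̃(x,L)` with `x ∈ 𝒜_k` for some `k ∈ D`. -/
def obstacleD (C₁ δ L : ℝ) (D : Finset ℕ) (ω : M.Ωq) : Set M.V :=
  {v | ∃ γ ∈ M.soup ω, (∃ k ∈ D, M.inLayerBig C₁ δ L k γ) ∧ M.ι v ∈ M.crange γ}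

end LoopSoup

/-! ## Random walk on a weighted graph -/

namespace WGraph

variable {M : WGraph}

/-- The finite set of neighbours of a vertex. -/
def nb (M : WGraph) (x : M.V) : Finset M.V := (M.locFin x).toFinset

/-- The transition operator of the random walk. -/
def avg (M : WGraph) (f : M.V → ℝ) (x : M.V) : ℝ := ∑ y ∈ M.nb x, M.p x y * f y

lemma mem_nb {x y : M.V} : y ∈ M.nb x ↔ M.lam x y ≠ 0 := by simp [nb]

lemma mem_nb_symm {x y : M.V} : y ∈ M.nb x ↔ x ∈ M.nb y := by
  rw [mem_nb, mem_nb, M.lam_symm]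

lemma lam_pos_of_mem {x y : M.V} (h : y ∈ M.nb x) : 0 < M.lam x y :=
  lt_of_le_of_ne (M.lam_nonneg x y) (Ne.symm (mem_nb.1 h))

lemma lamTot_eq (x : M.V) : M.lamTot x = ∑ y ∈ M.nb x, M.lam x y := by
  unfold lamTot
  apply finsum_eq_sum_of_support_subset
  intro y hy
  simpa [nb] using hy

lemma lamTot_nonneg (x : M.V) : 0 ≤ M.lamTot x := by
  rw [lamTot_eq]
  exact Finset.sum_nonneg fun y _ => M.lam_nonneg x y

lemma p_nonneg (x y : M.V) : 0 ≤ M.p x y := div_nonneg (M.lam_nonneg x y) (lamTot_nonneg x)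

lemma p_eq_zero {x y : M.V} (h : y ∉ M.nb x) : M.p x y = 0 := by
  have : M.lam x y = 0 := by
    by_contra h'
    exact h (mem_nb.2 h')
  simp [p, this]

lemma sum_p {x : M.V} (h : 0 < M.lamTot x) : ∑ y ∈ M.nb x, M.p x y = 1 := by
  unfold p
  rw [← Finset.sum_div, ← lamTot_eq, div_self h.ne']

lemma pstep_succ (n : ℕ) (x y : M.V) :
    M.pstep (n + 1) x y = M.avg (fun z => M.pstep n z y) x := by
  rw [pstep, avg]
  apply finsum_eq_sum_of_support_subset
  intro z hz
  by_contra h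
  exact hz (by simp [p_eq_zero (fun h' => h (by simpa using h'))])

lemma avg_add (f g : M.V → ℝ) (x : M.V) :
    M.avg (fun y => f y + g y) x = M.avg f x + M.avg g x := by
  simp [avg, mul_add, Finset.sum_add_distrib]

lemma avg_smul (c : ℝ) (f : M.V → ℝ) (x : M.V) :
    M.avg (fun y => c * f y) x = c * M.avg f x := by
  simp only [avg, Finset.mul_sum]
  exact Finset.sum_congr rfl fun y _ => by ring

lemma avg_sum {ι : Type*} (s : Finset ι) (f : ι → M.V → ℝ) (x : M.V) :
    M.avg (fun y => ∑ i ∈ s, f i y) x = ∑ i ∈ s, M.avg (f i) x := by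
  simp only [avg, Finset.mul_sum]
  exact Finset.sum_comm

lemma avg_mono {f g : M.V → ℝ} {x : M.V} (h : ∀ y ∈ M.nb x, f y ≤ g y) :
    M.avg f x ≤ M.avg g x :=
  Finset.sum_le_sum fun y hy => mul_le_mul_of_nonneg_left (h y hy) (p_nonneg x y)

lemma avg_congr {f g : M.V → ℝ} {x : M.V} (h : ∀ y ∈ M.nb x, f y = g y) :
    M.avg f x = M.avg g x :=
  Finset.sum_congr rfl fun y hy => by rw [h y hy]

lemma avg_nonneg {f : M.V → ℝ} {x : M.V} (h : ∀ y ∈ M.nb x, 0 ≤ f y) : 0 ≤ M.avg f x :=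
  Finset.sum_nonneg fun y hy => mul_nonneg (p_nonneg x y) (h y hy)

lemma avg_const {x : M.V} (hx : 0 < M.lamTot x) (c : ℝ) : M.avg (fun _ => c) x = c := by
  rw [avg, ← Finset.sum_mul, sum_p hx, one_mul]

lemma pstep_nonneg (n : ℕ) (x y : M.V) : 0 ≤ M.pstep n x y := by
  induction n generalizing x with
  | zero => simp only [pstep]; split_ifs <;> norm_num
  | succ n ih => rw [pstep_succ]; exact avg_nonneg fun z _ => ih z

lemma pstep_succ_right (n : ℕ) (x y : M.V) :
    M.pstep (n + 1) x y = ∑ z ∈ M.nb y, M.pstep n x z * M.p z y := by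
  induction n generalizing x with
  | zero =>
    rw [pstep_succ, avg]
    simp only [pstep, mul_ite, mul_one, mul_zero, ite_mul, one_mul, zero_mul]
    rw [Finset.sum_ite_eq', Finset.sum_ite_eq]
    simp [mem_nb_symm (x := x)]
  | succ n ih =>
    rw [pstep_succ]
    simp_rw [avg, ih, Finset.mul_sum]
    rw [Finset.sum_comm]
    refine Finset.sum_congr rfl fun w _ => ?_
    rw [pstep_succ, avg, Finset.sum_mul]
    exact Finset.sum_congr rfl fun z _ => by ring

lemma lamTot_mul_p {x : M.V} (hx : 0 < M.lamTot x) (y : M.V) :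
    M.lamTot x * M.p x y = M.lam x y := by
  unfold p; field_simp

lemma pstep_reversible (h : ∀ x, 0 < M.lamTot x) (n : ℕ) (x y : M.V) :
    M.lamTot x * M.pstep n x y = M.lamTot y * M.pstep n y x := by
  induction n generalizing x y with
  | zero =>
    simp only [pstep]
    by_cases hxy : x = y
    · subst hxy; rfl
    · simp [hxy, Ne.symm hxy]
  | succ n ih =>
    rw [pstep_succ, pstep_succ_right, avg, Finset.mul_sum, Finset.mul_sum]
    refine Finset.sum_congr rfl fun z _ => ?_
    rw [← mul_assoc, lamTot_mul_p (h x), M.lam_symm, ← lamTot_mul_p (h z)]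
    linear_combination M.p z x * ih z y

/-- Tail of the Green's function: `P^n g(·, y)`. -/
def greenTail (M : WGraph) (n : ℕ) (x y : M.V) : ℝ :=
  (∑' k, M.pstep (k + n) x y) / M.lamTot y

/-- Quantitative consequences of the standing assumptions with `ν = 1` and `α ≥ 3`, with a
single constant. -/
structure Reg (M : WGraph) (K : ℝ) : Prop where
  one_le : 1 ≤ K
  alpha : 3 ≤ M.α
  lamTot_lb : ∀ x, K⁻¹ ≤ M.lamTot x
  summ : ∀ x y, Summable fun n => M.pstep n x y
  green_diag_lb : ∀ x, K⁻¹ ≤ M.green x x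
  green_diag_ub : ∀ x, M.green x x ≤ K
  green_lb : ∀ x y, x ≠ y → K⁻¹ / M.d x y ≤ M.green x y
  green_ub : ∀ x y, x ≠ y → M.green x y ≤ K / M.d x y
  jump : ∀ x y, 0 < M.lam x y → M.d x y ≤ K
  ball_fin : ∀ x r, (M.ball x r).Finite
  card_lb : ∀ x r, 1 ≤ r → K⁻¹ * r ^ M.α ≤ (M.ball x r).ncard
  card_ub : ∀ x r, 1 ≤ r → ((M.ball x r).ncard : ℝ) ≤ K * r ^ M.α

lemma greenTail_nonneg (n : ℕ) (x y : M.V) : 0 ≤ M.greenTail n x y :=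
  div_nonneg (tsum_nonneg fun _ => pstep_nonneg _ _ _) (lamTot_nonneg y)

lemma green_nonneg (x y : M.V) : 0 ≤ M.green x y := greenTail_nonneg 0 x y

lemma avg_greenTail (hs : ∀ x y, Summable fun n => M.pstep n x y) (n : ℕ) (x y : M.V) :
    M.avg (fun z => M.greenTail n z y) x = M.greenTail (n + 1) x y := by
  unfold greenTail avg
  simp_rw [← mul_div_assoc]
  rw [← Finset.sum_div]
  congr 1
  simp_rw [← tsum_mul_left]
  rw [← Summable.tsum_finsetSum]
  · refine tsum_congr fun k => ?_
    rw [← add_assoc, pstep_succ, avg]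
  · intro z _
    exact ((summable_nat_add_iff n).2 (hs z y)).mul_left _

lemma greenTail_tendsto (x y : M.V) :
    Tendsto (fun n => M.greenTail n x y) atTop (𝓝 0) := by
  have := (tendsto_sum_nat_add fun n => M.pstep n x y).div_const (M.lamTot y)
  simpa [greenTail] using this

lemma green_eq (hs : ∀ x y, Summable fun n => M.pstep n x y) (x y : M.V) :
    M.green x y = (if x = y then 1 else 0) / M.lamTot y + M.greenTail 1 x y := by
  unfold green greenTail
  rw [(hs x y).tsum_eq_zero_add, add_div]
  simp only [pstep]

lemma green_symm_of (h : ∀ x, 0 < M.lamTot x) (x y : M.V) : M.green x y = M.green y x := by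
  have e : ∀ n, M.pstep n x y / M.lamTot y = M.pstep n y x / M.lamTot x := by
    intro n
    rw [div_eq_div_iff (h y).ne' (h x).ne']
    linarith [pstep_reversible h n x y, mul_comm (M.lamTot x) (M.pstep n x y),
      mul_comm (M.lamTot y) (M.pstep n y x)]
  unfold green
  rw [← tsum_div_const, ← tsum_div_const]
  exact tsum_congr e

namespace Reg

variable {K : ℝ} (H : M.Reg K)

end Reg

lemma exists_reg (hS : M.Standing) (hν : M.ν = 1) (hα : 3 ≤ M.α) : ∃ K, M.Reg K := by
  obtain ⟨-, ⟨c, hc, C, hC, hvol⟩, c', hc', C', hC', hdiag, hoff⟩ := hS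
  obtain ⟨c₀, hc₀, hctrl⟩ := M.ctrl
  rw [hν] at hoff
  have gpos : ∀ x y, 0 < M.green x y := by
    intro x y
    by_cases h : x = y
    · subst h; exact hc'.trans_le (hdiag x).1
    · exact lt_of_lt_of_le (mul_pos hc' (rpow_pos_of_pos (M.d_pos x y h) _)) (hoff x y h).1
  have lpos : ∀ x, 0 < M.lamTot x := by
    intro x
    refine lt_of_le_of_ne (lamTot_nonneg x) fun h => ?_
    have := gpos x x
    rw [green, ← h, div_zero] at this
    exact lt_irrefl _ this
  have summ : ∀ x y, Summable fun n => M.pstep n x y := by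
    intro x y
    by_contra h
    have := gpos x y
    rw [green, tsum_eq_zero_of_not_summable h, zero_div] at this
    exact lt_irrefl _ this
  have fin1 : ∀ x r, 1 ≤ r → (M.ball x r).Finite := by
    intro x r hr
    by_contra h
    have h1 := (hvol x r hr).1
    have h2 : (∑ᶠ y ∈ M.ball x r, M.lamTot y) = 0 := by
      apply finsum_mem_eq_zero_of_infinite
      have : M.ball x r ∩ Function.support M.lamTot = M.ball x r := by
        ext y; simp [(lpos y).ne']
      rw [this]; exact h
    rw [h2] at h1
    have : 0 < c * r ^ M.α := mul_pos hc (rpow_pos_of_pos (by linarith) _)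
    linarith
  have lub : ∀ x, M.lamTot x ≤ C := by
    intro x
    have h := (hvol x 1 le_rfl).2
    rw [one_rpow, mul_one, finsum_mem_eq_finite_toFinset_sum _ (fin1 x 1 le_rfl)] at h
    refine le_trans (Finset.single_le_sum (f := M.lamTot) (fun y _ => lamTot_nonneg y) ?_) h
    simp [ball, M.d_self]
  have llb : ∀ x, 1 / C' ≤ M.lamTot x := by
    intro x
    have h := green_eq summ x x
    have h1 := greenTail_nonneg (M := M) 1 x x
    have h2 := (hdiag x).2
    rw [if_pos rfl] at h
    have h3 : 1 / M.lamTot x ≤ C' := by linarith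
    rw [div_le_iff₀ (lpos x)] at h3
    rw [div_le_iff₀ hC']
    linarith
  have cardvol : ∀ x r, 1 ≤ r → (∑ᶠ y ∈ M.ball x r, M.lamTot y) ≤ C * (M.ball x r).ncard ∧
      ((M.ball x r).ncard : ℝ) ≤ C' * ∑ᶠ y ∈ M.ball x r, M.lamTot y := by
    intro x r hr
    rw [finsum_mem_eq_finite_toFinset_sum _ (fin1 x r hr),
      Set.ncard_eq_toFinset_card _ (fin1 x r hr)]
    constructor
    · calc _ ≤ ∑ y ∈ (fin1 x r hr).toFinset, C := Finset.sum_le_sum fun y _ => lub y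
        _ = _ := by rw [Finset.sum_const, nsmul_eq_mul, mul_comm]
    · calc _ = ∑ y ∈ (fin1 x r hr).toFinset, (1 : ℝ) := by simp
        _ ≤ ∑ y ∈ (fin1 x r hr).toFinset, C' * M.lamTot y := by
          refine Finset.sum_le_sum fun y _ => ?_
          have := llb y
          rw [div_le_iff₀ hC'] at this
          linarith
        _ = _ := by rw [Finset.mul_sum]
  set K := 1 + 1 / c' + C' + C + C / c + C * C' + C * C' / c₀ with hK
  have e1 : 0 < 1 / c' := by positivity
  have e2 : 0 < C / c := by positivity
  have e3 : 0 < C * C' := by positivity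
  have e4 : 0 < C * C' / c₀ := by positivity
  have hK1 : 1 ≤ K := by linarith
  have hK0 : 0 < K := by linarith
  have kc' : K⁻¹ ≤ c' := by
    rw [inv_le_comm₀ hK0 hc', ← one_div]; linarith
  have kC' : K⁻¹ ≤ 1 / C' := by
    rw [one_div]; exact inv_anti₀ hC' (by linarith)
  refine ⟨K, hK1, hα, fun x => kC'.trans (llb x), summ,
    fun x => kc'.trans (hdiag x).1, fun x => (hdiag x).2.trans (by linarith), ?_, ?_, ?_, ?_,
    ?_, ?_⟩
  · intro x y h
    have h1 := (hoff x y h).1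
    rw [rpow_neg_one] at h1
    rw [div_eq_mul_inv]
    refine le_trans ?_ h1
    have := M.d_pos x y h
    gcongr
  · intro x y h
    have h1 := (hoff x y h).2
    rw [rpow_neg_one] at h1
    rw [div_eq_mul_inv]
    refine le_trans h1 ?_
    have := M.d_pos x y h
    have : C' ≤ K := by linarith
    gcongr
  · intro x y h
    by_cases hxy : x = y
    · rw [hxy, M.d_self]; linarith
    have h1 := hctrl x y h
    have h2 : c₀ ≤ M.p x y := by
      rw [p, le_div_iff₀ (lpos x)]; exact h1
    have h3 : c₀ / C ≤ M.green x y := by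
      have hmem : y ∈ M.nb x := mem_nb.2 h.ne'
      have h4 : M.p x y * M.green y y ≤ M.greenTail 1 x y := by
        rw [← avg_greenTail summ]
        exact Finset.single_le_sum (f := fun z => M.p x z * M.greenTail 0 z y)
          (fun z _ => mul_nonneg (p_nonneg _ _) (greenTail_nonneg _ _ _)) hmem
      have h5 : 1 / C ≤ M.green y y := by
        have h := green_eq summ y y
        have h1 := greenTail_nonneg (M := M) 1 y y
        rw [if_pos rfl] at h
        have : 1 / C ≤ 1 / M.lamTot y := one_div_le_one_div_of_le (lpos y) (lub y)
        linarith
      have h6 := green_eq summ x y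
      rw [if_neg hxy, zero_div, zero_add] at h6
      rw [h6]
      refine le_trans ?_ h4
      rw [div_eq_mul_one_div]
      exact mul_le_mul h2 h5 (by positivity) (p_nonneg _ _)
    have h7 := (hoff x y hxy).2
    rw [rpow_neg_one] at h7
    have hd := M.d_pos x y hxy
    have h8 : c₀ / C ≤ C' / M.d x y := by rw [div_eq_mul_inv C']; linarith
    rw [div_le_div_iff₀ hC hd] at h8
    have h9 : M.d x y ≤ C * C' / c₀ := by
      rw [le_div_iff₀ hc₀]; linarith
    linarith
  · intro x r
    rcases le_total 1 r with hr | hr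
    · exact fin1 x r hr
    · exact (fin1 x 1 le_rfl).subset fun y hy => le_trans (show M.d x y ≤ r from hy) hr
  · intro x r hr
    have h1 := (hvol x r hr).1
    have h2 := (cardvol x r hr).1
    have h3 : c / C * r ^ M.α ≤ (M.ball x r).ncard := by
      rw [div_mul_eq_mul_div, div_le_iff₀ hC]; linarith
    refine le_trans ?_ h3
    have : K⁻¹ ≤ c / C := by
      rw [inv_le_comm₀ hK0 (by positivity), inv_div]; linarith
    have : 0 ≤ r ^ M.α := rpow_nonneg (by linarith) _
    gcongr
  · intro x r hr
    have h1 := (hvol x r hr).2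
    have h2 := (cardvol x r hr).2
    have h3 : ((M.ball x r).ncard : ℝ) ≤ C * C' * r ^ M.α := by
      refine h2.trans ?_
      calc _ ≤ C' * (C * r ^ M.α) := by gcongr
        _ = _ := by ring
    refine h3.trans ?_
    have : C * C' ≤ K := by linarith
    have : 0 ≤ r ^ M.α := rpow_nonneg (by linarith) _
    gcongr

namespace Reg

variable {K : ℝ}

lemma K_pos (H : M.Reg K) : 0 < K := zero_lt_one.trans_le H.one_le

lemma lamTot_pos (H : M.Reg K) (x : M.V) : 0 < M.lamTot x :=
  (inv_pos.2 H.K_pos).trans_le (H.lamTot_lb x)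

lemma green_symm (H : M.Reg K) (x y : M.V) : M.green x y = M.green y x :=
  green_symm_of H.lamTot_pos x y

lemma sum_p (H : M.Reg K) (x : M.V) : ∑ y ∈ M.nb x, M.p x y = 1 := WGraph.sum_p (H.lamTot_pos x)

lemma avg_const (H : M.Reg K) (c : ℝ) (x : M.V) : M.avg (fun _ => c) x = c :=
  WGraph.avg_const (H.lamTot_pos x) c

lemma green_ub' (H : M.Reg K) {x y : M.V} {r : ℝ} (hr : 0 < r) (h : r ≤ M.d x y) :
    M.green x y ≤ K / r := by
  have hne : x ≠ y := by
    rintro rfl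
    rw [M.d_self] at h
    linarith
  refine (H.green_ub x y hne).trans ?_
  have := H.K_pos
  gcongr

lemma green_lb' (H : M.Reg K) {x y : M.V} {r : ℝ} (hr : 1 ≤ r) (h : M.d x y ≤ r) :
    K⁻¹ / r ≤ M.green x y := by
  have hK := inv_pos.2 H.K_pos
  by_cases hne : x = y
  · subst hne
    exact (div_le_self hK.le hr).trans (H.green_diag_lb x)
  · refine le_trans ?_ (H.green_lb x y hne)
    have := M.d_pos x y hne
    gcongr

lemma green_eq (H : M.Reg K) (x y : M.V) :
    M.green x y = (if x = y then 1 else 0) / M.lamTot y + M.avg (fun z => M.green z y) x := by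
  rw [WGraph.green_eq H.summ, ← avg_greenTail H.summ]; rfl

lemma avg_green_le (H : M.Reg K) (x y : M.V) : M.avg (fun z => M.green z y) x ≤ M.green x y := by
  rw [H.green_eq x y]
  have := lamTot_nonneg y
  have : 0 ≤ (if x = y then (1 : ℝ) else 0) / M.lamTot y := by split_ifs <;> positivity
  linarith

lemma avg_green_of_ne (H : M.Reg K) {x y : M.V} (h : x ≠ y) :
    M.avg (fun z => M.green z y) x = M.green x y := by
  rw [H.green_eq x y, if_neg h, zero_div, zero_add]

end Reg

end WGraph

/-! ## Potentials, the maximum principle and hitting operators -/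

namespace WGraph

variable {M : WGraph} {K : ℝ}

/-- The potential of a finite charge. -/
def pot (M : WGraph) (A : Finset M.V) (σ : M.V → ℝ) (x : M.V) : ℝ := ∑ y ∈ A, σ y * M.green x y

lemma pot_nonneg {A : Finset M.V} {σ : M.V → ℝ} (h : ∀ y ∈ A, 0 ≤ σ y) (x : M.V) :
    0 ≤ M.pot A σ x :=
  Finset.sum_nonneg fun y hy => mul_nonneg (h y hy) (green_nonneg x y)

lemma avg_pot (A : Finset M.V) (σ : M.V → ℝ) (x : M.V) :
    M.avg (M.pot A σ) x = ∑ y ∈ A, σ y * M.avg (fun z => M.green z y) x := by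
  unfold pot
  rw [avg_sum]
  exact Finset.sum_congr rfl fun y _ => avg_smul _ _ _

lemma Reg.pot_eq (H : M.Reg K) (A : Finset M.V) (σ : M.V → ℝ) (x : M.V) :
    M.pot A σ x = (if x ∈ A then σ x else 0) / M.lamTot x + M.avg (M.pot A σ) x := by
  rw [avg_pot, pot]
  simp_rw [fun y => H.green_eq x y, mul_add, Finset.sum_add_distrib]
  congr 1
  simp only [ite_div, one_div, zero_div, mul_ite, mul_zero, Finset.sum_ite_eq]
  split_ifs <;> simp [div_eq_mul_inv]

lemma Reg.avg_pot_of_notMem (H : M.Reg K) {A : Finset M.V} {σ : M.V → ℝ} {x : M.V}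
    (hx : x ∉ A) : M.avg (M.pot A σ) x = M.pot A σ x := by
  rw [H.pot_eq A σ x, if_neg hx, zero_div, zero_add]

/-- Maximum principle: a potential is dominated by a nonnegative function which is
superharmonic off the charge as soon as it is dominated on the charge. -/
lemma Reg.pot_le (H : M.Reg K) {A : Finset M.V} {σ v : M.V → ℝ} (hv : ∀ x, 0 ≤ v x)
    (hsup : ∀ x, x ∉ A → M.avg v x ≤ v x) (hA : ∀ x ∈ A, M.pot A σ x ≤ v x) (x : M.V) :
    M.pot A σ x ≤ v x := by
  have key : ∀ n x, M.pot A σ x ≤ v x + ∑ y ∈ A, |σ y| * M.greenTail n x y := by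
    intro n
    induction n with
    | zero =>
      intro x
      have : M.pot A σ x ≤ ∑ y ∈ A, |σ y| * M.greenTail 0 x y :=
        Finset.sum_le_sum fun y _ =>
          mul_le_mul_of_nonneg_right (le_abs_self _) (green_nonneg _ _)
      linarith [hv x]
    | succ n ih =>
      intro x
      by_cases hx : x ∈ A
      · have : 0 ≤ ∑ y ∈ A, |σ y| * M.greenTail (n + 1) x y :=
          Finset.sum_nonneg fun y _ => mul_nonneg (abs_nonneg _) (greenTail_nonneg _ _ _)
        linarith [hA x hx]
      · rw [← H.avg_pot_of_notMem hx]
        refine (avg_mono fun y _ => ih y).trans ?_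
        rw [avg_add, avg_sum]
        refine add_le_add (hsup x hx) (le_of_eq (Finset.sum_congr rfl fun y _ => ?_))
        rw [avg_smul, avg_greenTail H.summ]
  have lim : Tendsto (fun n => v x + ∑ y ∈ A, |σ y| * M.greenTail n x y) atTop
      (𝓝 (v x + ∑ y ∈ A, |σ y| * 0)) :=
    tendsto_const_nhds.add
      (tendsto_finsetSum _ fun y _ => (greenTail_tendsto x y).const_mul _)
  simp only [mul_zero, Finset.sum_const_zero, add_zero] at lim
  exact ge_of_tendsto' lim fun n => key n x

/-- `hit A F n x` is the expectation of `F` at the hitting point of `A` by the walk from `x`,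
on the event that this happens within `n` steps. -/
def hit (M : WGraph) (A : Set M.V) (F : M.V → ℝ) : ℕ → M.V → ℝ
  | 0, x => if x ∈ A then F x else 0
  | n + 1, x => if x ∈ A then F x else M.avg (hit M A F n) x

lemma hit_of_mem {A : Set M.V} {F : M.V → ℝ} {x : M.V} (hx : x ∈ A) (n : ℕ) :
    M.hit A F n x = F x := by
  cases n <;> simp [hit, hx]

lemma hit_zero {A : Set M.V} {F : M.V → ℝ} {x : M.V} (hx : x ∉ A) : M.hit A F 0 x = 0 := by
  simp [hit, hx]

lemma hit_succ {A : Set M.V} {F : M.V → ℝ} {x : M.V} (hx : x ∉ A) (n : ℕ) :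
    M.hit A F (n + 1) x = M.avg (M.hit A F n) x := by
  simp [hit, hx]

lemma hit_mono {A : Set M.V} {F G : M.V → ℝ} (h : ∀ x ∈ A, F x ≤ G x) (n : ℕ) (x : M.V) :
    M.hit A F n x ≤ M.hit A G n x := by
  induction n generalizing x with
  | zero =>
    by_cases hx : x ∈ A
    · simpa [hit_of_mem hx] using h x hx
    · simp [hit_zero hx]
  | succ n ih =>
    by_cases hx : x ∈ A
    · simpa [hit_of_mem hx] using h x hx
    · rw [hit_succ hx, hit_succ hx]
      exact avg_mono fun y _ => ih y

lemma hit_le {A : Set M.V} {F u : M.V → ℝ} (hu : ∀ x, 0 ≤ u x) (h : ∀ x ∈ A, F x ≤ u x)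
    (hsup : ∀ x, x ∉ A → M.avg u x ≤ u x) (n : ℕ) (x : M.V) : M.hit A F n x ≤ u x := by
  induction n generalizing x with
  | zero =>
    by_cases hx : x ∈ A
    · simpa [hit_of_mem hx] using h x hx
    · simpa [hit_zero hx] using hu x
  | succ n ih =>
    by_cases hx : x ∈ A
    · simpa [hit_of_mem hx] using h x hx
    · rw [hit_succ hx]
      exact (avg_mono fun y _ => ih y).trans (hsup x hx)

lemma hit_nonneg {A : Set M.V} {F : M.V → ℝ} (h : ∀ x ∈ A, 0 ≤ F x) (n : ℕ) (x : M.V) :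
    0 ≤ M.hit A F n x := by
  induction n generalizing x with
  | zero =>
    by_cases hx : x ∈ A
    · simpa [hit_of_mem hx] using h x hx
    · simp [hit_zero hx]
  | succ n ih =>
    by_cases hx : x ∈ A
    · simpa [hit_of_mem hx] using h x hx
    · rw [hit_succ hx]
      exact avg_nonneg fun y _ => ih y

lemma hit_le_succ {A : Set M.V} {F : M.V → ℝ} (h : ∀ x ∈ A, 0 ≤ F x) (n : ℕ) (x : M.V) :
    M.hit A F n x ≤ M.hit A F (n + 1) x := by
  induction n generalizing x with
  | zero =>
    by_cases hx : x ∈ A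
    · simp [hit_of_mem hx]
    · rw [hit_zero hx]
      exact hit_nonneg h _ _
  | succ n ih =>
    by_cases hx : x ∈ A
    · simp [hit_of_mem hx]
    · rw [hit_succ hx, hit_succ hx]
      exact avg_mono fun y _ => ih y

lemma hit_monotone {A : Set M.V} {F : M.V → ℝ} (h : ∀ x ∈ A, 0 ≤ F x) (x : M.V) :
    Monotone fun n => M.hit A F n x :=
  monotone_nat_of_le_succ fun n => hit_le_succ h n x

lemma hit_smul (A : Set M.V) (c : ℝ) (F : M.V → ℝ) (n : ℕ) (x : M.V) :
    M.hit A (fun y => c * F y) n x = c * M.hit A F n x := by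
  induction n generalizing x with
  | zero => by_cases hx : x ∈ A <;> simp [hit, hx]
  | succ n ih =>
    by_cases hx : x ∈ A
    · simp [hit_of_mem hx]
    · rw [hit_succ hx, hit_succ hx, ← avg_smul]
      exact avg_congr fun y _ => ih y

lemma hit_sum {ι : Type*} (s : Finset ι) (A : Set M.V) (F : ι → M.V → ℝ) (n : ℕ) (x : M.V) :
    M.hit A (fun y => ∑ i ∈ s, F i y) n x = ∑ i ∈ s, M.hit A (F i) n x := by
  induction n generalizing x with
  | zero => by_cases hx : x ∈ A <;> simp [hit, hx]
  | succ n ih =>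
    by_cases hx : x ∈ A
    · simp [hit_of_mem hx]
    · simp only [hit_succ hx]
      rw [← avg_sum]
      exact avg_congr fun y _ => ih y

lemma hit_congr {A : Set M.V} {F G : M.V → ℝ} (h : ∀ x ∈ A, F x = G x) (n : ℕ) (x : M.V) :
    M.hit A F n x = M.hit A G n x :=
  le_antisymm (hit_mono (fun x hx => (h x hx).le) n x) (hit_mono (fun x hx => (h x hx).ge) n x)

/-- A nonnegative function which is subharmonic off `A` is bounded by its value at the hitting
point of `A` plus its mean after `n + 1` steps. -/
lemma le_hit_add {A : Set M.V} {u : M.V → ℝ} (hu : ∀ x, 0 ≤ u x)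
    (hsub : ∀ x, x ∉ A → u x ≤ M.avg u x) (n : ℕ) (x : M.V) :
    u x ≤ M.hit A u n x + M.avg^[n + 1] u x := by
  have pos : ∀ n x, 0 ≤ M.avg^[n] u x := by
    intro n
    induction n with
    | zero => exact hu
    | succ n ih =>
      intro x
      rw [Function.iterate_succ_apply']
      exact avg_nonneg fun y _ => ih y
  induction n generalizing x with
  | zero =>
    by_cases hx : x ∈ A
    · rw [hit_of_mem hx]; linarith [pos 1 x]
    · rw [hit_zero hx, zero_add]
      exact hsub x hx
  | succ n ih =>
    by_cases hx : x ∈ A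
    · rw [hit_of_mem hx]; linarith [pos (n + 2) x]
    · rw [hit_succ hx, Function.iterate_succ_apply', ← avg_add]
      exact (hsub x hx).trans (avg_mono fun y _ => ih y)

lemma iterate_avg_greenTail (hs : ∀ x y, Summable fun n => M.pstep n x y) (n : ℕ) (x y : M.V) :
    M.avg^[n] (fun z => M.green z y) x = M.greenTail n x y := by
  induction n generalizing x with
  | zero => rfl
  | succ n ih =>
    rw [Function.iterate_succ_apply', ← avg_greenTail hs]
    exact avg_congr fun z _ => ih z

lemma Reg.iterate_avg_pot (H : M.Reg K) (A : Finset M.V) (σ : M.V → ℝ) (n : ℕ) (x : M.V) :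
    M.avg^[n] (M.pot A σ) x = ∑ y ∈ A, σ y * M.greenTail n x y := by
  induction n generalizing x with
  | zero => rfl
  | succ n ih =>
    rw [Function.iterate_succ_apply', avg_congr fun z _ => ih z, avg_sum]
    refine Finset.sum_congr rfl fun y _ => ?_
    rw [avg_smul, avg_greenTail H.summ]

lemma Reg.iterate_avg_pot_tendsto (H : M.Reg K) (A : Finset M.V) (σ : M.V → ℝ) (x : M.V) :
    Tendsto (fun n => M.avg^[n] (M.pot A σ) x) atTop (𝓝 0) := by
  simp_rw [H.iterate_avg_pot]
  have : Tendsto (fun n => ∑ y ∈ A, σ y * M.greenTail n x y) atTop (𝓝 (∑ y ∈ A, σ y * 0)) :=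
    tendsto_finsetSum _ fun y _ => (greenTail_tendsto x y).const_mul _
  simpa using this

end WGraph

/-! ## Finitely supported random sets -/

/-- A random finite set taking finitely many values. -/
structure RSet (V : Type) where
  (I : Type) [fin : Fintype I]
  (w : I → ℝ)
  (w_nonneg : ∀ i, 0 ≤ w i)
  (w_sum : ∑ i, w i = 1)
  (s : I → Finset V)

attribute [instance] RSet.fin

namespace RSet

variable {V : Type}

/-- Expectation of a functional of a random set. -/
def E (X : RSet V) (Φ : Finset V → ℝ) : ℝ := ∑ i, X.w i * Φ (X.s i)

/-- A deterministic set. -/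
def pure (s : Finset V) : RSet V where
  I := Unit
  w _ := 1
  w_nonneg _ := zero_le_one
  w_sum := by simp
  s _ := s

/-- The image of a random set under a map. -/
def map (X : RSet V) (f : Finset V → Finset V) : RSet V where
  I := X.I
  w := X.w
  w_nonneg := X.w_nonneg
  w_sum := X.w_sum
  s i := f (X.s i)

/-- The union of two independent random sets. -/
def union (X Y : RSet V) : RSet V where
  I := X.I × Y.I
  w i := X.w i.1 * Y.w i.2
  w_nonneg i := mul_nonneg (X.w_nonneg _) (Y.w_nonneg _)
  w_sum := by
    rw [Fintype.sum_prod_type]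
    simp_rw [← Finset.mul_sum, Y.w_sum, mul_one]
    exact X.w_sum
  s i := X.s i.1 ∪ Y.s i.2

/-- A mixture of random sets. -/
def mix (J : Finset V) (q : V → ℝ) (hq : ∀ j, 0 ≤ q j) (h1 : ∑ j ∈ J, q j = 1)
    (X : V → RSet V) : RSet V where
  I := Σ j : J, (X j).I
  w i := q i.1 * (X i.1).w i.2
  w_nonneg i := mul_nonneg (hq _) ((X i.1).w_nonneg _)
  w_sum := by
    rw [Fintype.sum_sigma]
    simp_rw [← Finset.mul_sum, fun j : J => (X j).w_sum, mul_one]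
    rw [Finset.sum_coe_sort J q, h1]
  s i := (X i.1).s i.2

lemma E_pure (s : Finset V) (Φ : Finset V → ℝ) : (pure s).E Φ = Φ s := by
  show ∑ _ : Unit, (1 : ℝ) * Φ s = Φ s
  simp

lemma E_map (X : RSet V) (f : Finset V → Finset V) (Φ : Finset V → ℝ) :
    (X.map f).E Φ = X.E fun s => Φ (f s) := rfl

lemma E_union (X Y : RSet V) (Φ : Finset V → ℝ) :
    (X.union Y).E Φ = X.E fun s => Y.E fun t => Φ (s ∪ t) := by
  show ∑ i : X.I × Y.I, X.w i.1 * Y.w i.2 * Φ (X.s i.1 ∪ Y.s i.2) = _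
  rw [Fintype.sum_prod_type, E]
  simp only [E]
  simp_rw [Finset.mul_sum, mul_assoc]

lemma E_mix (J : Finset V) (q : V → ℝ) (hq : ∀ j, 0 ≤ q j) (h1 : ∑ j ∈ J, q j = 1)
    (X : V → RSet V) (Φ : Finset V → ℝ) :
    (mix J q hq h1 X).E Φ = ∑ j ∈ J, q j * (X j).E Φ := by
  show ∑ i : (Σ j : J, (X j).I), q i.1 * (X i.1).w i.2 * Φ ((X i.1).s i.2) = _
  rw [Fintype.sum_sigma, ← Finset.sum_coe_sort J]
  simp_rw [E, Finset.mul_sum, mul_assoc]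

lemma E_mono {X : RSet V} {Φ Ψ : Finset V → ℝ} (h : ∀ s, Φ s ≤ Ψ s) : X.E Φ ≤ X.E Ψ :=
  Finset.sum_le_sum fun i _ => mul_le_mul_of_nonneg_left (h _) (X.w_nonneg i)

lemma E_mono_of_mem {X : RSet V} {Φ Ψ : Finset V → ℝ} (h : ∀ i, Φ (X.s i) ≤ Ψ (X.s i)) :
    X.E Φ ≤ X.E Ψ :=
  Finset.sum_le_sum fun i _ => mul_le_mul_of_nonneg_left (h i) (X.w_nonneg i)

lemma E_const (X : RSet V) (c : ℝ) : (X.E fun _ => c) = c := by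
  rw [E, ← Finset.sum_mul, X.w_sum, one_mul]

lemma E_sum {ι : Type*} (X : RSet V) (S : Finset ι) (Φ : ι → Finset V → ℝ) :
    (X.E fun s => ∑ j ∈ S, Φ j s) = ∑ j ∈ S, X.E (Φ j) := by
  simp only [E, Finset.mul_sum]
  exact Finset.sum_comm

lemma E_mul_left (X : RSet V) (c : ℝ) (Φ : Finset V → ℝ) :
    (X.E fun s => c * Φ s) = c * X.E Φ := by
  simp only [E, Finset.mul_sum]
  exact Finset.sum_congr rfl fun _ _ => by ring

lemma E_mul_right (X : RSet V) (c : ℝ) (Φ : Finset V → ℝ) :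
    (X.E fun s => Φ s * c) = X.E Φ * c := by
  simp_rw [mul_comm _ c]; exact X.E_mul_left c Φ

lemma E_add (X : RSet V) (Φ Ψ : Finset V → ℝ) :
    (X.E fun s => Φ s + Ψ s) = X.E Φ + X.E Ψ := by
  simp only [E, mul_add, Finset.sum_add_distrib]

lemma E_sub (X : RSet V) (Φ Ψ : Finset V → ℝ) :
    (X.E fun s => Φ s - Ψ s) = X.E Φ - X.E Ψ := by
  simp only [E, mul_sub, Finset.sum_sub_distrib]

lemma E_nonneg {X : RSet V} {Φ : Finset V → ℝ} (h : ∀ s, 0 ≤ Φ s) : 0 ≤ X.E Φ :=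
  Finset.sum_nonneg fun i _ => mul_nonneg (X.w_nonneg i) (h _)

/-- The probability that a random set meets a given set. -/
def hitProb (X : RSet V) (S : Finset V) : ℝ :=
  X.E fun s => if (s ∩ S).Nonempty then 1 else 0

lemma hitProb_nonneg (X : RSet V) (S : Finset V) : 0 ≤ X.hitProb S :=
  E_nonneg fun s => by split_ifs <;> norm_num

lemma hitProb_union_le (X Y : RSet V) (S : Finset V) :
    (X.union Y).hitProb S ≤ X.hitProb S + Y.hitProb S := by
  unfold hitProb
  rw [E_union, ← X.E_const (Y.E _), ← E_add]
  refine E_mono fun s => ?_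
  rw [← Y.E_const (if (s ∩ S).Nonempty then 1 else 0), ← E_add]
  refine E_mono fun t => ?_
  simp only [Finset.union_inter_distrib_right, Finset.union_nonempty]
  split_ifs <;> simp_all

end RSet

namespace WGraph

variable {M : WGraph} {K : ℝ}

/-- The range of the walk during its first `n` steps. -/
def Reg.walk (H : M.Reg K) : ℕ → M.V → RSet M.V
  | 0, x => RSet.pure {x}
  | n + 1, x => (RSet.mix (M.nb x) (M.p x) (p_nonneg x) (H.sum_p x) (Reg.walk H n)).map (insert x)

lemma Reg.E_walk_zero (H : M.Reg K) (x : M.V) (Φ : Finset M.V → ℝ) :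
    (H.walk 0 x).E Φ = Φ {x} := RSet.E_pure _ _

lemma Reg.E_walk_succ (H : M.Reg K) (n : ℕ) (x : M.V) (Φ : Finset M.V → ℝ) :
    (H.walk (n + 1) x).E Φ = M.avg (fun z => (H.walk n z).E fun s => Φ (insert x s)) x := by
  rw [walk, RSet.E_map, RSet.E_mix]; rfl

lemma Reg.walk_hits (H : M.Reg K) (A : Set M.V) (n : ℕ) (x : M.V) :
    ((H.walk n x).E fun s => if ∃ y ∈ s, y ∈ A then 1 else 0) = M.hit A (fun _ => 1) n x := by
  induction n generalizing x with
  | zero => simp [H.E_walk_zero, hit]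
  | succ n ih =>
    rw [H.E_walk_succ]
    by_cases hx : x ∈ A
    · simp only [hit_of_mem hx, Finset.exists_mem_insert, hx, true_or, if_true]
      simp_rw [RSet.E_const]
      exact H.avg_const 1 x
    · simp only [Finset.exists_mem_insert, hx, false_or]
      rw [hit_succ hx]
      exact avg_congr fun z _ => ih z

lemma Reg.walk_mem_le (H : M.Reg K) (y : M.V) (n : ℕ) (x : M.V) :
    ((H.walk n x).E fun s => if y ∈ s then 1 else 0) ≤ K * M.green x y := by
  have h := H.walk_hits {y} n x
  simp only [Set.mem_singleton_iff, exists_eq_right] at h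
  rw [h]
  refine hit_le (fun z => mul_nonneg H.K_pos.le (green_nonneg z y)) ?_ ?_ n x
  · rintro z rfl
    have := H.green_diag_lb z
    rwa [inv_le_iff_one_le_mul₀ H.K_pos, mul_comm] at this
  · intro z _
    rw [avg_smul]
    exact mul_le_mul_of_nonneg_left (H.avg_green_le z y) H.K_pos.le

lemma Reg.walk_mem_pair_le (H : M.Reg K) (y z : M.V) (n : ℕ) (x : M.V) :
    ((H.walk n x).E fun s => if y ∈ s ∧ z ∈ s then 1 else 0) ≤
      K ^ 2 * M.green y z * (M.green x y + M.green x z) := by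
  have hK := H.K_pos
  have one : ∀ w, 1 ≤ K * M.green w w := fun w => by
    have := H.green_diag_lb w
    rwa [inv_le_iff_one_le_mul₀ H.K_pos, mul_comm] at this
  have single : ∀ (n : ℕ) (v w : M.V),
      ((H.walk n v).E fun s => if w ∈ s then 1 else 0) ≤ K ^ 2 * M.green v w * M.green v v := by
    intro n v w
    refine (H.walk_mem_le w n v).trans ?_
    have := mul_le_mul_of_nonneg_left (one v) (mul_nonneg hK.le (green_nonneg v w))
    linarith
  have hy : ∀ n, ((H.walk n y).E fun s => if y ∈ s ∧ z ∈ s then 1 else 0) ≤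
      K ^ 2 * M.green y z * (M.green y y + M.green y z) := by
    intro n
    refine (RSet.E_mono (Ψ := fun s => if z ∈ s then 1 else 0) fun s => ?_).trans
      ((single n y z).trans ?_)
    · split_ifs <;> simp_all
    · have := mul_nonneg (mul_nonneg (sq_nonneg K) (green_nonneg y z)) (green_nonneg y z)
      linarith
  have hz : ∀ n, ((H.walk n z).E fun s => if y ∈ s ∧ z ∈ s then 1 else 0) ≤
      K ^ 2 * M.green y z * (M.green z y + M.green z z) := by
    intro n
    refine (RSet.E_mono (Ψ := fun s => if y ∈ s then 1 else 0) fun s => ?_).trans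
      ((single n z y).trans ?_)
    · split_ifs <;> simp_all
    · rw [H.green_symm z y]
      have := mul_nonneg (mul_nonneg (sq_nonneg K) (green_nonneg y z)) (green_nonneg y z)
      linarith
  induction n generalizing x with
  | zero =>
    by_cases h1 : x = y
    · subst h1; exact hy 0
    · rw [H.E_walk_zero]
      simp only [Finset.mem_singleton, Ne.symm h1, false_and, if_false]
      have := green_nonneg y z
      have := green_nonneg x y
      have := green_nonneg x z
      positivity
  | succ n ih =>
    by_cases h1 : x = y
    · subst h1; exact hy _
    by_cases h2 : x = z
    · subst h2; exact hz _
    rw [H.E_walk_succ]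
    simp only [Finset.mem_insert, Ne.symm h1, Ne.symm h2, false_or]
    refine (avg_mono fun w _ => ih w).trans ?_
    rw [avg_smul, avg_add, H.avg_green_of_ne h1, H.avg_green_of_ne h2]

/-- The trace on `A` of the first `n` steps of the walk. -/
def Reg.trace (H : M.Reg K) (A : Finset M.V) (n : ℕ) (b : M.V) : RSet M.V :=
  (H.walk n b).map fun s => s ∩ A

/-- The first hitting distribution carries the hitting probability and has potential at most
that of the starting point. -/
lemma Reg.trace_hitProb (H : M.Reg K) (A : Finset M.V) (n : ℕ) (b : M.V) (S : Finset M.V) :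
    ∃ μ : M.V → ℝ, (∀ y, 0 ≤ μ y) ∧ (∀ y, y ∉ A → μ y = 0) ∧
      ∑ y ∈ S, μ y = (H.trace A n b).hitProb S ∧ ∀ x, M.pot S μ x ≤ M.green b x := by
  obtain ⟨B, hB⟩ : ∃ B : Set M.V, B = ↑(A ∩ S) := ⟨_, rfl⟩
  set δ : M.V → M.V → ℝ := fun y z => if z = y ∧ y ∈ A then 1 else 0 with hδ
  have δ0 : ∀ y z, 0 ≤ δ y z := fun y z => by simp only [hδ]; split_ifs <;> norm_num
  refine ⟨fun y => M.hit B (δ y) n b, fun y => hit_nonneg (fun z _ => δ0 y z) n b, ?_, ?_, ?_⟩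
  · intro y hy
    have : M.hit B (δ y) n b ≤ 0 :=
      hit_le (u := fun _ => 0) (fun _ => le_rfl) (fun z _ => by simp [hδ, hy])
        (fun z _ => by simp [avg]) n b
    exact le_antisymm this (hit_nonneg (fun z _ => δ0 y z) n b)
  · rw [← hit_sum, RSet.hitProb, Reg.trace, RSet.E_map]
    have h := H.walk_hits B n b
    have e : ((H.walk n b).E fun s => if ((s ∩ A) ∩ S).Nonempty then 1 else 0) =
        M.hit B (fun _ => 1) n b := by
      rw [← h]
      congr 1
      funext s
      refine if_congr ?_ rfl rfl
      simp only [Finset.Nonempty, Finset.mem_inter, hB, Finset.mem_coe, and_assoc]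
    rw [e]
    refine hit_congr (fun x hx => ?_) n b
    have hx' : x ∈ A ∧ x ∈ S := by simpa [hB] using hx
    simp only [hδ]
    rw [Finset.sum_eq_single x] <;> simp +contextual [hx', eq_comm]
  · intro x
    unfold pot
    have e : ∑ y ∈ S, M.hit B (δ y) n b * M.green x y =
        M.hit B (fun z => ∑ y ∈ S, M.green x y * δ y z) n b := by
      rw [hit_sum]
      refine Finset.sum_congr rfl fun y _ => ?_
      rw [hit_smul, mul_comm]
    rw [e]
    refine hit_le (fun z => green_nonneg z x) ?_ (fun z _ => H.avg_green_le z x) n b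
    intro z hz
    have hz' : z ∈ A ∧ z ∈ S := by simpa [hB] using hz
    simp only [hδ]
    rw [Finset.sum_eq_single z]
    · simp [hz'.1, H.green_symm x z]
    · intro y _ hy; simp [Ne.symm hy]
    · intro h; exact absurd hz'.2 h

end WGraph

/-! ## Random obstacles -/

namespace WGraph

variable {M : WGraph} {K : ℝ}

/-- The Green's function is positive semidefinite. -/
def GreenPSD (M : WGraph) : Prop :=
  ∀ (s : Finset M.V) (c : M.V → ℝ), 0 ≤ ∑ x ∈ s, ∑ y ∈ s, c x * c y * M.green x y

/-- A ball as a finite set. -/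
def Reg.bl (H : M.Reg K) (x : M.V) (r : ℝ) : Finset M.V := (H.ball_fin x r).toFinset

lemma Reg.mem_bl (H : M.Reg K) {x y : M.V} {r : ℝ} : y ∈ H.bl x r ↔ M.d x y ≤ r := by
  simp [bl, ball]

lemma Reg.card_bl_lb (H : M.Reg K) (x : M.V) {r : ℝ} (hr : 1 ≤ r) :
    K⁻¹ * r ^ M.α ≤ (H.bl x r).card := by
  rw [bl, ← Set.ncard_eq_toFinset_card _ (H.ball_fin x r)]; exact H.card_lb x r hr

lemma Reg.card_bl_ub (H : M.Reg K) (x : M.V) {r : ℝ} (hr : 1 ≤ r) :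
    ((H.bl x r).card : ℝ) ≤ K * r ^ M.α := by
  rw [bl, ← Set.ncard_eq_toFinset_card _ (H.ball_fin x r)]; exact H.card_ub x r hr

lemma Reg.green_le (H : M.Reg K) (x y : M.V) : M.green x y ≤ K := by
  have := H.pot_le (A := {y}) (σ := fun _ => 1) (v := fun _ => K) (fun _ => H.K_pos.le)
    (fun x _ => (H.avg_const K x).le) (by simpa [pot] using H.green_diag_ub y) x
  simpa [pot] using this

/-- Energy of a finite charge. -/
def energy (M : WGraph) (s : Finset M.V) (μ : M.V → ℝ) : ℝ := ∑ y ∈ s, μ y * M.pot s μ y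

lemma energy_eq (s : Finset M.V) (μ : M.V → ℝ) :
    M.energy s μ = ∑ x ∈ s, ∑ y ∈ s, μ x * μ y * M.green x y := by
  unfold energy pot
  simp_rw [Finset.mul_sum, mul_assoc]

lemma energy_nonneg (hp : M.GreenPSD) (s : Finset M.V) (μ : M.V → ℝ) : 0 ≤ M.energy s μ := by
  rw [energy_eq]; exact hp s μ

/-- Arithmetic-geometric bound for the mutual energy of two charges. -/
lemma Reg.mutual_le (H : M.Reg K) (hp : M.GreenPSD) (s : Finset M.V) (μ ν : M.V → ℝ) :
    2 * ∑ y ∈ s, ν y * M.pot s μ y ≤ M.energy s ν + M.energy s μ := by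
  have h := hp s fun y => ν y - μ y
  have e : ∑ x ∈ s, ∑ y ∈ s, (ν x - μ x) * (ν y - μ y) * M.green x y =
      M.energy s ν + M.energy s μ - 2 * ∑ y ∈ s, ν y * M.pot s μ y := by
    have sw : ∑ x ∈ s, ∑ y ∈ s, ν y * μ x * M.green x y =
        ∑ x ∈ s, ∑ y ∈ s, ν x * μ y * M.green x y := by
      rw [Finset.sum_comm]
      exact Finset.sum_congr rfl fun x _ => Finset.sum_congr rfl fun y _ => by
        rw [H.green_symm]
    have e3 : ∑ y ∈ s, ν y * M.pot s μ y = ∑ x ∈ s, ∑ y ∈ s, ν x * μ y * M.green x y := by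
      unfold pot
      simp_rw [Finset.mul_sum, mul_assoc]
    have e4 : 2 * ∑ y ∈ s, ν y * M.pot s μ y = ∑ x ∈ s, ∑ y ∈ s, ν x * μ y * M.green x y +
        ∑ x ∈ s, ∑ y ∈ s, ν y * μ x * M.green x y := by rw [sw, e3]; ring
    rw [energy_eq, energy_eq, e4]
    simp_rw [← Finset.sum_add_distrib, ← Finset.sum_sub_distrib]
    refine Finset.sum_congr rfl fun x _ => Finset.sum_congr rfl fun y _ => by ring
  linarith

lemma pot_smul (s : Finset M.V) (c : ℝ) (μ : M.V → ℝ) (x : M.V) :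
    M.pot s (fun y => c * μ y) x = c * M.pot s μ x := by
  unfold pot
  rw [Finset.mul_sum]
  exact Finset.sum_congr rfl fun _ _ => by ring

lemma energy_smul (s : Finset M.V) (c : ℝ) (μ : M.V → ℝ) :
    M.energy s (fun y => c * μ y) = c ^ 2 * M.energy s μ := by
  unfold energy
  rw [Finset.mul_sum]
  refine Finset.sum_congr rfl fun y _ => ?_
  rw [pot_smul]; ring

/-- A fixed obstacle whose uniform measure has a large potential at `x` is hit before leaving
`Λ` with a probability controlled by its energy. -/
lemma Reg.pot_le_of_obstacle (H : M.Reg K) (hp : M.GreenPSD) {s : Finset M.V} {Λ : Set M.V}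
    {x : M.V} {B β t : ℝ} (ht : 0 < t) (hB : 0 ≤ B) (h1 : ∀ y ∈ s, M.green x y ≤ B)
    (h2 : ∀ z, z ∉ Λ → M.pot s (fun _ => 1) z ≤ β) (hβ : 0 ≤ β) (n₀ : ℕ) :
    M.pot s (fun _ => 1) x ≤
      t / 2 * B * (1 - M.hit (↑s ∪ Λᶜ) (fun y => if y ∈ s then 0 else 1) n₀ x) +
        M.energy s (fun _ => 1) / (2 * t) + β := by
  obtain ⟨A, hA⟩ : ∃ A : Set M.V, A = ↑s ∪ Λᶜ := ⟨_, rfl⟩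
  rw [← hA]
  have hsA : ∀ y ∈ s, y ∈ A := fun y hy => by rw [hA]; exact Or.inl hy
  have hAs : ∀ y, y ∈ A → y ∉ s → y ∉ Λ := by
    intro y hy hys
    rw [hA] at hy
    exact hy.resolve_left hys
  set u := M.pot s (fun _ => 1) with hu
  have u0 : ∀ z, 0 ≤ u z := pot_nonneg fun _ _ => zero_le_one
  have key : ∀ n, n₀ ≤ n → u x ≤
      t / 2 * B * (1 - M.hit A (fun y => if y ∈ s then 0 else 1) n₀ x) +
        M.energy s (fun _ => 1) / (2 * t) + β + M.avg^[n + 1] u x := by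
    intro n hn
    set ν : M.V → ℝ := fun y => M.hit A (fun z => if z = y then 1 else 0) n x with hνd
    have ν0 : ∀ y, 0 ≤ ν y := fun y => hit_nonneg (fun z _ => by split_ifs <;> norm_num) n x
    set h := M.hit A (fun y => if y ∈ s then 1 else 0) n x with hh
    have hνh : ∑ y ∈ s, ν y = h := by
      simp only [hνd, hh]
      rw [← hit_sum]
      exact hit_congr (fun z _ => by simp) n x
    have hsum : M.hit A (fun y => if y ∈ s then 0 else 1) n x + h ≤ 1 := by
      rw [hh]
      have e : M.hit A (fun y => if y ∈ s then 0 else 1) n x +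
          M.hit A (fun y => if y ∈ s then 1 else 0) n x =
          M.hit A (fun y => ∑ i : Bool, if i then (if y ∈ s then 0 else 1)
            else (if y ∈ s then 1 else 0)) n x := by
        rw [hit_sum]; simp
      rw [e]
      refine hit_le (fun _ => zero_le_one) (fun z _ => ?_) (fun z _ => (H.avg_const 1 z).le) n x
      by_cases hz : z ∈ s <;> simp [hz]
    have hmono : M.hit A (fun y => if y ∈ s then 0 else 1) n₀ x ≤
        M.hit A (fun y => if y ∈ s then 0 else 1) n x :=
      hit_monotone (fun z _ => by split_ifs <;> norm_num) x hn
    have hEν : M.energy s ν ≤ B * h := by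
      rw [← hνh, Finset.mul_sum]
      refine Finset.sum_le_sum fun y hy => ?_
      rw [mul_comm]
      refine mul_le_mul_of_nonneg_right (le_trans ?_ (h1 y hy)) (ν0 y)
      have e : M.pot s ν y = M.hit A (fun z => ∑ w ∈ s, M.green y w * if z = w then 1 else 0)
          n x := by
        rw [hit_sum]
        refine Finset.sum_congr rfl fun w _ => ?_
        rw [hit_smul, mul_comm]
      rw [e]
      refine hit_le (fun z => green_nonneg z y) (fun z _ => ?_) (fun z _ => H.avg_green_le z y) n x
      simp only [mul_ite, mul_one, mul_zero, Finset.sum_ite_eq]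
      rw [H.green_symm y z]
      have := green_nonneg z y
      split_ifs <;> linarith
    have hmut := H.mutual_le hp s (fun _ => 1) (fun y => t * ν y)
    rw [energy_smul] at hmut
    have e5 : ∑ y ∈ s, t * ν y * M.pot s (fun _ => 1) y = t * ∑ y ∈ s, ν y * u y := by
      rw [Finset.mul_sum]; exact Finset.sum_congr rfl fun y _ => by rw [hu]; ring
    rw [e5] at hmut
    have hνu : ∑ y ∈ s, ν y * u y ≤ t / 2 * B * h + M.energy s (fun _ => 1) / (2 * t) := by
      have : t / 2 * B * h + M.energy s (fun _ => 1) / (2 * t) =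
          (t ^ 2 * (B * h) + M.energy s (fun _ => 1)) / (2 * t) := by field_simp
      rw [this, le_div_iff₀ (by positivity)]
      have := mul_le_mul_of_nonneg_left hEν (sq_nonneg t)
      linarith
    have hlow := le_hit_add (A := A) u0 (fun z hz =>
      (H.avg_pot_of_notMem (σ := fun _ => 1) fun h => hz (hsA z h)).ge) n x
    have hhu : M.hit A u n x ≤ ∑ y ∈ s, ν y * u y + β := by
      have e : ∑ y ∈ s, ν y * u y =
          M.hit A (fun z => ∑ y ∈ s, u y * if z = y then 1 else 0) n x := by
        rw [hit_sum]
        exact Finset.sum_congr rfl fun y _ => by rw [hit_smul, mul_comm]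
      have e' : M.hit A u n x ≤
          M.hit A (fun z => ∑ i : Bool, if i then (∑ y ∈ s, u y * if z = y then 1 else 0)
            else β) n x := by
        refine hit_mono (fun z hz => ?_) n x
        simp only [Fintype.sum_bool, if_true, Bool.false_eq_true, if_false, mul_ite, mul_one,
          mul_zero, Finset.sum_ite_eq]
        by_cases hzs : z ∈ s
        · simp only [hzs, if_true]; linarith
        · simp only [hzs, if_false]; linarith [h2 z (hAs z hz hzs)]
      refine e'.trans ?_
      rw [hit_sum, e]
      simp only [Fintype.sum_bool, if_true, Bool.false_eq_true, if_false]
      have : M.hit A (fun _ => β) n x ≤ β :=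
        hit_le (fun _ => hβ) (fun _ _ => le_rfl) (fun z _ => (H.avg_const β z).le) n x
      linarith
    have : t / 2 * B * h ≤
        t / 2 * B * (1 - M.hit A (fun y => if y ∈ s then 0 else 1) n₀ x) :=
      mul_le_mul_of_nonneg_left (by linarith) (by positivity)
    linarith
  have lim : Tendsto (fun n => t / 2 * B * (1 - M.hit A (fun y => if y ∈ s then 0 else 1) n₀ x) +
        M.energy s (fun _ => 1) / (2 * t) + β + M.avg^[n + 1] u x) atTop
      (𝓝 (t / 2 * B * (1 - M.hit A (fun y => if y ∈ s then 0 else 1) n₀ x) +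
        M.energy s (fun _ => 1) / (2 * t) + β + 0)) :=
    tendsto_const_nhds.add ((tendsto_add_atTop_iff_nat 1).2 (H.iterate_avg_pot_tendsto s _ x))
  rw [add_zero] at lim
  exact ge_of_tendsto lim (eventually_atTop.2 ⟨n₀, key⟩)

lemma Reg.sum_green_sq_two_pow (H : M.Reg K) (x : M.V) (k : ℕ) :
    ∑ y ∈ H.bl x (2 ^ k), M.green x y ^ 2 ≤ K ^ 3 * 2 ^ M.α * ((2 : ℝ) ^ k) ^ (M.α - 2) := by
  have hK := H.K_pos
  have hα := H.alpha
  induction k with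
  | zero =>
    have h1 : ∑ y ∈ H.bl x (2 ^ 0), M.green x y ^ 2 ≤ ∑ y ∈ H.bl x (2 ^ 0), K ^ 2 :=
      Finset.sum_le_sum fun y _ => pow_le_pow_left₀ (green_nonneg x y) (H.green_le x y) 2
    rw [Finset.sum_const, nsmul_eq_mul] at h1
    have h2 := H.card_bl_ub x (r := 2 ^ 0) (by norm_num)
    simp only [pow_zero, one_rpow, mul_one] at h1 h2 ⊢
    have h3 : (1 : ℝ) ≤ 2 ^ M.α := one_le_rpow (by norm_num) (by linarith)
    calc _ ≤ _ := h1
      _ ≤ K * K ^ 2 := by gcongr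
      _ = K ^ 3 * 1 := by ring
      _ ≤ _ := by gcongr
  | succ k ih =>
    have pk : (0 : ℝ) < 2 ^ k := by positivity
    have sub : H.bl x (2 ^ k) ⊆ H.bl x (2 ^ (k + 1)) := by
      intro y hy
      rw [H.mem_bl] at hy ⊢
      refine hy.trans ?_
      rw [pow_succ]; linarith
    rw [← Finset.sum_sdiff sub]
    have h1 : ∑ y ∈ H.bl x (2 ^ (k + 1)) \ H.bl x (2 ^ k), M.green x y ^ 2 ≤
        ∑ y ∈ H.bl x (2 ^ (k + 1)) \ H.bl x (2 ^ k), (K / 2 ^ k) ^ 2 := by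
      refine Finset.sum_le_sum fun y hy => pow_le_pow_left₀ (green_nonneg x y) ?_ 2
      rw [Finset.mem_sdiff, H.mem_bl, H.mem_bl, not_le] at hy
      exact H.green_ub' pk hy.2.le
    rw [Finset.sum_const, nsmul_eq_mul] at h1
    have h2 : ((H.bl x (2 ^ (k + 1)) \ H.bl x (2 ^ k)).card : ℝ) ≤
        K * ((2 : ℝ) ^ (k + 1)) ^ M.α :=
      le_trans (by exact_mod_cast Finset.card_le_card Finset.sdiff_subset)
        (H.card_bl_ub x (one_le_pow₀ (by norm_num)))
    have h3 : K * ((2 : ℝ) ^ (k + 1)) ^ M.α * (K / 2 ^ k) ^ 2 =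
        K ^ 3 * 2 ^ M.α * ((2 : ℝ) ^ k) ^ (M.α - 2) := by
      rw [pow_succ, mul_rpow pk.le (by norm_num), rpow_sub pk, rpow_two]
      field_simp
    have h4 : 2 * ((2 : ℝ) ^ k) ^ (M.α - 2) ≤ ((2 : ℝ) ^ (k + 1)) ^ (M.α - 2) := by
      rw [pow_succ, mul_rpow pk.le (by norm_num), mul_comm]
      have : (2 : ℝ) ^ (1 : ℝ) ≤ 2 ^ (M.α - 2) :=
        rpow_le_rpow_of_exponent_le (by norm_num) (by linarith)
      rw [rpow_one] at this
      gcongr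
    have h5 : (0 : ℝ) ≤ K ^ 3 * 2 ^ M.α := by positivity
    calc _ ≤ K * ((2 : ℝ) ^ (k + 1)) ^ M.α * (K / 2 ^ k) ^ 2 +
          K ^ 3 * 2 ^ M.α * ((2 : ℝ) ^ k) ^ (M.α - 2) := by
            refine add_le_add (h1.trans ?_) ih
            gcongr
      _ = K ^ 3 * 2 ^ M.α * (2 * ((2 : ℝ) ^ k) ^ (M.α - 2)) := by rw [h3]; ring
      _ ≤ _ := by gcongr

lemma Reg.sum_green_sq (H : M.Reg K) (x : M.V) {r : ℝ} (hr : 1 ≤ r) :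
    ∑ y ∈ H.bl x r, M.green x y ^ 2 ≤ K ^ 3 * 2 ^ M.α * (2 * r) ^ (M.α - 2) := by
  have hα := H.alpha
  have hK := H.K_pos
  obtain ⟨n, hn1, hn2⟩ := exists_nat_pow_near hr (one_lt_two)
  calc _ ≤ ∑ y ∈ H.bl x (2 ^ (n + 1)), M.green x y ^ 2 := by
        refine Finset.sum_le_sum_of_subset_of_nonneg (fun y hy => ?_) fun _ _ _ => sq_nonneg _
        rw [H.mem_bl] at hy ⊢
        exact hy.trans hn2.le
    _ ≤ _ := H.sum_green_sq_two_pow x (n + 1)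
    _ ≤ _ := by
        have : (2 : ℝ) ^ (n + 1) ≤ 2 * r := by rw [pow_succ]; linarith
        have : 0 ≤ M.α - 2 := by linarith
        gcongr

/-- Truncated hitting probabilities of single points are eventually comparable to the Green's
function. -/
lemma Reg.exists_walk_mem_ge (H : M.Reg K) (b : M.V) (A : Finset M.V) {r : ℝ} (hr : 1 ≤ r)
    (hA : ∀ y ∈ A, M.d b y ≤ r) :
    ∃ T, ∀ y ∈ A, 1 / (2 * K ^ 2 * r) ≤ (H.walk T b).E fun s => if y ∈ s then 1 else 0 := by
  have hK := H.K_pos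
  have ev : ∀ᶠ T in atTop, ∀ y ∈ A, M.greenTail (T + 1) b y ≤ 1 / (2 * K * r) := by
    rw [Filter.eventually_all_finset]
    intro y _
    have := (tendsto_add_atTop_iff_nat 1).2 (greenTail_tendsto (M := M) b y)
    exact (this.eventually (gt_mem_nhds (show 0 < 1 / (2 * K * r) by positivity))).mono
      fun _ h => h.le
  obtain ⟨T, hT⟩ := ev.exists
  refine ⟨T, fun y hy => ?_⟩
  have h := H.walk_hits {y} T b
  simp only [Set.mem_singleton_iff, exists_eq_right] at h
  rw [h]
  have h1 := le_hit_add (A := {y}) (u := fun z => M.green z y) (fun z => green_nonneg z y)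
    (fun z hz => (H.avg_green_of_ne hz).ge) T b
  have h2 : M.hit {y} (fun z => M.green z y) T b ≤ K * M.hit {y} (fun _ => 1) T b := by
    rw [← hit_smul]
    refine hit_mono (fun z hz => ?_) T b
    rw [mul_one]
    exact H.green_le z y
  rw [iterate_avg_greenTail H.summ] at h1
  have h3 := H.green_lb' hr (hA y hy)
  have h4 := hT y hy
  have h5 : K⁻¹ / r = 1 / (2 * K * r) + 1 / (2 * K * r) := by field_simp; norm_num
  have h6 : 1 / (2 * K ^ 2 * r) = 1 / (2 * K * r) / K := by field_simp
  rw [h6, div_le_iff₀ hK]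
  linarith

lemma Reg.trace_energy_le (H : M.Reg K) (b : M.V) (T : ℕ) (A : Finset M.V) {L r : ℝ} (hL : 0 < L)
    (hr : 1 ≤ r) (hA : ∀ y ∈ A, L ≤ M.d b y ∧ M.d b y ≤ r) :
    ((H.trace A T b).E fun s => M.energy s fun _ => 1) ≤
      2 * K ^ 3 / L * (A.card * (K ^ 3 * 2 ^ M.α * (4 * r) ^ (M.α - 2))) := by
  have hK := H.K_pos
  rw [Reg.trace, RSet.E_map]
  have e : ∀ s : Finset M.V, M.energy (s ∩ A) (fun _ => 1) =
      ∑ y ∈ A, ∑ z ∈ A, M.green y z * if y ∈ s ∧ z ∈ s then 1 else 0 := by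
    intro s
    rw [energy_eq, Finset.inter_comm, ← Finset.filter_mem_eq_inter, Finset.sum_filter]
    refine Finset.sum_congr rfl fun y _ => ?_
    rw [Finset.sum_filter]
    by_cases hy : y ∈ s <;> simp [hy]
  simp_rw [e, RSet.E_sum, RSet.E_mul_left]
  have h1 : ∀ y ∈ A, ∀ z ∈ A,
      M.green y z * ((H.walk T b).E fun s => if y ∈ s ∧ z ∈ s then 1 else 0) ≤
        2 * K ^ 3 / L * M.green y z ^ 2 := by
    intro y hy z hz
    have h2 := H.walk_mem_pair_le y z T b
    have h3 := H.green_ub' hL (hA y hy).1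
    have h4 := H.green_ub' hL (hA z hz).1
    have g0 := green_nonneg y z
    calc _ ≤ M.green y z * (K ^ 2 * M.green y z * (K / L + K / L)) := by
          refine mul_le_mul_of_nonneg_left (h2.trans ?_) g0
          gcongr
      _ = _ := by ring
  calc _ ≤ ∑ y ∈ A, ∑ z ∈ A, 2 * K ^ 3 / L * M.green y z ^ 2 :=
        Finset.sum_le_sum fun y hy => Finset.sum_le_sum fun z hz => h1 y hy z hz
    _ = 2 * K ^ 3 / L * ∑ y ∈ A, ∑ z ∈ A, M.green y z ^ 2 := by simp_rw [Finset.mul_sum]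
    _ ≤ 2 * K ^ 3 / L * ∑ y ∈ A, K ^ 3 * 2 ^ M.α * (4 * r) ^ (M.α - 2) := by
        refine mul_le_mul_of_nonneg_left (Finset.sum_le_sum fun y hy => ?_) (by positivity)
        have := H.sum_green_sq y (r := 2 * r) (by linarith)
        rw [show 2 * (2 * r) = 4 * r by ring] at this
        refine le_trans (Finset.sum_le_sum_of_subset_of_nonneg (fun z hz => ?_)
          fun _ _ _ => sq_nonneg _) this
        rw [H.mem_bl]
        have := M.d_triangle y b z
        rw [M.d_symm y b] at this
        linarith [(hA y hy).2, (hA z hz).2]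
    _ = _ := by rw [Finset.sum_const, nsmul_eq_mul]

set_option maxHeartbeats 1600000 in
/-- Existence of obstacles: the trace of a random walk on an annulus at scale `L` is hit, with
uniformly positive probability, by the walk started near the center before it leaves a larger
ball. -/
lemma Reg.exists_obstacle (H : M.Reg K) (hp : M.GreenPSD) :
    ∃ κ κ' c : ℝ, 3 ≤ κ ∧ κ ≤ κ' ∧ 0 < c ∧ c ≤ 1 ∧ ∀ L, 1 ≤ L → ∀ b, ∃ (A : Finset M.V) (T : ℕ),
      (∀ y ∈ A, 2 * L ≤ M.d b y ∧ M.d b y ≤ κ * L) ∧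
      ∀ x, M.d x b ≤ L → ∀ Λ : Set M.V, (∀ y, M.d b y < κ' * L → y ∈ Λ) → ∀ n,
        ((H.trace A T b).E fun s =>
          M.hit (↑s ∪ Λᶜ) (fun y => if y ∈ s then 0 else 1) n x) ≤ 1 - c := by
  have hK := H.K_pos
  have hK1 := H.one_le
  have hα := H.alpha
  have h2a : (1 : ℝ) ≤ 2 ^ M.α := one_le_rpow (by norm_num) (by linarith)
  set κ := 2 + K * (1 + K * 2 ^ M.α) with hκ
  have hKK : 1 ≤ K * (1 + K * 2 ^ M.α) := by
    have : 0 ≤ K * 2 ^ M.α := by positivity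
    exact one_le_mul_of_one_le_of_one_le hK1 (by linarith)
  have hκ3 : 3 ≤ κ := by linarith
  have hκ0 : 0 < κ := by linarith
  set κ' := κ + 2 * K ^ 2 * (κ + 1) with hκ'
  have hκκ : κ ≤ κ' := by
    have : 0 ≤ 2 * K ^ 2 * (κ + 1) := by positivity
    linarith
  set C₂ := 2 * K ^ 3 * (K * κ ^ M.α * (K ^ 3 * 2 ^ M.α * (4 * κ) ^ (M.α - 2))) with hC₂
  have hC₂0 : 0 < C₂ := by positivity
  set a₁ := 1 / (2 * K ^ 2 * κ) / (2 * K * (κ + 1)) with ha₁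
  have ha₁0 : 0 < a₁ := by positivity
  refine ⟨κ, κ', min 1 (a₁ ^ 2 / (C₂ * K)), hκ3, hκκ, lt_min one_pos (by positivity),
    min_le_left _ _, fun L hL b => ?_⟩
  have hL0 : 0 < L := by linarith
  have hκL : 1 ≤ κ * L := one_le_mul_of_one_le_of_one_le (by linarith) hL
  set A : Finset M.V := (H.bl b (κ * L)).filter fun y => 2 * L ≤ M.d b y with hA
  have hAmem : ∀ y ∈ A, 2 * L ≤ M.d b y ∧ M.d b y ≤ κ * L := by
    intro y hy
    rw [hA, Finset.mem_filter, H.mem_bl] at hy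
    exact ⟨hy.2, hy.1⟩
  set X := L ^ (M.α - 2) with hX
  have hX0 : 0 < X := rpow_pos_of_pos hL0 _
  have hLa : L ^ M.α = X * L ^ 2 := by
    rw [hX, ← rpow_natCast, ← rpow_add hL0]; norm_num
  have hcard_ub : (A.card : ℝ) ≤ K * κ ^ M.α * (X * L ^ 2) := by
    have h1 : (A.card : ℝ) ≤ (H.bl b (κ * L)).card := by
      exact_mod_cast Finset.card_le_card (Finset.filter_subset _ _)
    refine h1.trans ((H.card_bl_ub b hκL).trans (le_of_eq ?_))
    rw [mul_rpow hκ0.le hL0.le, hLa]; ring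
  have hcard_lb : X * L ^ 2 ≤ A.card := by
    have h1 : H.bl b (κ * L) ⊆ A ∪ H.bl b (2 * L) := by
      intro y hy
      rw [Finset.mem_union, H.mem_bl, hA, Finset.mem_filter]
      rcases le_total (2 * L) (M.d b y) with h | h
      · exact Or.inl ⟨hy, h⟩
      · exact Or.inr h
    have h2 : ((H.bl b (κ * L)).card : ℝ) ≤ A.card + (H.bl b (2 * L)).card := by
      exact_mod_cast (Finset.card_le_card h1).trans (Finset.card_union_le _ _)
    have h3 := H.card_bl_lb b hκL
    have h4 := H.card_bl_ub b (r := 2 * L) (by linarith)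
    rw [mul_rpow (by norm_num) hL0.le, hLa] at h4
    rw [mul_rpow hκ0.le hL0.le, hLa] at h3
    have h5 : 1 + K * 2 ^ M.α ≤ K⁻¹ * κ ^ M.α := by
      rw [le_inv_mul_iff₀ hK]
      have : κ ^ (1 : ℝ) ≤ κ ^ M.α := rpow_le_rpow_of_exponent_le (by linarith) (by linarith)
      rw [rpow_one] at this
      linarith
    have h6 : 0 < X * L ^ 2 := by positivity
    have := mul_le_mul_of_nonneg_right h5 h6.le
    linarith
  obtain ⟨T, hT⟩ := H.exists_walk_mem_ge b A hκL fun y hy => (hAmem y hy).2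
  refine ⟨A, T, hAmem, fun x hx Λ hΛ n => ?_⟩
  set Y := H.trace A T b with hY
  set q : M.V → ℝ := fun y => (H.walk T b).E fun s => if y ∈ s then 1 else 0 with hq
  have hYsum : ∀ f : M.V → ℝ, (Y.E fun s => ∑ y ∈ s, f y) = ∑ y ∈ A, f y * q y := by
    intro f
    rw [hY, Reg.trace, RSet.E_map]
    simp_rw [Finset.inter_comm _ A, ← Finset.filter_mem_eq_inter, Finset.sum_filter]
    rw [RSet.E_sum]
    refine Finset.sum_congr rfl fun y _ => ?_
    rw [hq, ← RSet.E_mul_left]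
    simp
  set m := Y.E fun s => (s.card : ℝ) with hm
  have hmq : m = ∑ y ∈ A, q y := by
    have := hYsum fun _ => 1
    simpa using this
  have q0 : ∀ y ∈ A, 1 / (2 * K ^ 2 * (κ * L)) ≤ q y := hT
  have hm_lb : 1 / (2 * K ^ 2 * κ) * (X * L) ≤ m := by
    rw [hmq]
    calc _ = X * L ^ 2 * (1 / (2 * K ^ 2 * (κ * L))) := by field_simp
      _ ≤ A.card * (1 / (2 * K ^ 2 * (κ * L))) := by gcongr
      _ = ∑ y ∈ A, 1 / (2 * K ^ 2 * (κ * L)) := by rw [Finset.sum_const, nsmul_eq_mul]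
      _ ≤ _ := Finset.sum_le_sum q0
  have hm0 : 0 < m := lt_of_lt_of_le (by positivity) hm_lb
  have hen : (Y.E fun s => M.energy s fun _ => 1) ≤ C₂ * X ^ 2 * L := by
    refine (H.trace_energy_le b T A (L := L) (r := κ * L) hL0 hκL
      fun y hy => ⟨by linarith [(hAmem y hy).1], (hAmem y hy).2⟩).trans ?_
    rw [← mul_assoc 4 κ L, mul_rpow (by positivity) hL0.le, ← hX]
    calc _ ≤ 2 * K ^ 3 / L * (K * κ ^ M.α * (X * L ^ 2) *
          (K ^ 3 * 2 ^ M.α * ((4 * κ) ^ (M.α - 2) * X))) := by gcongr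
      _ = _ := by rw [hC₂]; field_simp
  have hEu : m * (K⁻¹ / ((κ + 1) * L)) ≤ Y.E fun s => M.pot s (fun _ => 1) x := by
    unfold pot
    simp_rw [one_mul]
    rw [hYsum, hmq, Finset.sum_mul]
    refine Finset.sum_le_sum fun y hy => ?_
    have : K⁻¹ / ((κ + 1) * L) ≤ M.green x y := by
      refine H.green_lb' (one_le_mul_of_one_le_of_one_le (by linarith) hL) ?_
      have := M.d_triangle x b y
      linarith [(hAmem y hy).2]
    rw [mul_comm]
    refine mul_le_mul_of_nonneg_right this (le_trans ?_ (q0 y hy))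
    positivity
  set D := 1 - Y.E fun s => M.hit (↑s ∪ Λᶜ) (fun y => if y ∈ s then 0 else 1) n x with hD
  set t := C₂ / a₁ * (X * L) with ht
  have ht0 : 0 < t := by positivity
  have hmain : (Y.E fun s => M.pot s (fun _ => 1) x) ≤
      t / 2 * (K / L) * D + C₂ * X ^ 2 * L / (2 * t) + m * (K / ((κ' - κ) * L)) := by
    have hδ : 0 < κ' - κ := by
      have : 0 < 2 * K ^ 2 * (κ + 1) := by positivity
      linarith
    have step : (Y.E fun s => M.pot s (fun _ => 1) x) ≤ Y.E fun s =>
        t / 2 * (K / L) * (1 - M.hit (↑s ∪ Λᶜ) (fun y => if y ∈ s then 0 else 1) n x) +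
          (1 / (2 * t)) * M.energy s (fun _ => 1) + s.card * (K / ((κ' - κ) * L)) := by
      refine RSet.E_mono_of_mem fun i => ?_
      obtain ⟨s, hs⟩ : ∃ s, s = Y.s i := ⟨_, rfl⟩
      have hsA : s ⊆ A := by rw [hs]; exact Finset.inter_subset_right
      rw [← hs, one_div_mul_eq_div]
      refine H.pot_le_of_obstacle hp ht0 (by positivity) (fun y hy => ?_) (fun z hz => ?_)
        (by positivity) n
      · refine H.green_ub' hL0 ?_
        have := M.d_triangle b x y
        rw [M.d_symm b x] at this
        linarith [(hAmem y (hsA hy)).1]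
      · unfold pot
        simp_rw [one_mul]
        calc _ ≤ ∑ y ∈ s, K / ((κ' - κ) * L) := by
              refine Finset.sum_le_sum fun y hy => H.green_ub' (by positivity) ?_
              have h1 : κ' * L ≤ M.d b z := not_lt.1 fun h => hz (hΛ z h)
              have := M.d_triangle b y z
              rw [M.d_symm y z] at this
              linarith [(hAmem y (hsA hy)).2]
          _ = _ := by rw [Finset.sum_const, nsmul_eq_mul]
    refine step.trans ?_
    rw [RSet.E_add, RSet.E_add, RSet.E_mul_left, RSet.E_mul_left, RSet.E_mul_right, RSet.E_sub,
      RSet.E_const, ← hD, ← hm]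
    have : 1 / (2 * t) * (Y.E fun s => M.energy s fun _ => 1) ≤ C₂ * X ^ 2 * L / (2 * t) := by
      rw [one_div_mul_eq_div]
      gcongr
    linarith
  have e1 : m * (K / ((κ' - κ) * L)) = m * (K⁻¹ / ((κ + 1) * L)) / 2 := by
    rw [show κ' - κ = 2 * K ^ 2 * (κ + 1) by rw [hκ']; ring]
    field_simp
  have e2 : t / 2 * (K / L) * D = X * (C₂ * K / (2 * a₁) * D) := by
    rw [ht]; field_simp
  have e3 : C₂ * X ^ 2 * L / (2 * t) = X * (a₁ / 2) := by
    rw [ht]; field_simp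
  have e4 : X * a₁ ≤ m * (K⁻¹ / ((κ + 1) * L)) / 2 := by
    calc X * a₁ = 1 / (2 * K ^ 2 * κ) * (X * L) * (K⁻¹ / ((κ + 1) * L)) / 2 := by
          rw [ha₁]; field_simp
      _ ≤ _ := by gcongr
  have e5 : X * a₁ ≤ X * (C₂ * K / (2 * a₁) * D + a₁ / 2) := by
    rw [mul_add, ← e2, ← e3]; linarith
  have e6 : a₁ / 2 ≤ C₂ * K / (2 * a₁) * D := by
    have := le_of_mul_le_mul_left e5 hX0
    linarith
  have e7 : a₁ ^ 2 / (C₂ * K) ≤ D := by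
    rw [div_le_iff₀ (by positivity)]
    calc a₁ ^ 2 = 2 * a₁ * (a₁ / 2) := by ring
      _ ≤ 2 * a₁ * (C₂ * K / (2 * a₁) * D) := by gcongr
      _ = D * (C₂ * K) := by field_simp
  have := min_le_right 1 (a₁ ^ 2 / (C₂ * K))
  linarith

end WGraph

/-! ## Obstacles on many levels -/

namespace RSet

variable {V : Type}

/-- Independent unions over a finite family. -/
lemma exists_iUnion (B : Finset V) (X : V → RSet V) : ∃ Z : RSet V,
    (∀ i, ∀ y ∈ Z.s i, ∃ b ∈ B, ∃ j, y ∈ (X b).s j) ∧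
    (∀ b ∈ B, ∀ Φ : Finset V → ℝ, Antitone Φ → Z.E Φ ≤ (X b).E Φ) ∧
    ∀ S, Z.hitProb S ≤ ∑ b ∈ B, (X b).hitProb S := by
  induction B using Finset.induction_on with
  | empty =>
    refine ⟨pure ∅, fun i y hy => ?_, by simp, fun S => ?_⟩
    · exact absurd (show y ∈ (∅ : Finset V) from hy) (Finset.notMem_empty y)
    · rw [hitProb, E_pure]; simp
  | insert a B ha ih =>
    obtain ⟨Z, hZ1, hZ2, hZ3⟩ := ih
    refine ⟨(X a).union Z, fun i y hy => ?_, fun b hb Φ hΦ => ?_, fun S => ?_⟩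
    · rcases Finset.mem_union.1 (show y ∈ (X a).s i.1 ∪ Z.s i.2 from hy) with h | h
      · exact ⟨a, Finset.mem_insert_self _ _, i.1, h⟩
      · obtain ⟨b, hb, j, hj⟩ := hZ1 _ _ h
        exact ⟨b, Finset.mem_insert_of_mem hb, j, hj⟩
    · rw [E_union]
      rcases Finset.mem_insert.1 hb with rfl | hb
      · refine E_mono fun s => ?_
        rw [← Z.E_const (Φ s)]
        exact E_mono fun t => hΦ Finset.subset_union_left
      · rw [← (X a).E_const ((X b).E Φ)]
        refine E_mono fun s => le_trans (E_mono fun t => hΦ Finset.subset_union_right)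
          (hZ2 b hb Φ hΦ)
    · rw [Finset.sum_insert ha]
      exact (hitProb_union_le _ _ S).trans (by gcongr; exact hZ3 S)

end RSet

namespace WGraph

variable {M : WGraph} {K : ℝ}

/-- Probability that the walk leaves `Λ` within `n` steps before hitting `S`. -/
def esc (M : WGraph) (S : Finset M.V) (Λ : Set M.V) (n : ℕ) (x : M.V) : ℝ :=
  M.hit (↑S ∪ Λᶜ) (fun y => if y ∈ S then 0 else 1) n x

lemma hit_le_of_boundary {A : Set M.V} {F G : M.V → ℝ}
    (h : ∀ y ∈ A, ∀ z ∉ A, y ∈ M.nb z → F y ≤ G y) (n : ℕ) :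
    ∀ x ∉ A, M.hit A F n x ≤ M.hit A G n x := by
  induction n with
  | zero => intro x hx; rw [hit_zero hx, hit_zero hx]
  | succ n ih =>
    intro x hx
    rw [hit_succ hx, hit_succ hx]
    refine avg_mono fun y hy => ?_
    by_cases hyA : y ∈ A
    · rw [hit_of_mem hyA, hit_of_mem hyA]; exact h y hyA x hx hy
    · exact ih y hyA

lemma esc_of_mem {S : Finset M.V} {Λ : Set M.V} {x : M.V} (hx : x ∈ S) (n : ℕ) :
    M.esc S Λ n x = 0 := by
  rw [esc, hit_of_mem (Or.inl hx), if_pos hx]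

lemma esc_of_notMem {S : Finset M.V} {Λ : Set M.V} {x : M.V} (hx : x ∉ S) (hΛ : x ∉ Λ) (n : ℕ) :
    M.esc S Λ n x = 1 := by
  rw [esc, hit_of_mem (Or.inr hΛ), if_neg hx]

lemma esc_zero {S : Finset M.V} {Λ : Set M.V} {x : M.V} (hx : x ∉ S) (hΛ : x ∈ Λ) :
    M.esc S Λ 0 x = 0 := by
  rw [esc, hit_zero]
  rintro (h | h)
  exacts [hx h, h hΛ]

lemma esc_succ {S : Finset M.V} {Λ : Set M.V} {x : M.V} (hx : x ∉ S) (hΛ : x ∈ Λ) (n : ℕ) :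
    M.esc S Λ (n + 1) x = M.avg (M.esc S Λ n) x := by
  rw [esc, hit_succ]
  · rfl
  rintro (h | h)
  exacts [hx h, h hΛ]

lemma esc_nonneg (S : Finset M.V) (Λ : Set M.V) (n : ℕ) (x : M.V) : 0 ≤ M.esc S Λ n x :=
  hit_nonneg (fun y _ => by split_ifs <;> norm_num) n x

lemma Reg.esc_le_one (H : M.Reg K) (S : Finset M.V) (Λ : Set M.V) (n : ℕ) (x : M.V) :
    M.esc S Λ n x ≤ 1 :=
  hit_le (u := fun _ => 1) (fun _ => zero_le_one) (fun y _ => by split_ifs <;> norm_num)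
    (fun y _ => (H.avg_const 1 y).le) n x

lemma esc_monotone (S : Finset M.V) (Λ : Set M.V) (x : M.V) : Monotone fun n => M.esc S Λ n x :=
  hit_monotone (fun y _ => by split_ifs <;> norm_num) x

/-- The strong Markov inequality at the exit from a smaller domain. -/
lemma esc_le_hit {S S₁ S₂ : Finset M.V} {Λ' Λ : Set M.V} (h1 : S₁ ⊆ S)
    (h2 : S₂ ⊆ S) (hΛ : Λ' ⊆ Λ) {m N : ℕ} (hmN : m ≤ N) (x : M.V) :
    M.esc S Λ m x ≤
      M.hit (↑S₁ ∪ Λ'ᶜ) (fun y => if y ∈ S₁ then 0 else M.esc S₂ Λ N y) m x := by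
  have anti : ∀ m x, M.esc S Λ m x ≤ M.esc S₂ Λ m x := by
    intro m
    induction m with
    | zero =>
      intro x
      by_cases hx : x ∈ S
      · rw [esc_of_mem hx]; exact esc_nonneg _ _ _ _
      by_cases hxΛ : x ∈ Λ
      · rw [esc_zero hx hxΛ]; exact esc_nonneg _ _ _ _
      · rw [esc_of_notMem hx hxΛ, esc_of_notMem (fun h => hx (h2 h)) hxΛ]
    | succ m ih =>
      intro x
      by_cases hx : x ∈ S
      · rw [esc_of_mem hx]; exact esc_nonneg _ _ _ _
      by_cases hxΛ : x ∈ Λ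
      · rw [esc_succ hx hxΛ, esc_succ (fun h => hx (h2 h)) hxΛ]
        exact avg_mono fun y _ => ih y
      · rw [esc_of_notMem hx hxΛ, esc_of_notMem (fun h => hx (h2 h)) hxΛ]
  have nn : ∀ n x, 0 ≤ M.hit (↑S₁ ∪ Λ'ᶜ) (fun y => if y ∈ S₁ then 0 else M.esc S₂ Λ N y) n x :=
    fun n x => hit_nonneg (fun y _ => by split_ifs; exacts [le_rfl, esc_nonneg _ _ _ _]) n x
  induction m generalizing x with
  | zero =>
    by_cases hx : x ∈ S
    · rw [esc_of_mem hx]; exact nn _ _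
    by_cases hxΛ : x ∈ Λ'
    · rw [esc_zero hx (hΛ hxΛ)]; exact nn _ _
    · rw [hit_of_mem (Or.inr hxΛ), if_neg fun h => hx (h1 h)]
      exact (anti _ _).trans (esc_monotone _ _ _ hmN)
  | succ m ih =>
    by_cases hx : x ∈ S
    · rw [esc_of_mem hx]; exact nn _ _
    by_cases hxΛ : x ∈ Λ'
    · rw [esc_succ hx (hΛ hxΛ), hit_succ]
      · exact avg_mono fun y _ => ih (by omega) y
      · rintro (h | h)
        exacts [hx (h1 h), h hxΛ]
    · rw [hit_of_mem (Or.inr hxΛ), if_neg fun h => hx (h1 h)]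
      exact (anti _ _).trans (esc_monotone _ _ _ hmN)

lemma Reg.esc_antitone (H : M.Reg K) (Λ : Set M.V) (m : ℕ) (x : M.V) :
    Antitone fun S => M.esc S Λ m x := by
  intro S T hST
  have := esc_le_hit (S := T) (S₁ := S) (S₂ := S) hST hST (subset_refl Λ) (le_refl m) x
  refine this.trans (hit_mono (fun y hy => ?_) m x)
  split_ifs with h
  · exact le_rfl
  · exact H.esc_le_one _ _ _ _

/-- One more level of obstacles multiplies the escape probability by `1 - c`. -/
lemma esc_union_le {X Y : RSet M.V} {Λ' Λ : Set M.V} (hΛ : Λ' ⊆ Λ)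
    {m : ℕ} {x : M.V} {p q : ℝ} (hp : 0 ≤ p) (hx : x ∈ Λ')
    (hX : X.E (fun s => M.esc s Λ' m x) ≤ q)
    (hY : ∀ y ∉ Λ', ∀ z ∈ Λ', y ∈ M.nb z → Y.E (fun s => M.esc s Λ m y) ≤ p) :
    (X.E fun s => Y.E fun t => M.esc (s ∪ t) Λ m x) ≤ p * q := by
  refine le_trans ?_ (mul_le_mul_of_nonneg_left hX hp)
  rw [← RSet.E_mul_left]
  refine RSet.E_mono fun s => ?_
  calc (Y.E fun t => M.esc (s ∪ t) Λ m x)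
      ≤ Y.E fun t => M.hit (↑s ∪ Λ'ᶜ) (fun y => if y ∈ s then 0 else M.esc t Λ m y) m x :=
        RSet.E_mono fun t => esc_le_hit Finset.subset_union_left Finset.subset_union_right hΛ
          le_rfl x
    _ = M.hit (↑s ∪ Λ'ᶜ) (fun y => if y ∈ s then 0 else Y.E fun t => M.esc t Λ m y) m x := by
        simp only [RSet.E]
        simp_rw [← hit_smul]
        rw [← hit_sum]
        refine hit_congr (fun y _ => ?_) m x
        split_ifs <;> simp
    _ ≤ M.hit (↑s ∪ Λ'ᶜ) (fun y => p * if y ∈ s then 0 else 1) m x := by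
        by_cases hxs : x ∈ s
        · rw [hit_of_mem (Or.inl hxs), hit_of_mem (Or.inl hxs), if_pos hxs, if_pos hxs, mul_zero]
        refine hit_le_of_boundary (fun y hy z hz hyz => ?_) m x ?_
        · split_ifs with h
          · simp
          rw [mul_one]
          refine hY y (hy.resolve_left h) z ?_ hyz
          by_contra hzΛ
          exact hz (Or.inr hzΛ)
        · rintro (h | h)
          exacts [hxs h, h hx]
    _ = p * M.esc s Λ' m x := hit_smul _ _ _ _ _

lemma exists_net (D : Finset M.V) (L : ℝ) (hL : 0 ≤ L) : ∃ B ⊆ D,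
    (∀ b ∈ B, ∀ b' ∈ B, b ≠ b' → L < M.d b b') ∧ ∀ x ∈ D, ∃ b ∈ B, M.d x b ≤ L := by
  induction D using Finset.induction_on with
  | empty => exact ⟨∅, subset_rfl, by simp, by simp⟩
  | insert a D ha ih =>
    obtain ⟨B, hBD, h1, h2⟩ := ih
    by_cases h : ∃ b ∈ B, M.d a b ≤ L
    · refine ⟨B, hBD.trans (Finset.subset_insert _ _), h1, fun x hx => ?_⟩
      rcases Finset.mem_insert.1 hx with rfl | hx
      exacts [h, h2 x hx]
    · push Not at h
      refine ⟨insert a B, Finset.insert_subset_insert a hBD, fun b hb b' hb' hne => ?_,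
        fun x hx => ?_⟩
      · rcases Finset.mem_insert.1 hb with e | hb <;> rcases Finset.mem_insert.1 hb' with e' | hb'
        · exact absurd (e.trans e'.symm) hne
        · rw [e]; exact h b' hb'
        · rw [M.d_symm, e']; exact h b hb
        · exact h1 b hb b' hb' hne
      · rcases Finset.mem_insert.1 hx with rfl | hx
        · exact ⟨x, Finset.mem_insert_self _ _, by rw [M.d_self]; exact hL⟩
        · obtain ⟨b, hb, hxb⟩ := h2 x hx
          exact ⟨b, Finset.mem_insert_of_mem hb, hxb⟩

lemma Reg.card_net_le (H : M.Reg K) {B : Finset M.V} {L ρ : ℝ} (hL : 2 ≤ L) (hρ : 1 ≤ ρ)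
    (hB : ∀ b ∈ B, ∀ b' ∈ B, b ≠ b' → L < M.d b b') (b : M.V) :
    ((B.filter fun b' => M.d b b' ≤ ρ * L).card : ℝ) ≤ K ^ 2 * (2 * (ρ + 1)) ^ M.α := by
  have hK := H.K_pos
  have hL0 : 0 < L := by linarith
  set F := B.filter fun b' => M.d b b' ≤ ρ * L with hF
  have hdisj : (F : Set M.V).PairwiseDisjoint fun b' => H.bl b' (L / 2) := by
    intro x hx y hy hxy
    refine Finset.disjoint_left.2 fun z hz1 hz2 => ?_
    rw [H.mem_bl] at hz1 hz2
    have h1 := hB x (Finset.mem_filter.1 hx).1 y (Finset.mem_filter.1 hy).1 hxy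
    have := M.d_triangle x z y
    rw [M.d_symm z y] at this
    linarith
  have hsub : F.biUnion (fun b' => H.bl b' (L / 2)) ⊆ H.bl b ((ρ + 1) * L) := by
    intro z hz
    obtain ⟨b', hb', hz⟩ := Finset.mem_biUnion.1 hz
    rw [H.mem_bl] at hz ⊢
    have := M.d_triangle b b' z
    have := (Finset.mem_filter.1 hb').2
    linarith
  have h1 : (((F.biUnion fun b' => H.bl b' (L / 2)).card : ℕ) : ℝ) ≤
      (H.bl b ((ρ + 1) * L)).card := by exact_mod_cast Finset.card_le_card hsub
  rw [Finset.card_biUnion hdisj] at h1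
  have h2 : (F.card : ℝ) * (K⁻¹ * (L / 2) ^ M.α) ≤ K * ((ρ + 1) * L) ^ M.α := by
    calc _ = ∑ b' ∈ F, K⁻¹ * (L / 2) ^ M.α := by rw [Finset.sum_const, nsmul_eq_mul]
      _ ≤ ∑ b' ∈ F, ((H.bl b' (L / 2)).card : ℝ) :=
          Finset.sum_le_sum fun b' _ => H.card_bl_lb b' (by linarith)
      _ ≤ _ := by
          rw [← Nat.cast_sum]
          exact h1.trans (H.card_bl_ub b (one_le_mul_of_one_le_of_one_le (by linarith)
            (by linarith)))
  have h3 : ((ρ + 1) * L) ^ M.α = (2 * (ρ + 1)) ^ M.α * (L / 2) ^ M.α := by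
    rw [← mul_rpow (by linarith) (by linarith)]; congr 1; ring
  have hpos : 0 < (L / 2) ^ M.α := rpow_pos_of_pos (by linarith) _
  rw [h3] at h2
  have h4 : (F.card : ℝ) * K⁻¹ ≤ K * (2 * (ρ + 1)) ^ M.α :=
    le_of_mul_le_mul_right (by linarith) hpos
  rw [← div_eq_mul_inv, div_le_iff₀ hK] at h4
  linarith

/-- Random obstacles on `n` levels around `o`: the walk from `o` crosses all of them with
exponentially small probability. -/
lemma Reg.exists_levels (H : M.Reg K) (hp : M.GreenPSD) :
    ∃ κ C₁ c N₀ : ℝ, 3 ≤ κ ∧ 1 ≤ C₁ ∧ 0 < c ∧ c ≤ 1 ∧ 0 ≤ N₀ ∧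
      ∀ L, 2 ≤ L → ∀ (o : M.V) (n : ℕ),
        ∃ (X : RSet M.V) (B : Finset M.V) (A : M.V → Finset M.V) (T : M.V → ℕ),
          (∀ b ∈ B, ∀ y ∈ A b, 2 * L ≤ M.d b y ∧ M.d b y ≤ κ * L) ∧
          (∀ i, ∀ y ∈ X.s i, M.d o y < n * (C₁ * L)) ∧
          (∀ m, X.E (fun s => M.esc s {y | M.d o y < n * (C₁ * L)} m o) ≤ (1 - c) ^ n) ∧
          (∀ S, X.hitProb S ≤ ∑ b ∈ B, (H.trace (A b) (T b) b).hitProb S) ∧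
          ∀ b, ((B.filter fun b' => M.d b b' ≤ (2 * κ + 1) * L).card : ℝ) ≤ N₀ := by
  have hK := H.K_pos
  obtain ⟨κ, κ', c, hκ, hκκ, hc, hc1, hobs⟩ := H.exists_obstacle hp
  refine ⟨κ, K + κ' + 2, c, K ^ 2 * (2 * (2 * κ + 1 + 1)) ^ M.α, hκ, by linarith, hc, hc1,
    by positivity, fun L hL o n => ?_⟩
  choose A T hA hT using hobs L (by linarith)
  set w := (K + κ' + 2) * L with hw
  have hKL : K ≤ K * L := le_mul_of_one_le_right hK.le (by linarith)
  have hκL : κ * L ≤ κ' * L := by gcongr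
  have hκL3 : 3 * L ≤ κ * L := by gcongr
  have hw' : w = K * L + κ' * L + 2 * L := by rw [hw]; ring
  obtain ⟨N, -, hsep, hcov⟩ := exists_net (H.bl o (n * w + K)) L (by linarith)

  have key : ∀ k ≤ n, ∃ X : RSet M.V,
      (∀ i, ∀ y ∈ X.s i, M.d o y < n * w) ∧
      (∀ x, ((n - k : ℕ) : ℝ) * w ≤ M.d o x → M.d o x ≤ ((n - k : ℕ) : ℝ) * w + K → ∀ m,
        X.E (fun s => M.esc s {y | M.d o y < n * w} m x) ≤ (1 - c) ^ k) ∧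
      ∀ S, X.hitProb S ≤ ∑ b ∈ N.filter (fun b => ((n - k : ℕ) : ℝ) * w - L ≤ M.d o b),
        (H.trace (A b) (T b) b).hitProb S := by
    intro k
    induction k with
    | zero =>
      intro _
      refine ⟨RSet.pure ∅, fun i y hy => absurd (show y ∈ (∅ : Finset M.V) from hy)
        (Finset.notMem_empty y), fun x _ _ m => ?_, fun S => ?_⟩
      · rw [RSet.E_pure, pow_zero]; exact H.esc_le_one _ _ _ _
      · rw [RSet.hitProb, RSet.E_pure]
        simp only [Finset.empty_inter, Finset.not_nonempty_empty, if_false]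
        exact Finset.sum_nonneg fun b _ => RSet.hitProb_nonneg _ _
    | succ k ih =>
      intro hk
      obtain ⟨Y, hY1, hY2, hY3⟩ := ih (by omega)
      have hj : n - k = n - (k + 1) + 1 := by omega
      have hjn : ((n - (k + 1) : ℕ) : ℝ) + 1 ≤ n := by
        have : n - (k + 1) + 1 ≤ n := by omega
        exact_mod_cast this
      obtain ⟨j, hjdef⟩ : ∃ j, j = n - (k + 1) := ⟨_, rfl⟩
      rw [hj, ← hjdef] at hY2 hY3
      rw [← hjdef] at hjn ⊢
      push_cast at hY2 hY3
      have hw0 : 0 < w := by linarith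
      have hjw : ((j : ℝ) + 1) * w ≤ n * w := by gcongr
      obtain ⟨X, hX1, hX2, hX3⟩ := RSet.exists_iUnion
        (N.filter fun b => (j : ℝ) * w - L ≤ M.d o b ∧ M.d o b ≤ j * w + K + L)
        fun b => H.trace (A b) (T b) b
      refine ⟨X.union Y, fun i y hy => ?_, fun x hx1 hx2 m => ?_, fun S => ?_⟩
      · rcases Finset.mem_union.1 (show y ∈ X.s i.1 ∪ Y.s i.2 from hy) with h | h
        · obtain ⟨b, hb, i', hi'⟩ := hX1 _ _ h
          have hyA : y ∈ A b := Finset.inter_subset_right (s₁ := (H.walk (T b) b).s i') hi'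
          have h1 := (hA b y hyA).2
          have h2 := (Finset.mem_filter.1 hb).2.2
          have := M.d_triangle o b y
          linarith
        · exact hY1 _ _ h
      · rw [RSet.E_union, pow_succ]
        refine esc_union_le (Λ' := {y | M.d o y < ((j : ℝ) + 1) * w}) (fun y hy => ?_)
          (pow_nonneg (by linarith) k) ?_ ?_ (fun y hy z hz hyz => ?_)
        · exact lt_of_lt_of_le hy hjw
        · show M.d o x < _
          linarith
        · obtain ⟨b, hb, hxb⟩ := hcov x (by rw [H.mem_bl]; linarith)
          have t1 := M.d_triangle o x b
          have t2 := M.d_triangle o b x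
          rw [M.d_symm b x] at t2
          refine (hX2 b (Finset.mem_filter.2 ⟨hb, by linarith, by linarith⟩) _
            (H.esc_antitone _ m x)).trans ?_
          refine hT b x hxb _ (fun y hy => ?_) m
          show M.d o y < _
          have := M.d_triangle o b y
          linarith
        · have hy' : ((j : ℝ) + 1) * w ≤ M.d o y := not_lt.1 hy
          refine hY2 y hy' ?_ m
          have h1 := H.jump z y (lam_pos_of_mem hyz)
          have h2 := M.d_triangle o z y
          have h3 : M.d o z < ((j : ℝ) + 1) * w := hz
          linarith
      · refine (RSet.hitProb_union_le _ _ S).trans ((add_le_add (hX3 S) (hY3 S)).trans ?_)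
        rw [← Finset.sum_union]
        · refine Finset.sum_le_sum_of_subset_of_nonneg (fun b hb => ?_)
            fun b _ _ => RSet.hitProb_nonneg _ _
          rcases Finset.mem_union.1 hb with h | h <;> rw [Finset.mem_filter] at h ⊢
          · exact ⟨h.1, h.2.1⟩
          · exact ⟨h.1, by linarith [h.2]⟩
        · refine Finset.disjoint_left.2 fun b h1 h2 => ?_
          have h3 := (Finset.mem_filter.1 h1).2.2
          have h4 := (Finset.mem_filter.1 h2).2
          linarith
  obtain ⟨X, hX1, hX2, hX3⟩ := key n le_rfl
  refine ⟨X, N.filter (fun b => ((n - n : ℕ) : ℝ) * w - L ≤ M.d o b), A, T, fun b _ => hA b, hX1,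
    fun m => hX2 o ?_ ?_ m, hX3, fun b => ?_⟩
  · simp [M.d_self]
  · simp [M.d_self, hK.le]
  · refine le_trans ?_ (H.card_net_le hL (by linarith) hsep b)
    exact_mod_cast Finset.card_le_card (Finset.filter_subset_filter _ (Finset.filter_subset _ _))

end WGraph

/-! ## A shift inequality for Gaussian integrals of Laplace-type products -/

section Shift

variable {κ : Type} [Fintype κ]

lemma mul_le_half_sq_add_sq (a b : ℝ≥0∞) : a * b ≤ 2⁻¹ * (a * a + b * b) := by
  rcases eq_or_ne a ⊤ with rfl | ha
  · simp [ENNReal.mul_top]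
  rcases eq_or_ne b ⊤ with rfl | hb
  · simp [ENNReal.mul_top]
  lift a to ℝ≥0 using ha
  lift b to ℝ≥0 using hb
  rw [← ENNReal.coe_two, ← ENNReal.coe_inv two_ne_zero]
  norm_cast
  rw [← NNReal.coe_le_coe]
  push_cast
  nlinarith [sq_nonneg ((a : ℝ) - b)]

/-- Integrals of products of two autocorrelations are maximal without shift. -/
lemma lintegral_autocorr_shift_le {g v : (κ → ℝ) → ℝ≥0∞} (hg : Measurable g) (hv : Measurable v)
    (ψ : κ → ℝ) :
    ∫⁻ y, (∫⁻ z, g (y + z) * g z) * ∫⁻ z, v (y + ψ + z) * v z ≤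
      ∫⁻ y, (∫⁻ z, g (y + z) * g z) * ∫⁻ z, v (y + z) * v z := by
  obtain ⟨U, hU⟩ : ∃ U : (κ → ℝ) → ℝ≥0∞, U = fun t => ∫⁻ z, g z * v (z + t) := ⟨_, rfl⟩
  have hUm : Measurable U := by
    rw [hU]
    exact Measurable.lintegral_prod_right' (f := fun p : (κ → ℝ) × (κ → ℝ) => g p.2 * v (p.2 + p.1))
      (by fun_prop)
  have key : ∀ ψ : κ → ℝ, ∫⁻ y, (∫⁻ z, g (y + z) * g z) * ∫⁻ z, v (y + ψ + z) * v z =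
      ∫⁻ t, U (t + ψ) * U t := by
    intro ψ
    calc ∫⁻ y, (∫⁻ z, g (y + z) * g z) * ∫⁻ z, v (y + ψ + z) * v z
        = ∫⁻ y, ∫⁻ z, ∫⁻ t, g (y + z) * g z * (v (y + ψ + (z + t)) * v (z + t)) := by
          refine lintegral_congr fun y => ?_
          rw [← lintegral_mul_const _ (by fun_prop)]
          refine lintegral_congr fun z => ?_
          rw [← lintegral_const_mul _ (by fun_prop)]
          rw [← lintegral_add_left_eq_self _ z]
      _ = ∫⁻ z, ∫⁻ t, ∫⁻ y, g (y + z) * g z * (v (y + ψ + (z + t)) * v (z + t)) := by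
          rw [lintegral_lintegral_swap]
          · refine lintegral_congr fun z => ?_
            rw [lintegral_lintegral_swap]
            fun_prop
          · refine Measurable.aemeasurable ?_
            exact Measurable.lintegral_prod_right'
              (f := fun p : ((κ → ℝ) × (κ → ℝ)) × (κ → ℝ) => g (p.1.1 + p.1.2) * g p.1.2 *
                (v (p.1.1 + ψ + (p.1.2 + p.2)) * v (p.1.2 + p.2))) (by fun_prop)
      _ = ∫⁻ z, ∫⁻ t, U (t + ψ) * (g z * v (z + t)) := by
          refine lintegral_congr fun z => lintegral_congr fun t => ?_
          rw [hU, ← lintegral_mul_const _ (by fun_prop),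
            ← lintegral_add_right_eq_self (fun a => g a * v (a + (t + ψ)) * (g z * v (z + t))) z]
          refine lintegral_congr fun y => ?_
          rw [show y + z + (t + ψ) = y + ψ + (z + t) by abel]
          ring
      _ = ∫⁻ t, U (t + ψ) * U t := by
          rw [lintegral_lintegral_swap (by fun_prop)]
          refine lintegral_congr fun t => ?_
          rw [lintegral_const_mul _ (by fun_prop), hU]
  have h0 := key 0
  simp only [add_zero] at h0
  rw [key, h0]
  calc ∫⁻ t, U (t + ψ) * U t ≤ ∫⁻ t, 2⁻¹ * (U (t + ψ) * U (t + ψ) + U t * U t) :=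
        lintegral_mono fun t => mul_le_half_sq_add_sq _ _
    _ = ∫⁻ t, U t * U t := by
        rw [lintegral_const_mul _ (by fun_prop), lintegral_add_left (by fun_prop),
          lintegral_add_right_eq_self (fun t => U t * U t) ψ, ← two_mul, ← mul_assoc,
          ENNReal.inv_mul_cancel two_ne_zero ENNReal.ofNat_ne_top, one_mul]

/-- One-sided exponential. -/
def oneSided (s z : ℝ) : ℝ := if 0 < z then exp (-(s * z)) else 0

lemma oneSided_nonneg (s z : ℝ) : 0 ≤ oneSided s z := by
  unfold oneSided; split_ifs; exacts [(exp_pos _).le, le_rfl]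

lemma measurable_oneSided (s : ℝ) : Measurable (oneSided s) :=
  Measurable.ite measurableSet_Ioi (by fun_prop) measurable_const

lemma oneSided_corr {s : ℝ} (hs : 0 < s) (y : ℝ) :
    Integrable (fun z => oneSided s (y + z) * oneSided s z) ∧
    ∫ z, oneSided s (y + z) * oneSided s z = (2 * s)⁻¹ * exp (-(s * |y|)) := by
  have e : (fun z => oneSided s (y + z) * oneSided s z) =
      (Set.Ioi (max 0 (-y))).indicator fun z => exp (-(s * y)) * exp (-(2 * s) * z) := by
    funext z
    unfold oneSided
    rw [Set.indicator_apply]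
    by_cases h1 : 0 < z <;> by_cases h2 : 0 < y + z
    · rw [if_pos h2, if_pos h1, if_pos (Set.mem_Ioi.2 (max_lt h1 (by linarith))), ← exp_add,
        ← exp_add]
      congr 1; ring
    · rw [if_neg h2, zero_mul, if_neg]
      intro h; exact h2 (by linarith [(max_lt_iff.1 (Set.mem_Ioi.1 h)).2])
    · rw [if_neg h1, mul_zero, if_neg]
      intro h; exact h1 (max_lt_iff.1 (Set.mem_Ioi.1 h)).1
    · rw [if_neg h1, mul_zero, if_neg]
      intro h; exact h1 (max_lt_iff.1 (Set.mem_Ioi.1 h)).1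
  rw [e]
  refine ⟨?_, ?_⟩
  · rw [integrable_indicator_iff measurableSet_Ioi]
    exact (integrableOn_exp_mul_Ioi (by linarith) _).const_mul _
  · rw [integral_indicator measurableSet_Ioi, integral_const_mul,
      integral_exp_mul_Ioi (by linarith)]
    rw [show (2 * s)⁻¹ * exp (-(s * |y|)) = exp (-(s * |y|)) / (2 * s) by field_simp,
      neg_div_neg_eq, ← mul_div_assoc, ← exp_add]
    congr 2
    rcases le_total 0 y with h | h
    · rw [abs_of_nonneg h, max_eq_left (by linarith)]; ring
    · rw [abs_of_nonpos h, max_eq_right (by linarith)]; ring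

lemma lintegral_prod_oneSided {s : κ → ℝ} (hs : ∀ i, 0 < s i) (y : κ → ℝ) :
    ∫⁻ z : κ → ℝ, ENNReal.ofReal (∏ i, oneSided (s i) ((y + z) i)) *
        ENNReal.ofReal (∏ i, oneSided (s i) (z i)) =
      ENNReal.ofReal (∏ i, (2 * s i)⁻¹) * ENNReal.ofReal (exp (-∑ i, s i * |y i|)) := by
  have h1 : ∀ z : κ → ℝ, ENNReal.ofReal (∏ i, oneSided (s i) ((y + z) i)) *
      ENNReal.ofReal (∏ i, oneSided (s i) (z i)) =
      ENNReal.ofReal (∏ i, (oneSided (s i) (y i + z i) * oneSided (s i) (z i))) := by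
    intro z
    rw [← ENNReal.ofReal_mul (Finset.prod_nonneg fun i _ => oneSided_nonneg _ _),
      Finset.prod_mul_distrib]
    rfl
  simp_rw [h1]
  have hint : Integrable fun z : κ → ℝ =>
      ∏ i, (oneSided (s i) (y i + z i) * oneSided (s i) (z i)) :=
    Integrable.fintype_prod (f := fun i z => oneSided (s i) (y i + z) * oneSided (s i) z)
      fun i => (oneSided_corr (hs i) (y i)).1
  rw [← ofReal_integral_eq_lintegral_ofReal hint (Filter.Eventually.of_forall fun z =>
    Finset.prod_nonneg fun i _ => mul_nonneg (oneSided_nonneg _ _) (oneSided_nonneg _ _)),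
    integral_fintype_prod_volume_eq_prod
      (f := fun i z => oneSided (s i) (y i + z) * oneSided (s i) z),
    ← ENNReal.ofReal_mul (Finset.prod_nonneg fun i _ => inv_nonneg.2 (by linarith [hs i]))]
  simp_rw [fun i => (oneSided_corr (hs i) (y i)).2]
  rw [Finset.prod_mul_distrib, ← exp_sum, Finset.sum_neg_distrib]

/-- Shifting the Gaussian weight `exp(-q/2)` decreases its integral against a product of Laplace
weights. -/
lemma lintegral_laplace_shift_le {q : (κ → ℝ) → ℝ} (hq : Measurable q)
    (hpar : ∀ x y, q (x + y) + q (x - y) = 2 * q x + 2 * q y)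
    (h0 : ∫⁻ z, ENNReal.ofReal (exp (-(2 * q z))) ≠ 0)
    (h1 : ∫⁻ z, ENNReal.ofReal (exp (-(2 * q z))) ≠ ⊤) {s : κ → ℝ} (hs : ∀ i, 0 ≤ s i)
    (ψ : κ → ℝ) :
    ∫⁻ y, ENNReal.ofReal (exp (-∑ i, s i * |y i|)) *
        ENNReal.ofReal (exp (-(1 / 2 * q (y + ψ)))) ≤
      ∫⁻ y, ENNReal.ofReal (exp (-∑ i, s i * |y i|)) *
        ENNReal.ofReal (exp (-(1 / 2 * q y))) := by
  have hq0 : q 0 = 0 := by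
    have := hpar 0 0
    simp only [add_zero, sub_zero] at this
    linarith
  have hq2 : ∀ y, q ((2 : ℝ) • y) = 4 * q y := by
    intro y
    have := hpar y y
    rw [sub_self, hq0, ← two_smul ℝ y] at this
    linarith
  have hw : ∀ y, ∫⁻ z, ENNReal.ofReal (exp (-q (y + z))) * ENNReal.ofReal (exp (-q z)) =
      (∫⁻ z, ENNReal.ofReal (exp (-(2 * q z)))) * ENNReal.ofReal (exp (-(1 / 2 * q y))) := by
    intro y
    rw [← lintegral_sub_right_eq_self _ ((1 / 2 : ℝ) • y), ← lintegral_mul_const _ (by fun_prop)]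
    refine lintegral_congr fun t => ?_
    rw [← ENNReal.ofReal_mul (exp_pos _).le, ← ENNReal.ofReal_mul (exp_pos _).le, ← exp_add,
      ← exp_add]
    congr 2
    have h2 := hpar t ((1 / 2 : ℝ) • y)
    have h3 := hq2 ((1 / 2 : ℝ) • y)
    rw [smul_smul, show (2 : ℝ) * (1 / 2) = 1 by norm_num, one_smul] at h3
    rw [show y + (t - (1 / 2 : ℝ) • y) = t + (1 / 2 : ℝ) • y by
      ext i; simp; ring]
    linarith
  have pos : ∀ s : κ → ℝ, (∀ i, 0 < s i) →
      ∫⁻ y, ENNReal.ofReal (exp (-∑ i, s i * |y i|)) *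
          ENNReal.ofReal (exp (-(1 / 2 * q (y + ψ)))) ≤
        ∫⁻ y, ENNReal.ofReal (exp (-∑ i, s i * |y i|)) *
          ENNReal.ofReal (exp (-(1 / 2 * q y))) := by
    intro s hs
    have hm : Measurable fun z : κ → ℝ => ENNReal.ofReal (∏ i, oneSided (s i) (z i)) := by
      refine ENNReal.measurable_ofReal.comp (Finset.measurable_prod _ fun i _ => ?_)
      exact (measurable_oneSided _).comp (measurable_pi_apply i)
    have := lintegral_autocorr_shift_le hm
      (v := fun z => ENNReal.ofReal (exp (-q z))) (by fun_prop) ψ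
    simp_rw [lintegral_prod_oneSided hs, hw] at this
    set a := ENNReal.ofReal (∏ i, (2 * s i)⁻¹) with ha
    set b := ∫⁻ z, ENNReal.ofReal (exp (-(2 * q z))) with hb
    have e : ∀ x y : ℝ≥0∞, a * x * (b * y) = a * b * (x * y) := fun x y => by ring
    simp_rw [e] at this
    rw [lintegral_const_mul _ (by fun_prop), lintegral_const_mul _ (by fun_prop)] at this
    refine (ENNReal.mul_le_mul_iff_right (mul_ne_zero ?_ h0)
      (ENNReal.mul_ne_top ENNReal.ofReal_ne_top h1)).1 this
    rw [ENNReal.ofReal_ne_zero_iff]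
    exact Finset.prod_pos fun i _ => inv_pos.2 (by linarith [hs i])
  have hmono : Monotone fun (n : ℕ) (y : κ → ℝ) =>
      ENNReal.ofReal (exp (-∑ i, (s i + 1 / ((n : ℝ) + 1)) * |y i|)) *
          ENNReal.ofReal (exp (-(1 / 2 * q (y + ψ)))) := by
    intro n m hnm y
    dsimp only
    gcongr
  have hsup : ∀ y : κ → ℝ, ⨆ n : ℕ, ENNReal.ofReal
      (exp (-∑ i, (s i + 1 / ((n : ℝ) + 1)) * |y i|)) *
        ENNReal.ofReal (exp (-(1 / 2 * q (y + ψ)))) =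
      ENNReal.ofReal (exp (-∑ i, s i * |y i|)) *
        ENNReal.ofReal (exp (-(1 / 2 * q (y + ψ)))) := by
    intro y
    refine iSup_eq_of_tendsto (fun n m hnm => hmono hnm y) ?_
    refine ENNReal.Tendsto.mul_const ?_ (Or.inr ENNReal.ofReal_ne_top)
    refine ENNReal.tendsto_ofReal ((continuous_exp.tendsto _).comp (Tendsto.neg ?_))
    refine tendsto_finsetSum _ fun i _ => Tendsto.mul_const _ ?_
    simpa using (tendsto_const_nhds (x := s i)).add tendsto_one_div_add_atTop_nhds_zero_nat
  calc _ = ∫⁻ y, ⨆ n : ℕ,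
          (ENNReal.ofReal (exp (-∑ i, (s i + 1 / ((n : ℝ) + 1)) * |y i|)) *
            ENNReal.ofReal (exp (-(1 / 2 * q (y + ψ))))) := by simp_rw [hsup]
    _ = ⨆ n : ℕ, ∫⁻ y,
          (ENNReal.ofReal (exp (-∑ i, (s i + 1 / ((n : ℝ) + 1)) * |y i|)) *
            ENNReal.ofReal (exp (-(1 / 2 * q (y + ψ))))) :=
        lintegral_iSup (fun n => by fun_prop) hmono
    _ ≤ _ := by
        refine iSup_le fun n => (pos _ fun i => ?_).trans (lintegral_mono fun y => ?_)
        · have := hs i; positivity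
        · gcongr with i
          have : (0 : ℝ) ≤ 1 / ((n : ℝ) + 1) := by positivity
          linarith

end Shift

/-! ## Bernoulli percolation on a finite set of edges -/

section Bernoulli

variable {α : Type} [DecidableEq α]

/-- Expectation of `F` of a random subset of `E` that contains each `e` independently with
probability `q e`. -/
def bern (E : Finset α) (q : α → ℝ) (F : Finset α → ℝ) : ℝ :=
  ∑ s ∈ E.powerset, (∏ e ∈ s, q e) * (∏ e ∈ E \ s, (1 - q e)) * F s

lemma bern_empty (q : α → ℝ) (F : Finset α → ℝ) : bern ∅ q F = F ∅ := by simp [bern]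

lemma bern_insert {E : Finset α} {e : α} (he : e ∉ E) (q : α → ℝ) (F : Finset α → ℝ) :
    bern (insert e E) q F =
      q e * bern E q (fun s => F (insert e s)) + (1 - q e) * bern E q F := by
  unfold bern
  rw [Finset.sum_powerset_insert he, add_comm, Finset.mul_sum, Finset.mul_sum]
  congr 1
  · refine Finset.sum_congr rfl fun s hs => ?_
    have hes : e ∉ s := fun h => he (Finset.mem_powerset.1 hs h)
    rw [Finset.prod_insert hes, Finset.insert_sdiff_insert,
      Finset.sdiff_insert_of_notMem he]
    ring
  · refine Finset.sum_congr rfl fun s hs => ?_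
    have hes : e ∉ s := fun h => he (Finset.mem_powerset.1 hs h)
    rw [Finset.insert_sdiff_of_notMem _ hes, Finset.prod_insert fun h =>
      he (Finset.mem_sdiff.1 h).1]
    ring

lemma bern_congr {E : Finset α} {q q' : α → ℝ} {F F' : Finset α → ℝ} (hq : ∀ e ∈ E, q e = q' e)
    (hF : ∀ s ⊆ E, F s = F' s) : bern E q F = bern E q' F' := by
  refine Finset.sum_congr rfl fun s hs => ?_
  have hs' := Finset.mem_powerset.1 hs
  have h1 : ∏ e ∈ s, q e = ∏ e ∈ s, q' e := Finset.prod_congr rfl fun e he => hq e (hs' he)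
  have h2 : ∏ e ∈ E \ s, (1 - q e) = ∏ e ∈ E \ s, (1 - q' e) :=
    Finset.prod_congr rfl fun e he => by rw [hq e (Finset.mem_sdiff.1 he).1]
  rw [hF s hs', h1, h2]

lemma bern_sum {κ : Type} (T : Finset κ) (E : Finset α) (q : α → ℝ) (F : κ → Finset α → ℝ) :
    bern E q (fun s => ∑ k ∈ T, F k s) = ∑ k ∈ T, bern E q (F k) := by
  unfold bern
  simp_rw [Finset.mul_sum]
  exact Finset.sum_comm

lemma bern_mul_left (E : Finset α) (q : α → ℝ) (c : ℝ) (F : Finset α → ℝ) :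
    bern E q (fun s => c * F s) = c * bern E q F := by
  unfold bern
  rw [Finset.mul_sum]
  exact Finset.sum_congr rfl fun s _ => by ring

lemma bern_mul_right (E : Finset α) (q : α → ℝ) (c : ℝ) (F : Finset α → ℝ) :
    bern E q (fun s => F s * c) = bern E q F * c := by
  simp_rw [mul_comm _ c]
  exact bern_mul_left E q c F

lemma bern_one (E : Finset α) (q : α → ℝ) : bern E q (fun _ => 1) = 1 := by
  induction E using Finset.induction_on with
  | empty => rw [bern_empty]
  | insert e E he ih => rw [bern_insert he, ih]; ring

lemma bern_mono {E : Finset α} {q : α → ℝ} (h0 : ∀ e ∈ E, 0 ≤ q e) (h1 : ∀ e ∈ E, q e ≤ 1)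
    {F F' : Finset α → ℝ} (hF : ∀ s ⊆ E, F s ≤ F' s) : bern E q F ≤ bern E q F' := by
  refine Finset.sum_le_sum fun s hs => ?_
  have hs' := Finset.mem_powerset.1 hs
  refine mul_le_mul_of_nonneg_left (hF s hs') (mul_nonneg ?_ ?_)
  · exact Finset.prod_nonneg fun e he => h0 e (hs' he)
  · exact Finset.prod_nonneg fun e he => sub_nonneg.2 (h1 e (Finset.mem_sdiff.1 he).1)

lemma bern_nonneg {E : Finset α} {q : α → ℝ} (h0 : ∀ e ∈ E, 0 ≤ q e) (h1 : ∀ e ∈ E, q e ≤ 1)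
    {F : Finset α → ℝ} (hF : ∀ s ⊆ E, 0 ≤ F s) : 0 ≤ bern E q F := by
  have := bern_mono h0 h1 hF
  simpa [bern] using this

/-- Expectations of increasing functions increase with the edge probabilities. -/
lemma bern_mono_prob {E : Finset α} {q q' : α → ℝ} (h0 : ∀ e ∈ E, 0 ≤ q e)
    (hq : ∀ e ∈ E, q e ≤ q' e) (h1 : ∀ e ∈ E, q' e ≤ 1) {F : Finset α → ℝ} (hF : Monotone F) :
    bern E q F ≤ bern E q' F := by
  induction E using Finset.induction_on generalizing F with
  | empty => rw [bern_empty, bern_empty]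
  | insert e E he ih =>
    rw [Finset.forall_mem_insert] at h0 hq h1
    rw [bern_insert he, bern_insert he]
    have i1 := ih h0.2 hq.2 h1.2 hF
    have i2 := ih h0.2 hq.2 h1.2 (F := fun s => F (insert e s))
      fun s t hst => hF (Finset.insert_subset_insert e hst)
    have i3 : bern E q F ≤ bern E q fun s => F (insert e s) :=
      bern_mono h0.2 (fun a ha => (hq.2 a ha).trans (h1.2 a ha))
        fun s _ => hF (Finset.subset_insert e s)
    nlinarith [h0.1, hq.1, h1.1, mul_le_mul_of_nonneg_left i2 (h0.1.trans hq.1),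
      mul_le_mul_of_nonneg_left i1 (sub_nonneg.2 h1.1),
      mul_le_mul_of_nonneg_right hq.1 (sub_nonneg.2 i3)]

lemma bern_union {A B : Finset α} (hAB : Disjoint A B) (q : α → ℝ) (F : Finset α → ℝ) :
    bern (A ∪ B) q F = bern A q fun s => bern B q fun t => F (s ∪ t) := by
  induction A using Finset.induction_on generalizing F with
  | empty => simp [bern_empty]
  | insert e A he ih =>
    rw [Finset.disjoint_insert_left] at hAB
    rw [Finset.insert_union, bern_insert (by simp [he, hAB.1]), bern_insert he, ih hAB.2, ih hAB.2]
    simp_rw [Finset.insert_union]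

lemma bern_disjoint (E A : Finset α) (q : α → ℝ) :
    bern E q (fun s => if Disjoint s A then 1 else 0) = ∏ e ∈ E.filter (· ∈ A), (1 - q e) := by
  induction E using Finset.induction_on with
  | empty => simp [bern_empty]
  | insert e E he ih =>
    rw [bern_insert he, ih, Finset.filter_insert]
    by_cases h : e ∈ A
    · rw [if_pos h, Finset.prod_insert fun h' => he (Finset.mem_filter.1 h').1]
      simp_rw [Finset.disjoint_insert_left, h, not_true_eq_false, false_and, if_false]
      have := bern_mul_left E q 0 fun _ => 1
      simp only [zero_mul] at this
      rw [this]; ring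
    · simp_rw [Finset.disjoint_insert_left, if_neg h, h, not_false_eq_true, true_and, ih]
      ring

lemma measurable_bern {Ω : Type} [MeasurableSpace Ω] (E : Finset α) {q : Ω → α → ℝ}
    (hq : ∀ e, Measurable fun ω => q ω e) (F : Finset α → ℝ) :
    Measurable fun ω => bern E (q ω) F := by
  unfold bern
  refine Finset.measurable_sum _ fun s _ => ((Finset.measurable_prod _ fun e _ => hq e).mul
    (Finset.measurable_prod _ fun e _ => measurable_const.sub (hq e))).mul_const _

end Bernoulli

/-! ## Clusters -/

section Cluster

variable {ι : Type} [Fintype ι]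

/-- The cluster of `o` in the graph with edge set `s`. -/
def cluster (o : ι) (s : Finset (ι × ι)) : Finset ι :=
  Finset.univ.filter fun y => Relation.ReflTransGen (fun u v => (u, v) ∈ s ∨ (v, u) ∈ s) o y

lemma mem_cluster {o y : ι} {s : Finset (ι × ι)} :
    y ∈ cluster o s ↔ Relation.ReflTransGen (fun u v => (u, v) ∈ s ∨ (v, u) ∈ s) o y := by
  simp [cluster]

lemma cluster_mono (o : ι) : Monotone (cluster o) := by
  intro s t hst y hy
  rw [mem_cluster] at hy ⊢
  induction hy with
  | refl => exact .refl
  | tail _ h ih => exact ih.tail (Or.imp (fun h => hst h) (fun h => hst h) h)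

/-- Edges with both end points in `S`. -/
def innerEdges (S : Finset ι) (E : Finset (ι × ι)) : Finset (ι × ι) :=
  E.filter fun e => e.1 ∈ S ∧ e.2 ∈ S

/-- Edges with exactly one end point in `S`. -/
def bdry (S : Finset ι) (E : Finset (ι × ι)) : Finset (ι × ι) :=
  E.filter fun e => (e.1 ∈ S ∧ e.2 ∉ S) ∨ (e.1 ∉ S ∧ e.2 ∈ S)

lemma disjoint_bdry_cluster (o : ι) (E s : Finset (ι × ι)) :
    Disjoint s (bdry (cluster o s) E) := by
  rw [Finset.disjoint_left]
  intro e hs he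
  rcases (Finset.mem_filter.1 he).2 with ⟨h1, h2⟩ | ⟨h1, h2⟩
  · exact h2 (mem_cluster.2 ((mem_cluster.1 h1).tail (Or.inl hs)))
  · exact h1 (mem_cluster.2 ((mem_cluster.1 h2).tail (Or.inr hs)))

lemma cluster_union_eq_iff {o : ι} {S : Finset ι} {E s t : Finset (ι × ι)} (hs : s ⊆ innerEdges S E)
    (ht : t ⊆ E \ innerEdges S E) :
    cluster o (s ∪ t) = S ↔ cluster o s = S ∧ Disjoint t (bdry S E) := by
  have key : Disjoint t (bdry S E) → ∀ y, Relation.ReflTransGen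
      (fun u v => (u, v) ∈ s ∪ t ∨ (v, u) ∈ s ∪ t) o y → o ∈ S →
      y ∈ S ∧ Relation.ReflTransGen (fun u v => (u, v) ∈ s ∨ (v, u) ∈ s) o y := by
    intro hd y h ho
    have ht' : ∀ e ∈ t, e.1 ∉ S ∧ e.2 ∉ S := by
      intro e he
      obtain ⟨h0, h1⟩ := Finset.mem_sdiff.1 (ht he)
      have h2 := Finset.disjoint_left.1 hd he
      simp only [innerEdges, bdry, Finset.mem_filter, h0, true_and] at h1 h2
      tauto
    induction h with
    | refl => exact ⟨ho, .refl⟩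
    | @tail y z _ hyz ih =>
      obtain ⟨hy, hc⟩ := ih
      rcases hyz with h | h <;> rcases Finset.mem_union.1 h with h' | h'
      · exact ⟨(Finset.mem_filter.1 (hs h')).2.2, hc.tail (Or.inl h')⟩
      · exact absurd hy (ht' _ h').1
      · exact ⟨(Finset.mem_filter.1 (hs h')).2.1, hc.tail (Or.inr h')⟩
      · exact absurd hy (ht' _ h').2
  have mo : ∀ s, o ∈ cluster o s := fun s => mem_cluster.2 .refl
  constructor
  · intro h
    have hd : Disjoint t (bdry S E) := by
      have := disjoint_bdry_cluster o E (s ∪ t)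
      rw [h] at this
      exact Finset.disjoint_of_subset_left Finset.subset_union_right this
    refine ⟨Finset.Subset.antisymm ?_ fun y hy => ?_, hd⟩
    · conv_rhs => rw [← h]
      exact cluster_mono o Finset.subset_union_left
    · have ho : o ∈ S := h ▸ mo (s ∪ t)
      rw [← h, mem_cluster] at hy
      exact mem_cluster.2 (key hd y hy ho).2
  · rintro ⟨h, hd⟩
    have ho : o ∈ S := h ▸ mo s
    refine Finset.Subset.antisymm (fun y hy => (key hd y (mem_cluster.1 hy) ho).1) ?_
    conv_lhs => rw [← h]
    exact cluster_mono o Finset.subset_union_left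

/-- The probability of a given cluster factorizes. -/
lemma bern_cluster_eq (o : ι) (S : Finset ι) (E : Finset (ι × ι)) (q : ι × ι → ℝ) :
    bern E q (fun s => if cluster o s = S then 1 else 0) =
      bern (innerEdges S E) q (fun s => if cluster o s = S then 1 else 0) *
        ∏ e ∈ bdry S E, (1 - q e) := by
  have h1 : innerEdges S E ∪ E \ innerEdges S E = E :=
    Finset.union_sdiff_of_subset (Finset.filter_subset _ _)
  have h2 : ∏ e ∈ bdry S E, (1 - q e) =
      bern (E \ innerEdges S E) q (fun t => if Disjoint t (bdry S E) then 1 else 0) := by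
    rw [bern_disjoint]
    congr 1
    ext e
    simp only [innerEdges, bdry, Finset.mem_filter, Finset.mem_sdiff]
    tauto
  rw [h2, ← bern_mul_right]
  conv_lhs => rw [← h1]
  rw [bern_union Finset.disjoint_sdiff]
  refine bern_congr (fun _ _ => rfl) fun s hs => ?_
  rw [← bern_mul_left]
  refine bern_congr (fun _ _ => rfl) fun t ht => ?_
  simp only [cluster_union_eq_iff hs ht]
  by_cases h : cluster o s = S <;> by_cases hd : Disjoint t (bdry S E) <;> simp [h, hd]

/-- A vertex all of whose edges are closed is not in the cluster. -/
lemma bern_cluster_eq_zero {o : ι} {S : Finset ι} {E : Finset (ι × ι)} {q : ι × ι → ℝ} {u : ι}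
    (hu : u ∈ S) (huo : u ≠ o) (hq : ∀ e ∈ E, e.1 = u ∨ e.2 = u → q e = 0) :
    bern E q (fun s => if cluster o s = S then 1 else 0) = 0 := by
  refine Finset.sum_eq_zero fun s hs => ?_
  by_cases h : cluster o s = S
  · rw [← h, mem_cluster] at hu
    obtain ⟨v, _, hv⟩ := (Relation.ReflTransGen.cases_tail hu).resolve_left fun h => huo h
    have : ∏ e ∈ s, q e = 0 := by
      rcases hv with hv | hv
      · exact Finset.prod_eq_zero hv (hq _ (Finset.mem_powerset.1 hs hv) (Or.inr rfl))
      · exact Finset.prod_eq_zero hv (hq _ (Finset.mem_powerset.1 hs hv) (Or.inl rfl))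
    rw [this]; ring
  · simp only [if_neg h, mul_zero]

/-- An orientation of the complete graph. -/
structure Oriented (E : Finset (ι × ι)) : Prop where
  ne : ∀ e ∈ E, e.1 ≠ e.2
  total : ∀ u v, u ≠ v → (u, v) ∈ E ∨ (v, u) ∈ E
  asymm : ∀ u v, (u, v) ∈ E → (v, u) ∉ E

lemma Oriented.sum_bdry {E : Finset (ι × ι)} (hE : Oriented E) (S : Finset ι) {F : ι × ι → ℝ}
    (hF : ∀ e, F e.swap = F e) :
    ∑ e ∈ bdry S E, F e = ∑ u ∈ S, ∑ v ∈ Sᶜ, F (u, v) := by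
  rw [← Finset.sum_product']
  refine Finset.sum_nbij' (fun e => if e.1 ∈ S then e else e.swap)
    (fun e => if e ∈ E then e else e.swap) ?_ ?_ ?_ ?_ ?_
  · intro e he
    rcases (Finset.mem_filter.1 he).2 with ⟨h1, h2⟩ | ⟨h1, h2⟩ <;> simp [h1, h2]
  · intro e he
    simp only [Finset.mem_product, Finset.mem_compl] at he
    have hne : e.1 ≠ e.2 := fun h => he.2 (h ▸ he.1)
    split_ifs with h
    · exact Finset.mem_filter.2 ⟨h, Or.inl he⟩
    · exact Finset.mem_filter.2 ⟨(hE.total _ _ hne).resolve_left h, Or.inr ⟨he.2, he.1⟩⟩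
  · intro e he
    have h0 := (Finset.mem_filter.1 he).1
    by_cases h : e.1 ∈ S
    · simp [h, h0]
    · rw [if_neg h, if_neg (show e.swap ∉ E from hE.asymm _ _ h0), Prod.swap_swap]
  · intro e he
    simp only [Finset.mem_product, Finset.mem_compl] at he
    by_cases h : e ∈ E
    · simp [h, he.1]
    · rw [if_neg h, Prod.fst_swap, if_neg he.2, Prod.swap_swap]
  · intro e _
    by_cases h : e.1 ∈ S
    · simp [h]
    · rw [if_neg h]; exact (hF e).symm

end Cluster

/-! ## Gaussian weights -/

section Glue

variable {ι : Type}

/-- Glues two partial configurations. -/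
def glue (S : Finset ι) (a : {i // i ∈ S} → ℝ) (y : {i // i ∉ S} → ℝ) (i : ι) : ℝ :=
  if h : i ∈ S then a ⟨i, h⟩ else y ⟨i, h⟩

lemma glue_add (S : Finset ι) (a b : {i // i ∈ S} → ℝ) (y z : {i // i ∉ S} → ℝ) :
    glue S (a + b) (y + z) = glue S a y + glue S b z := by
  ext i; unfold glue; simp only [Pi.add_apply]; split_ifs <;> rfl

lemma measurable_glue (S : Finset ι) :
    Measurable fun z : ({i // i ∈ S} → ℝ) × ({i // i ∉ S} → ℝ) => glue S z.1 z.2 :=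
  (MeasurableEquiv.piEquivPiSubtypeProd (fun _ : ι => ℝ) (· ∈ S)).symm.measurable

end Glue

section GaussianWeight

open Matrix

variable {ι : Type} [Fintype ι] {Q : Matrix ι ι ℝ} {δ : ℝ}

/-- Precision matrices of free fields. -/
structure Precision (Q : Matrix ι ι ℝ) (δ : ℝ) : Prop where
  symm : Q.IsSymm
  pos : 0 < δ
  coercive : ∀ x : ι → ℝ, δ * ∑ i, x i ^ 2 ≤ x ⬝ᵥ Q *ᵥ x
  off_diag : ∀ u v, u ≠ v → Q u v ≤ 0

/-- The density of the centered Gaussian vector with precision matrix `Q`, not normalized. -/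
def gw (Q : Matrix ι ι ℝ) (x : ι → ℝ) : ℝ≥0∞ := ENNReal.ofReal (exp (-(1 / 2 * (x ⬝ᵥ Q *ᵥ x))))

lemma measurable_quadForm (Q : Matrix ι ι ℝ) : Measurable fun x : ι → ℝ => x ⬝ᵥ Q *ᵥ x :=
  (continuous_id.dotProduct (continuous_const.matrix_mulVec continuous_id)).measurable

lemma measurable_gw (Q : Matrix ι ι ℝ) : Measurable (gw Q) := by
  have := measurable_quadForm Q
  unfold gw
  fun_prop

lemma bil_comm (hQ : Q.IsSymm) (x y : ι → ℝ) : x ⬝ᵥ Q *ᵥ y = y ⬝ᵥ Q *ᵥ x := by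
  rw [dotProduct_comm, dotProduct_mulVec, ← mulVec_transpose, hQ.eq, dotProduct_comm,
    dotProduct_comm, dotProduct_comm]

lemma quadForm_add (hQ : Q.IsSymm) (x y : ι → ℝ) : (x + y) ⬝ᵥ Q *ᵥ (x + y) =
    x ⬝ᵥ Q *ᵥ x + 2 * (x ⬝ᵥ Q *ᵥ y) + y ⬝ᵥ Q *ᵥ y := by
  rw [mulVec_add, add_dotProduct, dotProduct_add, dotProduct_add, bil_comm hQ y x]
  ring

lemma lintegral_exp_neg_sum_sq_ne_top {c : ℝ} (hc : 0 < c) :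
    ∫⁻ x : ι → ℝ, ENNReal.ofReal (exp (-(c * ∑ i, x i ^ 2))) ≠ ⊤ := by
  have h : Integrable fun x : ι → ℝ => ∏ i, exp (-c * x i ^ 2) :=
    Integrable.fintype_prod (f := fun _ t => exp (-c * t ^ 2)) fun _ => integrable_exp_neg_mul_sq hc
  have e : ∀ x : ι → ℝ, exp (-(c * ∑ i, x i ^ 2)) = ∏ i, exp (-c * x i ^ 2) := by
    intro x
    rw [← exp_sum, Finset.mul_sum, ← Finset.sum_neg_distrib]
    simp_rw [neg_mul]
  simp_rw [e]
  exact h.lintegral_lt_top.ne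

lemma Precision.nonneg (hQ : Precision Q δ) (x : ι → ℝ) : 0 ≤ x ⬝ᵥ Q *ᵥ x :=
  le_trans (mul_nonneg hQ.pos.le (Finset.sum_nonneg fun _ _ => sq_nonneg _)) (hQ.coercive x)

lemma Precision.eq_zero (hQ : Precision Q δ) {x : ι → ℝ} (h : x ⬝ᵥ Q *ᵥ x = 0) : x = 0 := by
  have h1 := hQ.coercive x
  rw [h] at h1
  have h2 : ∑ i, x i ^ 2 = 0 := le_antisymm (by
    by_contra! h'
    linarith [mul_pos hQ.pos h']) (Finset.sum_nonneg fun i _ => sq_nonneg _)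
  rw [Finset.sum_eq_zero_iff_of_nonneg fun i _ => sq_nonneg _] at h2
  exact funext fun i => by simpa using h2 i (Finset.mem_univ i)

lemma Precision.lintegral_gw_ne_top (hQ : Precision Q δ) : ∫⁻ x, gw Q x ≠ ⊤ := by
  refine ne_top_of_le_ne_top (lintegral_exp_neg_sum_sq_ne_top (ι := ι) (half_pos hQ.pos))
    (lintegral_mono fun x => ENNReal.ofReal_le_ofReal (exp_le_exp.2 ?_))
  have := hQ.coercive x
  linarith

lemma lintegral_ofReal_exp_ne_zero {g : (ι → ℝ) → ℝ} (hg : Measurable g) :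
    ∫⁻ x, ENNReal.ofReal (exp (g x)) ≠ 0 := by
  rw [Ne, lintegral_eq_zero_iff (by fun_prop)]
  intro h
  have h1 : ∀ᵐ x : ι → ℝ, False := by
    filter_upwards [h] with x hx
    have := ENNReal.ofReal_pos.2 (exp_pos (g x))
    exact this.ne' hx
  rw [Filter.eventually_false_iff_eq_bot, ae_eq_bot] at h1
  exact (NeZero.ne (volume : Measure (ι → ℝ))) h1

/-- The extension of `f|_S` that is harmonic off `S`. -/
lemma Precision.exists_harmonic (hQ : Precision Q δ) (S : Finset ι) (f : ι → ℝ) :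
    ∃ r : ι → ℝ, (∀ u ∈ S, r u = f u) ∧ ∀ v ∉ S, (Q *ᵥ r) v = 0 := by
  let L : (ι → ℝ) →ₗ[ℝ] (ι → ℝ) :=
    { toFun := fun x i => if i ∈ S then x i else (Q *ᵥ x) i
      map_add' := fun x y => by
        ext i
        simp only [mulVec_add, Pi.add_apply]
        split_ifs <;> rfl
      map_smul' := fun c x => by
        ext i
        simp only [mulVec_smul, Pi.smul_apply, RingHom.id_apply]
        split_ifs <;> rfl }
  have hL : ∀ x i, L x i = if i ∈ S then x i else (Q *ᵥ x) i := fun _ _ => rfl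
  have hinj : Function.Injective L := by
    rw [← LinearMap.ker_eq_bot, LinearMap.ker_eq_bot']
    intro x hx
    refine hQ.eq_zero (Finset.sum_eq_zero fun i _ => ?_)
    have h := hL x i
    rw [hx, Pi.zero_apply] at h
    split_ifs at h with hi
    · rw [← h, zero_mul]
    · rw [← h, mul_zero]
  obtain ⟨r, hr⟩ := LinearMap.injective_iff_surjective.1 hinj fun i => if i ∈ S then f i else 0
  refine ⟨r, fun u hu => ?_, fun v hv => ?_⟩
  · have := congrFun hr u
    rwa [hL, if_pos hu, if_pos hu] at this
  · have := congrFun hr v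
    rwa [hL, if_neg hv, if_neg hv] at this

lemma lintegral_glue (S : Finset ι) {F : (ι → ℝ) → ℝ≥0∞} (hF : Measurable F) :
    ∫⁻ x, F x = ∫⁻ a, ∫⁻ y, F (glue S a y) := by
  have h := (volume_preserving_piEquivPiSubtypeProd (fun _ : ι => ℝ) (· ∈ S)).symm
  rw [← h.lintegral_comp hF]
  have e := lintegral_prod (μ := (volume : Measure ({i // i ∈ S} → ℝ)))
    (ν := (volume : Measure ({i // i ∉ S} → ℝ))) _ (hF.comp (measurable_glue S)).aemeasurable
  convert e using 3
  · rw [Measure.volume_eq_prod]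
    congr!
  · rfl
  · rfl

/-- The probability that all edges between `S` and its complement are closed. -/
def closing (Q : Matrix ι ι ℝ) (S : Finset ι) (x : ι → ℝ) : ℝ :=
  2 * ∑ u ∈ S, ∑ v ∈ Sᶜ, Q u v * (max (x u) 0 * max (x v) 0)

lemma measurable_closing (Q : Matrix ι ι ℝ) (S : Finset ι) : Measurable (closing Q S) := by
  unfold closing
  fun_prop

/-- The exponent splits into a part on `S`, a Laplace weight and a Gaussian weight off `S`. -/
lemma closing_sub_quadForm (hQ : Q.IsSymm) (S : Finset ι) {a : {i // i ∈ S} → ℝ}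
    (ha : ∀ u, 0 < a u) (y : {i // i ∉ S} → ℝ) :
    closing Q S (glue S a y) - 1 / 2 * (glue S a y ⬝ᵥ Q *ᵥ glue S a y) =
      -(1 / 2 * (glue S a 0 ⬝ᵥ Q *ᵥ glue S a 0)) -
        ∑ v : {i // i ∉ S}, (-∑ u : {i // i ∈ S}, Q u.1 v.1 * a u) * |y v| -
        1 / 2 * (glue S 0 y ⬝ᵥ Q *ᵥ glue S 0 y) := by
  have h1 : glue S a y = glue S a 0 + glue S 0 y := by rw [← glue_add, add_zero, zero_add]
  have sumS : ∀ g : ι → ℝ, ∑ u ∈ S, g u = ∑ u : {i // i ∈ S}, g u :=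
    fun g => (Finset.sum_coe_sort S g).symm
  have sumC : ∀ g : ι → ℝ, ∑ v ∈ Sᶜ, g v = ∑ v : {i // i ∉ S}, g v := fun g =>
    Finset.sum_subtype Sᶜ (fun _ => Finset.mem_compl) g
  have gS : ∀ (b : {i // i ∈ S} → ℝ) (y) (u : {i // i ∈ S}), glue S b y u = b u :=
    fun b y u => by simp [glue]
  have gC : ∀ (b : {i // i ∈ S} → ℝ) (y) (v : {i // i ∉ S}), glue S b y v = y v :=
    fun b y v => by simp [glue, v.2]
  have hcross : glue S a 0 ⬝ᵥ Q *ᵥ glue S 0 y =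
      ∑ v : {i // i ∉ S}, ∑ u : {i // i ∈ S}, Q u.1 v.1 * a u * y v := by
    simp only [dotProduct, mulVec]
    rw [← Finset.sum_add_sum_compl S, sumS, sumC, Finset.sum_comm]
    simp_rw [gS, gC]
    simp only [Pi.zero_apply, zero_mul, Finset.sum_const_zero, add_zero]
    refine Finset.sum_congr rfl fun u _ => ?_
    rw [← Finset.sum_add_sum_compl S, sumS, sumC]
    simp_rw [gS, gC]
    simp only [Pi.zero_apply, mul_zero, Finset.sum_const_zero, zero_add, Finset.mul_sum]
    exact Finset.sum_congr rfl fun v _ => by ring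
  have hclos : closing Q S (glue S a y) =
      ∑ v : {i // i ∉ S}, ∑ u : {i // i ∈ S}, Q u.1 v.1 * a u * (2 * max (y v) 0) := by
    unfold closing
    rw [sumS, Finset.sum_congr rfl fun u _ => sumC _, Finset.sum_comm, Finset.mul_sum]
    refine Finset.sum_congr rfl fun v _ => ?_
    rw [Finset.mul_sum]
    refine Finset.sum_congr rfl fun u _ => ?_
    rw [gS, gC, max_eq_left (ha u).le]
    ring
  rw [h1, quadForm_add hQ, ← h1, hclos, hcross]
  have habs : ∀ v, (-∑ u : {i // i ∈ S}, Q u.1 v.1 * a u) * |y v| =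
      ∑ u : {i // i ∈ S}, Q u.1 v.1 * a u * y v -
        ∑ u : {i // i ∈ S}, Q u.1 v.1 * a u * (2 * max (y v) 0) := by
    intro v
    rw [← Finset.sum_mul, ← Finset.sum_mul, ← mul_sub]
    have : |y v| = 2 * max (y v) 0 - y v := by
      rcases le_total 0 (y v) with h | h
      · rw [abs_of_nonneg h, max_eq_left h]; ring
      · rw [abs_of_nonpos h, max_eq_right h]; ring
    rw [this]; ring
  simp_rw [habs, Finset.sum_sub_distrib]
  ring

/-- Shifting the field by `f` costs at least the energy of the harmonic extension of `f|_S`. -/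
lemma Precision.lintegral_shift_le (hQ : Precision Q δ) (S : Finset ι) {k : (ι → ℝ) → ℝ≥0∞}
    (hk : Measurable k) (hloc : ∀ x x', (∀ u ∈ S, x u = x' u) → k x = k x')
    (hpos : ∀ x, k x ≠ 0 → ∀ u ∈ S, 0 < x u) {f r : ι → ℝ} (hrf : ∀ u ∈ S, r u = f u)
    (hr : ∀ v ∉ S, (Q *ᵥ r) v = 0) (he : ∀ u ∈ S, 0 ≤ (Q *ᵥ f) u) :
    ∫⁻ x, k x * ENNReal.ofReal (exp (closing Q S x)) * gw Q (x + f) ≤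
      ENNReal.ofReal (exp (-(1 / 2 * (r ⬝ᵥ Q *ᵥ r)))) *
        ∫⁻ x, k x * ENNReal.ofReal (exp (closing Q S x)) * gw Q x := by
  have hm1 := measurable_closing Q S
  have hm2 := measurable_gw Q
  have hm3 := measurable_quadForm Q
  have mL : Measurable fun x => k x * ENNReal.ofReal (exp (closing Q S x)) * gw Q (x + f) := by
    fun_prop
  have mR : Measurable fun x => k x * ENNReal.ofReal (exp (closing Q S x)) * gw Q x := by
    fun_prop
  rw [lintegral_glue S mL, lintegral_glue S mR, ← lintegral_const_mul' _ _ ENNReal.ofReal_ne_top]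
  refine lintegral_mono fun a => ?_
  have gS : ∀ y (u : {i // i ∈ S}), glue S a y u = a u := fun y u => by simp [glue]
  have hka : ∀ y, k (glue S a y) = k (glue S a 0) := fun y =>
    hloc _ _ fun u hu => (gS y ⟨u, hu⟩).trans (gS 0 ⟨u, hu⟩).symm
  simp_rw [hka]
  by_cases h0 : k (glue S a 0) = 0
  · simp [h0]
  have ha : ∀ u, 0 < a u := fun u => by
    have := hpos _ h0 u u.2
    rwa [gS] at this
  obtain ⟨ψ, hψ⟩ : ∃ ψ : {i // i ∉ S} → ℝ, ψ = fun v => f v.1 - r v.1 := ⟨_, rfl⟩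
  have hψf : glue S 0 ψ = f - r := by
    ext i
    by_cases hi : i ∈ S
    · simp [glue, hi, hrf i hi]
    · simp [glue, hi, hψ]
  obtain ⟨s, hs⟩ : ∃ s : {i // i ∉ S} → ℝ, s = fun v => -∑ u : {i // i ∈ S}, Q u.1 v.1 * a u :=
    ⟨_, rfl⟩
  have hs0 : ∀ v, 0 ≤ s v := by
    intro v
    rw [hs]
    refine neg_nonneg.2 (Finset.sum_nonpos fun u _ =>
      mul_nonpos_of_nonpos_of_nonneg (hQ.off_diag _ _ fun h => v.2 (h ▸ u.2)) (ha u).le)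
  obtain ⟨q, hq⟩ : ∃ q : ({i // i ∉ S} → ℝ) → ℝ,
      q = fun y => glue S 0 y ⬝ᵥ Q *ᵥ glue S 0 y := ⟨_, rfl⟩
  have mg : Measurable fun y : {i // i ∉ S} → ℝ => glue S 0 y :=
    (measurable_glue S).comp measurable_prodMk_left
  have mq : Measurable q := by rw [hq]; exact hm3.comp mg
  have hpar : ∀ x y, q (x + y) + q (x - y) = 2 * q x + 2 * q y := by
    intro x y
    have e1 : glue S 0 (x + y) = glue S 0 x + glue S 0 y := by rw [← glue_add, zero_add]
    have e2 : glue S 0 (x - y) + glue S 0 y = glue S 0 x := by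
      rw [← glue_add, zero_add, sub_add_cancel]
    have e3 := quadForm_add hQ.symm (glue S 0 (x - y)) (glue S 0 y)
    rw [e2] at e3
    have e5 : glue S 0 x ⬝ᵥ Q *ᵥ glue S 0 y =
        glue S 0 (x - y) ⬝ᵥ Q *ᵥ glue S 0 y + glue S 0 y ⬝ᵥ Q *ᵥ glue S 0 y := by
      rw [← add_dotProduct, e2]
    have e6 := quadForm_add hQ.symm (glue S 0 x) (glue S 0 y)
    simp only [hq]
    rw [e1, e6]
    linarith
  have key0 : ∀ y, closing Q S (glue S a y) - 1 / 2 * (glue S a y ⬝ᵥ Q *ᵥ glue S a y) =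
      -(1 / 2 * (glue S a 0 ⬝ᵥ Q *ᵥ glue S a 0)) - ∑ v, s v * |y v| - 1 / 2 * q y := by
    intro y
    rw [hs, hq]
    exact closing_sub_quadForm hQ.symm S ha y
  have key1 : ∀ y, closing Q S (glue S a y) -
      1 / 2 * ((glue S a y + f) ⬝ᵥ Q *ᵥ (glue S a y + f)) ≤
      -(1 / 2 * (glue S a 0 ⬝ᵥ Q *ᵥ glue S a 0)) - 1 / 2 * (r ⬝ᵥ Q *ᵥ r) -
        ∑ v, s v * |y v| - 1 / 2 * q (y + ψ) := by
    intro y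
    have h0 := key0 y
    have h1 := quadForm_add hQ.symm (glue S a y) f
    have h2 : q (y + ψ) = q y + 2 * (glue S 0 y ⬝ᵥ Q *ᵥ (f - r)) +
        (f - r) ⬝ᵥ Q *ᵥ (f - r) := by
      simp only [hq]
      rw [show glue S 0 (y + ψ) = glue S 0 y + glue S 0 ψ by rw [← glue_add, zero_add],
        quadForm_add hQ.symm, hψf]
    have h3 := quadForm_add hQ.symm r (f - r)
    rw [add_sub_cancel, bil_comm hQ.symm r (f - r)] at h3
    have off : ∀ z : ι → ℝ, (∀ u ∈ S, z u = 0) → z ⬝ᵥ Q *ᵥ r = 0 := fun z hz =>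
      Finset.sum_eq_zero fun i _ => by
        by_cases hi : i ∈ S
        · rw [hz i hi, zero_mul]
        · rw [hr i hi, mul_zero]
    rw [off (f - r) fun u hu => by rw [Pi.sub_apply, hrf u hu, sub_self]] at h3
    rw [mulVec_sub, dotProduct_sub (glue S 0 y), off (glue S 0 y) fun u hu => by simp [glue, hu],
      ← mulVec_sub] at h2
    have h4 : glue S a y ⬝ᵥ Q *ᵥ f = glue S a 0 ⬝ᵥ Q *ᵥ f + glue S 0 y ⬝ᵥ Q *ᵥ f := by
      rw [← add_dotProduct, ← glue_add, add_zero, zero_add]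
    have h5 : 0 ≤ glue S a 0 ⬝ᵥ Q *ᵥ f := by
      refine Finset.sum_nonneg fun i _ => ?_
      by_cases hi : i ∈ S
      · exact mul_nonneg (by simpa [glue, hi] using (ha ⟨i, hi⟩).le) (he i hi)
      · simp [glue, hi]
    linarith
  have shift := lintegral_laplace_shift_le mq hpar
    (lintegral_ofReal_exp_ne_zero (by fun_prop)) ?_ hs0 ψ
  · obtain ⟨A, hA⟩ : ∃ A, A = exp (-(1 / 2 * (glue S a 0 ⬝ᵥ Q *ᵥ glue S a 0))) := ⟨_, rfl⟩
    obtain ⟨R, hR⟩ : ∃ R, R = exp (-(1 / 2 * (r ⬝ᵥ Q *ᵥ r))) := ⟨_, rfl⟩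
    have hA0 : 0 ≤ A := by rw [hA]; positivity
    have hR0 : 0 ≤ R := by rw [hR]; positivity
    rw [← hR]
    have b1 : ∀ y, k (glue S a 0) * ENNReal.ofReal (exp (closing Q S (glue S a y))) *
        gw Q (glue S a y + f) ≤ k (glue S a 0) * ENNReal.ofReal A * ENNReal.ofReal R *
          (ENNReal.ofReal (exp (-∑ i, s i * |y i|)) *
            ENNReal.ofReal (exp (-(1 / 2 * q (y + ψ))))) := by
      intro y
      simp only [mul_assoc, gw]
      refine mul_le_mul_right ?_ _
      rw [← ENNReal.ofReal_mul (exp_pos _).le, ← ENNReal.ofReal_mul (exp_pos _).le,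
        ← ENNReal.ofReal_mul hR0, ← ENNReal.ofReal_mul hA0, hA, hR, ← exp_add, ← exp_add,
        ← exp_add, ← exp_add]
      refine ENNReal.ofReal_le_ofReal (exp_le_exp.2 ?_)
      have := key1 y
      linarith
    have b2 : ∀ y, k (glue S a 0) * ENNReal.ofReal (exp (closing Q S (glue S a y))) *
        gw Q (glue S a y) = k (glue S a 0) * ENNReal.ofReal A *
          (ENNReal.ofReal (exp (-∑ i, s i * |y i|)) *
            ENNReal.ofReal (exp (-(1 / 2 * q y)))) := by
      intro y
      simp only [mul_assoc, gw]
      congr 1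
      rw [← ENNReal.ofReal_mul (exp_pos _).le, ← ENNReal.ofReal_mul (exp_pos _).le,
        ← ENNReal.ofReal_mul hA0, hA, ← exp_add, ← exp_add, ← exp_add]
      congr 2
      have := key0 y
      linarith
    refine (lintegral_mono b1).trans ?_
    simp_rw [b2]
    rw [lintegral_const_mul _ (by fun_prop), lintegral_const_mul _ (by fun_prop)]
    calc _ ≤ k (glue S a 0) * ENNReal.ofReal A * ENNReal.ofReal R * _ :=
          mul_le_mul_right shift _
      _ = _ := by ring
  · refine ne_top_of_le_ne_top (lintegral_exp_neg_sum_sq_ne_top (c := 2 * δ)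
      (by linarith [hQ.pos])) (lintegral_mono fun y =>
        ENNReal.ofReal_le_ofReal (exp_le_exp.2 ?_))
    have h1 := hQ.coercive (glue S 0 y)
    have h2 : ∑ v : {i // i ∉ S}, y v ^ 2 ≤ ∑ i, glue S 0 y i ^ 2 := by
      rw [← Finset.sum_add_sum_compl S, Finset.sum_subtype Sᶜ (fun _ => Finset.mem_compl)]
      have h3 : ∀ v : {i // i ∉ S}, glue S 0 y v = y v := fun v => by simp [glue, v.2]
      simp_rw [h3]
      have := Finset.sum_nonneg fun i (_ : i ∈ S) => sq_nonneg (glue S 0 y i)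
      linarith
    have h3 := mul_le_mul_of_nonneg_left h2 hQ.pos.le
    simp only [hq]
    linarith

end GaussianWeight

/-! ## The cluster of a vertex in the field-dependent percolation -/

section MasterInequality

open Matrix

variable {ι : Type} [Fintype ι] {Q : Matrix ι ι ℝ} {δ : ℝ}

/-- The probability that an edge is open, given the field. -/
def edgeProb (Q : Matrix ι ι ℝ) (x : ι → ℝ) (e : ι × ι) : ℝ :=
  1 - exp (2 * (Q e.1 e.2 * (max (x e.1) 0 * max (x e.2) 0)))

/-- The conditional probability that the cluster of `o` is `S`, given the field. -/
def clusterProb (Q : Matrix ι ι ℝ) (o : ι) (E : Finset (ι × ι)) (S : Finset ι) (x : ι → ℝ) : ℝ :=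
  bern E (edgeProb Q x) fun s => if cluster o s = S then 1 else 0

/-- The conditional probability of `F` if the field is positive at `o`. -/
def onPos (o : ι) (F : (ι → ℝ) → ℝ) (x : ι → ℝ) : ℝ≥0∞ :=
  if 0 < x o then ENNReal.ofReal (F x) else 0

/-- The weight of the event that the field is positive at `o` and the cluster of `o` is `S`. -/
def clusterMass (Q : Matrix ι ι ℝ) (o : ι) (E : Finset (ι × ι)) (S : Finset ι) : ℝ≥0∞ :=
  ∫⁻ x, onPos o (clusterProb Q o E S) x * gw Q x

lemma edgeProb_le_one {κ : Type} (Q : Matrix κ κ ℝ) (x : κ → ℝ) (e : κ × κ) : edgeProb Q x e ≤ 1 :=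
  sub_le_self _ (exp_pos _).le

lemma Precision.edgeProb_mono (hQ : Precision Q δ) {x y : ι → ℝ} (hxy : ∀ i, x i ≤ y i) {e : ι × ι}
    (he : e.1 ≠ e.2) : edgeProb Q x e ≤ edgeProb Q y e := by
  unfold edgeProb
  refine sub_le_sub_left (exp_le_exp.2 (mul_le_mul_of_nonneg_left ?_ two_pos.le)) _
  refine mul_le_mul_of_nonpos_left ?_ (hQ.off_diag _ _ he)
  gcongr <;> apply hxy

lemma Precision.edgeProb_nonneg (hQ : Precision Q δ) (x : ι → ℝ) {e : ι × ι} (he : e.1 ≠ e.2) :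
    0 ≤ edgeProb Q x e := by
  refine sub_nonneg.2 (exp_le_one_iff.2 ?_)
  have := hQ.off_diag _ _ he
  have := mul_nonneg (le_max_right (x e.1) 0) (le_max_right (x e.2) 0)
  nlinarith

lemma measurable_edgeProb {κ : Type} (Q : Matrix κ κ ℝ) (e : κ × κ) :
    Measurable fun x : κ → ℝ => edgeProb Q x e := by
  unfold edgeProb
  fun_prop

lemma measurable_onPos {κ : Type} (o : κ) {F : (κ → ℝ) → ℝ} (hF : Measurable F) :
    Measurable (onPos o F) :=
  Measurable.ite (measurableSet_lt measurable_const (measurable_pi_apply o)) (by fun_prop)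
    measurable_const

lemma measurable_clusterProb (Q : Matrix ι ι ℝ) (o : ι) (E : Finset (ι × ι)) (S : Finset ι) :
    Measurable (clusterProb Q o E S) :=
  measurable_bern E (measurable_edgeProb Q) _

lemma Precision.clusterProb_nonneg (hQ : Precision Q δ) {E : Finset (ι × ι)} (hE : Oriented E)
    (o : ι) (S : Finset ι) (x : ι → ℝ) : 0 ≤ clusterProb Q o E S x :=
  bern_nonneg (fun e he => hQ.edgeProb_nonneg x (hE.ne e he)) (fun _ _ => edgeProb_le_one Q x _)
    fun s _ => by split_ifs <;> norm_num

lemma sum_clusterProb (Q : Matrix ι ι ℝ) (o : ι) (E : Finset (ι × ι)) (x : ι → ℝ)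
    (T : Finset (Finset ι)) :
    ∑ S ∈ T, clusterProb Q o E S x =
      bern E (edgeProb Q x) fun s => if cluster o s ∈ T then 1 else 0 := by
  unfold clusterProb
  rw [← bern_sum]
  simp

lemma Precision.clusterProb_shift_le (hQ : Precision Q δ) {E : Finset (ι × ι)} (hE : Oriented E)
    (o : ι) (S : Finset ι) {f r : ι → ℝ} (hrf : ∀ u ∈ S, r u = f u)
    (hr : ∀ v ∉ S, (Q *ᵥ r) v = 0) (he : ∀ u ∈ S, 0 ≤ (Q *ᵥ f) u) :
    ∫⁻ x, onPos o (clusterProb Q o E S) x * gw Q (x + f) ≤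
      ENNReal.ofReal (exp (-(1 / 2 * (r ⬝ᵥ Q *ᵥ r)))) * clusterMass Q o E S := by
  by_cases ho : o ∈ S
  swap
  · have : ∀ x, clusterProb Q o E S x = 0 := fun x => Finset.sum_eq_zero fun s _ => by
      dsimp only
      rw [if_neg, mul_zero]
      rintro rfl
      exact ho (mem_cluster.2 .refl)
    simp [onPos, this]
  obtain ⟨k', hk'⟩ : ∃ k' : (ι → ℝ) → ℝ, k' = fun x => bern (innerEdges S E) (edgeProb Q x)
      fun s => if cluster o s = S then 1 else 0 := ⟨_, rfl⟩
  obtain ⟨k, hk⟩ : ∃ k : (ι → ℝ) → ℝ≥0∞, k = fun x =>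
      if ∀ u ∈ S, 0 < x u then ENNReal.ofReal (k' x) else 0 := ⟨_, rfl⟩
  have mk : Measurable k := by
    rw [hk]
    refine Measurable.ite ?_ ?_ measurable_const
    · simp_rw [Set.ofPred_forall]
      exact MeasurableSet.iInter fun u => MeasurableSet.iInter fun _ =>
        measurableSet_lt measurable_const (measurable_pi_apply u)
    · rw [hk']
      exact ENNReal.measurable_ofReal.comp (measurable_bern _ (measurable_edgeProb Q) _)
  have hloc : ∀ x x', (∀ u ∈ S, x u = x' u) → k x = k x' := by
    intro x x' h
    have h1 : k' x = k' x' := by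
      rw [hk']
      refine bern_congr (fun e he => ?_) fun _ _ => rfl
      obtain ⟨h1, h2⟩ := (Finset.mem_filter.1 he).2
      unfold edgeProb
      rw [h _ h1, h _ h2]
    have h2 : (∀ u ∈ S, 0 < x u) ↔ ∀ u ∈ S, 0 < x' u :=
      forall₂_congr fun u hu => by rw [h u hu]
    simp only [hk, h1, h2]
  have hpos : ∀ x, k x ≠ 0 → ∀ u ∈ S, 0 < x u := by
    intro x hx
    by_contra h
    exact hx (by simp only [hk, if_neg h])
  have hfac : ∀ x, onPos o (clusterProb Q o E S) x =
      k x * ENNReal.ofReal (exp (closing Q S x)) := by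
    intro x
    have hz : ∀ u ∈ S, x u ≤ 0 → ∀ e : ι × ι, e.1 = u ∨ e.2 = u → edgeProb Q x e = 0 := by
      intro u _ hu e he
      unfold edgeProb
      rcases he with rfl | rfl <;> rw [max_eq_right hu] <;> simp
    have hc : clusterProb Q o E S x = k' x * exp (closing Q S x) := by
      rw [clusterProb, bern_cluster_eq, hk']
      congr 1
      unfold edgeProb
      simp_rw [sub_sub_cancel]
      rw [← exp_sum, hE.sum_bdry S fun e => ?_]
      · simp_rw [closing, Finset.mul_sum]
      · rw [Prod.fst_swap, Prod.snd_swap, hQ.symm.apply e.1 e.2]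
        ring
    unfold onPos
    by_cases hx : 0 < x o
    · by_cases hS : ∀ u ∈ S, 0 < x u
      · simp only [hk]
        rw [if_pos hx, if_pos hS, hc, ENNReal.ofReal_mul]
        rw [hk']
        exact bern_nonneg (fun e he => hQ.edgeProb_nonneg x
          (hE.ne e (Finset.mem_filter.1 he).1)) (fun _ _ => edgeProb_le_one Q x _)
          fun s _ => by split_ifs <;> norm_num
      · have h0 : clusterProb Q o E S x = 0 := by
          push Not at hS
          obtain ⟨u, hu, hxu⟩ := hS
          exact bern_cluster_eq_zero hu (fun h => by rw [h] at hxu; linarith)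
            fun e _ he => hz u hu hxu e he
        simp only [hk]
        rw [if_neg hS, h0]
        simp
    · have hS : ¬∀ u ∈ S, 0 < x u := fun h => hx (h o ho)
      simp only [hk]
      rw [if_neg hS, if_neg hx, zero_mul]
  have := hQ.lintegral_shift_le S mk hloc hpos hrf hr he
  simp_rw [← hfac] at this
  exact this

lemma onPos_sum {α κ : Type} (o : α) (T : Finset κ) {F : κ → (α → ℝ) → ℝ}
    (hF : ∀ k x, 0 ≤ F k x) (x : α → ℝ) :
    ∑ k ∈ T, onPos o (F k) x = onPos o (fun x => ∑ k ∈ T, F k x) x := by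
  unfold onPos
  split_ifs
  · rw [ENNReal.ofReal_sum_of_nonneg fun k _ => hF k x]
  · simp

lemma Precision.sum_lintegral_clusterProb (hQ : Precision Q δ) {E : Finset (ι × ι)}
    (hE : Oriented E) (o : ι) (T : Finset (Finset ι)) {G : (ι → ℝ) → ℝ≥0∞} (hG : Measurable G) :
    ∑ S ∈ T, ∫⁻ x, onPos o (clusterProb Q o E S) x * G x =
      ∫⁻ x, onPos o (fun x => bern E (edgeProb Q x)
        fun s => if cluster o s ∈ T then 1 else 0) x * G x := by
  refine (lintegral_finsetSum T fun S _ =>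
    (measurable_onPos o (measurable_clusterProb Q o E S)).mul hG).symm.trans
    (lintegral_congr fun x => ?_)
  simp only [Pi.mul_apply]
  rw [← Finset.sum_mul, onPos_sum o T fun S x => hQ.clusterProb_nonneg hE o S x]
  simp_rw [sum_clusterProb]

lemma Precision.sum_clusterMass_ne_top (hQ : Precision Q δ) {E : Finset (ι × ι)}
    (hE : Oriented E) (o : ι) (T : Finset (Finset ι)) : ∑ S ∈ T, clusterMass Q o E S ≠ ⊤ := by
  unfold clusterMass
  rw [hQ.sum_lintegral_clusterProb hE o T (measurable_gw Q)]
  refine ne_top_of_le_ne_top hQ.lintegral_gw_ne_top (lintegral_mono fun x => ?_)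
  refine mul_le_of_le_one_left' ?_
  unfold onPos
  split_ifs
  · rw [ENNReal.ofReal_le_one]
    refine (bern_mono (fun e he => hQ.edgeProb_nonneg x (hE.ne e he))
      (fun _ _ => edgeProb_le_one Q x _) (F' := fun _ => 1) fun s _ => ?_).trans
      (bern_one _ _).le
    split_ifs <;> norm_num
  · exact zero_le_one

/-- Few clusters avoid `A` and have a large energy with respect to a potential `f` whose charges
off `A` are nonnegative. -/
theorem Precision.sum_clusterMass_le (hQ : Precision Q δ) {E : Finset (ι × ι)} (hE : Oriented E)
    (o : ι) (A : Finset ι) {f : ι → ℝ} (hf0 : ∀ i, 0 ≤ f i) (hf : ∀ u ∉ A, 0 ≤ (Q *ᵥ f) u)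
    (T : Finset (Finset ι)) (hT : ∀ S ∈ T, Disjoint S A ∧ ∃ h : ι → ℝ,
      (∀ v ∉ S, (Q *ᵥ h) v = 0) ∧ f ⬝ᵥ Q *ᵥ h ≠ 0 ∧ h ⬝ᵥ Q *ᵥ h ≤ (f ⬝ᵥ Q *ᵥ h) ^ 2) :
    ∑ S ∈ T, clusterMass Q o E S ≤
      3 * ∫⁻ x, (if 0 < x o ∧ x o ≤ f o then 1 else 0) * gw Q x := by
  have mgw := measurable_gw Q
  have mgwf : Measurable fun x => gw Q (x + f) := mgw.comp (measurable_id.add_const f)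
  have sumT := fun (T : Finset (Finset ι)) {G : (ι → ℝ) → ℝ≥0∞} (hG : Measurable G) =>
    hQ.sum_lintegral_clusterProb hE o T hG
  have fin := hQ.sum_clusterMass_ne_top hE o
  obtain ⟨m', hm'⟩ : ∃ m' : Finset ι → ℝ≥0∞, m' = fun S =>
    ∫⁻ x, onPos o (clusterProb Q o E S) x * gw Q (x + f) := ⟨_, rfl⟩
  obtain ⟨J, hJ⟩ : ∃ J, J = ∫⁻ x, (if 0 < x o ∧ x o ≤ f o then 1 else 0) * gw Q x := ⟨_, rfl⟩
  have univ_one : ∀ x, (bern E (edgeProb Q x)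
      fun s => if cluster o s ∈ Finset.univ then 1 else 0) = 1 := fun x => by
    simp [bern_one]
  have total : ∑ S, clusterMass Q o E S = J + ∑ S, m' S := by
    unfold clusterMass
    rw [hm', sumT Finset.univ mgw, sumT Finset.univ mgwf]
    simp_rw [univ_one]
    have e : ∫⁻ x, onPos o (fun _ => 1) x * gw Q (x + f) =
        ∫⁻ x, (if f o < x o then 1 else 0) * gw Q x := by
      rw [← lintegral_add_right_eq_self (fun x => (if f o < x o then 1 else 0) * gw Q x) f]
      refine lintegral_congr fun x => ?_
      simp only [onPos, Pi.add_apply, lt_add_iff_pos_left, ENNReal.ofReal_one]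
    rw [e, hJ, ← lintegral_add_left]
    · refine lintegral_congr fun x => ?_
      rw [← add_mul]
      congr 1
      unfold onPos
      have := hf0 o
      by_cases h1 : 0 < x o <;> by_cases h2 : x o ≤ f o
      · simp [h1, h2, not_lt.2 h2]
      · simp [h1, h2, not_le.1 h2]
      · simp [h1, h2, not_lt.2 h2]
      · exact absurd ((not_le.1 h2).trans_le' this) h1
    · refine Measurable.mul (Measurable.ite ?_ measurable_const measurable_const) mgw
      exact (measurableSet_lt measurable_const (measurable_pi_apply o)).inter
        (measurableSet_le (measurable_pi_apply o) measurable_const)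
  obtain ⟨U, hU⟩ : ∃ U : Finset (Finset ι), U = Finset.univ.filter (Disjoint · A) := ⟨_, rfl⟩
  have hhit : ∑ S ∈ Uᶜ, m' S ≤ ∑ S ∈ Uᶜ, clusterMass Q o E S := by
    unfold clusterMass
    rw [hm', sumT _ mgw, sumT _ mgwf, ← lintegral_sub_right_eq_self _ f]
    refine lintegral_mono fun x => ?_
    simp only [sub_add_cancel]
    gcongr
    unfold onPos
    have h0 := hf0 o
    by_cases h1 : 0 < (x - f) o
    · have h2 : 0 < x o := by rw [Pi.sub_apply] at h1; linarith
      rw [if_pos h1, if_pos h2]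
      refine ENNReal.ofReal_le_ofReal (bern_mono_prob
        (fun e he => hQ.edgeProb_nonneg _ (hE.ne e he))
        (fun e he => hQ.edgeProb_mono (fun i => sub_le_self _ (hf0 i)) (hE.ne e he))
        (fun _ _ => edgeProb_le_one Q _ _) fun s t hst => ?_)
      simp only [hU, Finset.mem_compl, Finset.mem_filter, Finset.mem_univ, true_and]
      have := cluster_mono o hst
      by_cases hs : Disjoint (cluster o s) A
      · simp only [hs, not_true_eq_false, if_false]
        split_ifs <;> norm_num
      · have ht : ¬Disjoint (cluster o t) A := fun h => hs (Finset.disjoint_of_subset_left this h)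
        simp [hs, ht]
    · rw [if_neg h1]
      exact zero_le
  have hmiss : ∀ S ∈ U, ∃ r : ι → ℝ, (∀ u ∈ S, r u = f u) ∧ (∀ v ∉ S, (Q *ᵥ r) v = 0) ∧
      m' S ≤ ENNReal.ofReal (exp (-(1 / 2 * (r ⬝ᵥ Q *ᵥ r)))) * clusterMass Q o E S := by
    intro S hS
    obtain ⟨r, hr1, hr2⟩ := hQ.exists_harmonic S f
    refine ⟨r, hr1, hr2, ?_⟩
    rw [hm']
    refine hQ.clusterProb_shift_le hE o S hr1 hr2 fun u hu => hf u fun h => ?_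
    rw [hU] at hS
    exact Finset.disjoint_left.1 (Finset.mem_filter.1 hS).2 hu h
  have hle : ∀ S ∈ U, m' S ≤ clusterMass Q o E S := by
    intro S hS
    obtain ⟨r, -, -, h⟩ := hmiss S hS
    refine h.trans (mul_le_of_le_one_left' (ENNReal.ofReal_le_one.2 (exp_le_one_iff.2 ?_)))
    have := hQ.nonneg r
    linarith
  have hTU : T ⊆ U := fun S hS => by
    rw [hU]; exact Finset.mem_filter.2 ⟨Finset.mem_univ _, (hT S hS).1⟩
  have hle' : ∀ S ∈ T, m' S ≤ ENNReal.ofReal (2 / 3) * clusterMass Q o E S := by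
    intro S hS
    obtain ⟨r, hr1, hr2, h⟩ := hmiss S (hTU hS)
    refine h.trans (mul_le_mul_left (ENNReal.ofReal_le_ofReal ?_) _)
    obtain ⟨-, g, hg1, hg2, hg3⟩ := hT S hS
    have e1 : r ⬝ᵥ Q *ᵥ g = f ⬝ᵥ Q *ᵥ g := by
      refine Finset.sum_congr rfl fun i _ => ?_
      by_cases hi : i ∈ S
      · rw [hr1 i hi]
      · rw [hg1 i hi]; ring
    obtain ⟨b, hb⟩ : ∃ b, b = f ⬝ᵥ Q *ᵥ g := ⟨_, rfl⟩
    rw [← hb] at e1 hg2 hg3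
    have e2 := hQ.nonneg (g + (-b) • r)
    rw [quadForm_add hQ.symm, mulVec_smul, dotProduct_smul, smul_dotProduct, dotProduct_smul,
      bil_comm hQ.symm g r, e1] at e2
    simp only [smul_eq_mul] at e2
    have e3 : 1 ≤ r ⬝ᵥ Q *ᵥ r := by
      have : 0 < b ^ 2 := by positivity
      have : b ^ 2 * 1 ≤ b ^ 2 * (r ⬝ᵥ Q *ᵥ r) := by nlinarith
      exact le_of_mul_le_mul_left this ‹_›
    have e4 : (3 / 2 : ℝ) ≤ exp (1 / 2 * (r ⬝ᵥ Q *ᵥ r)) := by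
      have := add_one_le_exp (1 / 2 * (r ⬝ᵥ Q *ᵥ r))
      linarith
    rw [Real.exp_neg]
    calc _ ≤ (3 / 2 : ℝ)⁻¹ := inv_anti₀ (by norm_num) e4
      _ = 2 / 3 := by norm_num
  rw [← hJ]
  have split : ∀ F : Finset ι → ℝ≥0∞,
      ∑ S, F S = ∑ S ∈ Uᶜ, F S + (∑ S ∈ U \ T, F S + ∑ S ∈ T, F S) := fun F => by
    rw [Finset.sum_sdiff hTU, add_comm, Finset.sum_add_sum_compl]
  rw [split, split m'] at total
  obtain ⟨a, ha⟩ : ∃ a, a = ∑ S ∈ Uᶜ, clusterMass Q o E S + ∑ S ∈ U \ T, clusterMass Q o E S :=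
    ⟨_, rfl⟩
  obtain ⟨t, ht⟩ : ∃ t, t = ∑ S ∈ T, clusterMass Q o E S := ⟨_, rfl⟩
  have hafin : a ≠ ⊤ := by rw [ha]; exact ENNReal.add_ne_top.2 ⟨fin _, fin _⟩
  have htfin : t ≠ ⊤ := by rw [ht]; exact fin _
  have h1 : ∑ S ∈ U \ T, m' S ≤ ∑ S ∈ U \ T, clusterMass Q o E S :=
    Finset.sum_le_sum fun S hS => hle S (Finset.mem_sdiff.1 hS).1
  have h2 : ∑ S ∈ T, m' S ≤ ENNReal.ofReal (2 / 3) * t := by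
    rw [ht, Finset.mul_sum]
    exact Finset.sum_le_sum hle'
  have h3 : a + t ≤ a + (J + ENNReal.ofReal (2 / 3) * t) := by
    rw [ha, ht, add_assoc, total, ← ht]
    calc _ ≤ J + (∑ S ∈ Uᶜ, clusterMass Q o E S +
          (∑ S ∈ U \ T, clusterMass Q o E S + ENNReal.ofReal (2 / 3) * t)) := by gcongr
      _ = _ := by ring
  have h4 := (ENNReal.add_le_add_iff_left hafin).1 h3
  rw [← ht]
  rcases eq_or_ne J ⊤ with hJt | hJt
  · rw [hJt]; simp
  rw [← ENNReal.toReal_le_toReal htfin (ENNReal.mul_ne_top (by simp) hJt)]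
  rw [← ENNReal.toReal_le_toReal htfin (ENNReal.add_ne_top.2
    ⟨hJt, ENNReal.mul_ne_top ENNReal.ofReal_ne_top htfin⟩),
    ENNReal.toReal_add hJt (ENNReal.mul_ne_top ENNReal.ofReal_ne_top htfin),
    ENNReal.toReal_mul, ENNReal.toReal_ofReal (by norm_num)] at h4
  rw [ENNReal.toReal_mul, ENNReal.toReal_ofNat]
  linarith

end MasterInequality

/-! ## The Green matrix of a finite set -/

namespace WGraph

open Matrix

variable {M : WGraph} {K : ℝ}

/-- The Green matrix of a finite set. -/
def gmat (M : WGraph) (D : Finset M.V) : Matrix D D ℝ := Matrix.of fun u v => M.green u.1 v.1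

/-- Extension by zero. -/
def ext0 {D : Finset M.V} (x : D → ℝ) (y : M.V) : ℝ := if h : y ∈ D then x ⟨y, h⟩ else 0

lemma ext0_coe {D : Finset M.V} (x : D → ℝ) (u : D) : ext0 x u.1 = x u := by
  simp [ext0]

lemma gmat_mulVec {D : Finset M.V} (x : D → ℝ) (u : D) :
    (M.gmat D *ᵥ x) u = M.pot D (ext0 x) u := by
  rw [pot, ← Finset.sum_coe_sort]
  refine Finset.sum_congr rfl fun v _ => ?_
  rw [ext0_coe, mul_comm]
  rfl

lemma gmat_quadForm {D : Finset M.V} (x : D → ℝ) :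
    x ⬝ᵥ M.gmat D *ᵥ x = M.energy D (ext0 x) := by
  rw [energy, ← Finset.sum_coe_sort]
  refine Finset.sum_congr rfl fun v _ => ?_
  rw [ext0_coe, gmat_mulVec]

lemma Reg.gmat_symm (H : M.Reg K) (D : Finset M.V) : (M.gmat D).IsSymm :=
  Matrix.IsSymm.ext fun _ _ => H.green_symm _ _

lemma Reg.pot_nonneg_of_nonneg (H : M.Reg K) {D : Finset M.V} {σ : M.V → ℝ}
    (h : ∀ x ∈ D, 0 ≤ M.pot D σ x) (x : M.V) : 0 ≤ M.pot D σ x := by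
  have neg : ∀ z, M.pot D (fun y => -1 * σ y) z = -M.pot D σ z := fun z => by
    rw [pot_smul, neg_one_mul]
  have := H.pot_le (A := D) (σ := fun y => -1 * σ y) (v := fun _ => 0) (fun _ => le_rfl)
    (fun x _ => (H.avg_const 0 x).le) (fun z hz => by rw [neg]; linarith [h z hz]) x
  rw [neg] at this
  linarith

lemma Reg.gmat_isUnit (H : M.Reg K) (D : Finset M.V) : IsUnit (M.gmat D) := by
  rw [← Matrix.mulVec_injective_iff_isUnit]
  intro a b hab
  rw [← sub_eq_zero]
  obtain ⟨x, hx⟩ : ∃ x, x = a - b := ⟨_, rfl⟩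
  rw [← hx]
  have h0 : M.gmat D *ᵥ x = 0 := by
    rw [hx, mulVec_sub, sub_eq_zero]
    exact hab
  have h1 : ∀ y ∈ D, M.pot D (ext0 x) y = 0 := fun y hy => by
    rw [← gmat_mulVec x ⟨y, hy⟩, h0, Pi.zero_apply]
  have h2 : ∀ y, M.pot D (ext0 x) y = 0 := fun y =>
    le_antisymm (H.pot_le (fun _ => le_rfl) (fun z _ => (H.avg_const 0 z).le)
      (fun z hz => (h1 z hz).le) y) (H.pot_nonneg_of_nonneg (fun z hz => (h1 z hz).ge) y)
  ext u
  have h3 := H.pot_eq D (ext0 x) u.1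
  rw [h2, if_pos u.2, ext0_coe, avg_congr (g := fun _ => 0) fun y _ => h2 y, H.avg_const,
    add_zero] at h3
  have := H.lamTot_pos u.1
  rw [eq_comm, div_eq_zero_iff] at h3
  exact h3.resolve_right this.ne'

/-- The precision matrix of the free field on a finite set. -/
def qmat (M : WGraph) (D : Finset M.V) : Matrix D D ℝ := (M.gmat D)⁻¹

lemma Reg.gmat_mul_qmat (H : M.Reg K) (D : Finset M.V) : M.gmat D * M.qmat D = 1 :=
  Matrix.mul_nonsing_inv _ ((Matrix.isUnit_iff_isUnit_det _).1 (H.gmat_isUnit D))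

lemma Reg.qmat_mul_gmat (H : M.Reg K) (D : Finset M.V) : M.qmat D * M.gmat D = 1 :=
  Matrix.nonsing_inv_mul _ ((Matrix.isUnit_iff_isUnit_det _).1 (H.gmat_isUnit D))

lemma Reg.qmat_symm (H : M.Reg K) (D : Finset M.V) : (M.qmat D).IsSymm := by
  rw [Matrix.IsSymm, qmat, Matrix.transpose_nonsing_inv, (H.gmat_symm D).eq]

lemma Reg.pot_qmat (H : M.Reg K) {D : Finset M.V} (x : D → ℝ) (u : D) :
    M.pot D (ext0 (M.qmat D *ᵥ x)) u = x u := by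
  rw [← gmat_mulVec, mulVec_mulVec, H.gmat_mul_qmat, one_mulVec]

/-- The charge at a point is the Laplacian of the potential. -/
lemma Reg.qmat_mulVec (H : M.Reg K) {D : Finset M.V} (x : D → ℝ) (u : D) :
    (M.qmat D *ᵥ x) u =
      M.lamTot u.1 * (x u - M.avg (M.pot D (ext0 (M.qmat D *ᵥ x))) u.1) := by
  have h := H.pot_eq D (ext0 (M.qmat D *ᵥ x)) u.1
  rw [H.pot_qmat, if_pos u.2, ext0_coe] at h
  have := (H.lamTot_pos u.1).ne'
  field_simp at h
  linarith

lemma Reg.qmat_mulVec_nonneg (H : M.Reg K) {D : Finset M.V} {f : M.V → ℝ} (hf : ∀ x, 0 ≤ f x)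
    (hsup : ∀ x, x ∉ D → M.avg f x ≤ f x) (u : D) (hu : M.avg f u.1 ≤ f u.1) :
    0 ≤ (M.qmat D *ᵥ fun v => f v.1) u := by
  rw [H.qmat_mulVec]
  refine mul_nonneg (H.lamTot_pos _).le (sub_nonneg.2 ((avg_mono fun y _ => ?_).trans hu))
  exact H.pot_le hf hsup (fun x hx => (H.pot_qmat (fun v => f v.1) ⟨x, hx⟩).le) y

lemma Reg.qmat_off_diag (H : M.Reg K) {D : Finset M.V} {u v : D} (huv : u ≠ v) :
    M.qmat D u v ≤ -M.lam u.1 v.1 := by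
  have e : M.qmat D u v = (M.qmat D *ᵥ Pi.single v 1) u := by simp
  rw [e, H.qmat_mulVec, Pi.single_eq_of_ne huv, zero_sub, mul_neg, neg_le_neg_iff]
  obtain ⟨w, hw⟩ : ∃ w, w = M.pot D (ext0 (M.qmat D *ᵥ Pi.single v 1)) := ⟨_, rfl⟩
  have h1 : ∀ z : D, w z.1 = (Pi.single v 1 : D → ℝ) z := fun z => by rw [hw, H.pot_qmat]
  have h0 : ∀ z, 0 ≤ w z := fun z => by
    rw [hw]
    refine H.pot_nonneg_of_nonneg (fun x hx => ?_) z
    rw [← hw, h1 ⟨x, hx⟩, Pi.single_apply]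
    split_ifs <;> norm_num
  rw [← hw]
  by_cases hn : v.1 ∈ M.nb u.1
  · have h2 : M.p u.1 v.1 * w v.1 ≤ M.avg w u.1 :=
      Finset.single_le_sum (f := fun y => M.p u.1 y * w y)
        (fun y _ => mul_nonneg (p_nonneg _ _) (h0 y)) hn
    rw [h1, Pi.single_eq_same, mul_one] at h2
    rw [← lamTot_mul_p]
    · exact mul_le_mul_of_nonneg_left h2 (H.lamTot_pos _).le
    all_goals exact H.lamTot_pos _
  · have : M.lam u.1 v.1 = 0 := by
      by_contra h
      exact hn (mem_nb.2 h)
    rw [this]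
    exact mul_nonneg (H.lamTot_pos _).le (avg_nonneg fun y _ => h0 y)

lemma Reg.gmat_quadForm_le (H : M.Reg K) {D : Finset M.V} (x : D → ℝ) :
    x ⬝ᵥ M.gmat D *ᵥ x ≤ K * (D.card + 1) * ∑ i, x i ^ 2 := by
  have h1 : x ⬝ᵥ M.gmat D *ᵥ x ≤ K * (∑ i, |x i|) ^ 2 := by
    rw [sq, Finset.sum_mul, Finset.mul_sum]
    refine Finset.sum_le_sum fun i _ => ?_
    rw [mulVec, dotProduct, Finset.mul_sum, Finset.mul_sum, Finset.mul_sum]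
    refine Finset.sum_le_sum fun j _ => ?_
    calc x i * (M.green i.1 j.1 * x j) = M.green i.1 j.1 * (x i * x j) := by ring
      _ ≤ M.green i.1 j.1 * (|x i| * |x j|) :=
        mul_le_mul_of_nonneg_left ((le_abs_self _).trans (abs_mul _ _).le) (green_nonneg _ _)
      _ ≤ _ := mul_le_mul_of_nonneg_right (H.green_le _ _) (by positivity)
  have h2 : (∑ i, |x i|) ^ 2 ≤ D.card * ∑ i, x i ^ 2 := by
    have := sq_sum_le_card_mul_sum_sq (s := (Finset.univ : Finset D)) (f := fun i => |x i|)
    simpa using this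
  have h3 : 0 ≤ ∑ i, x i ^ 2 := Finset.sum_nonneg fun _ _ => sq_nonneg _
  calc _ ≤ _ := h1
    _ ≤ K * (D.card * ∑ i, x i ^ 2) := mul_le_mul_of_nonneg_left h2 H.K_pos.le
    _ ≤ _ := by nlinarith [mul_nonneg H.K_pos.le h3]

lemma Reg.precision (H : M.Reg K) (hp : M.GreenPSD) (D : Finset M.V) :
    Precision (M.qmat D) (K * (D.card + 1))⁻¹ where
  symm := H.qmat_symm D
  pos := inv_pos.2 (mul_pos H.K_pos (by positivity))
  off_diag u v huv := (H.qmat_off_diag huv).trans (neg_nonpos.2 (M.lam_nonneg _ _))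
  coercive x := by
    obtain ⟨C, hC⟩ : ∃ C, C = K * ((D.card : ℝ) + 1) := ⟨_, rfl⟩
    have C0 : 0 < C := hC ▸ mul_pos H.K_pos (by positivity)
    obtain ⟨y, hy⟩ : ∃ y, y = M.qmat D *ᵥ x := ⟨_, rfl⟩
    have hx : M.gmat D *ᵥ y = x := by rw [hy, mulVec_mulVec, H.gmat_mul_qmat, one_mulVec]
    have h1 : 0 ≤ (y + (-C⁻¹) • x) ⬝ᵥ M.gmat D *ᵥ (y + (-C⁻¹) • x) := by
      rw [gmat_quadForm]; exact energy_nonneg hp _ _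
    rw [quadForm_add (H.gmat_symm D), hx, mulVec_smul, dotProduct_smul, smul_dotProduct,
      dotProduct_smul, bil_comm (H.gmat_symm D) y x, hx] at h1
    have h2 := H.gmat_quadForm_le x
    rw [← hC] at h2
    rw [← hC, ← hy]
    have h3 : x ⬝ᵥ x = ∑ i, x i ^ 2 := Finset.sum_congr rfl fun i _ => by ring
    rw [dotProduct_comm y x, h3] at h1
    simp only [smul_eq_mul] at h1
    have h4 : C⁻¹ * (x ⬝ᵥ M.gmat D *ᵥ x) ≤ ∑ i, x i ^ 2 := by
      rw [inv_mul_le_iff₀ C0]; exact h2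
    have h5 : C⁻¹ * (C⁻¹ * (x ⬝ᵥ M.gmat D *ᵥ x)) ≤ C⁻¹ * ∑ i, x i ^ 2 :=
      mul_le_mul_of_nonneg_left h4 (by positivity)
    linarith

end WGraph

/-! ## The law of the free field on a finite set -/

section GaussianLaw

open Matrix

variable {ι : Type} [Fintype ι] {Q G : Matrix ι ι ℝ} {δ : ℝ}

lemma lintegral_exp_mul_gw (hQ : Q.IsSymm) (hG : Q * G = 1) (c : ι → ℝ) :
    ∫⁻ x, ENNReal.ofReal (exp (c ⬝ᵥ x)) * gw Q x =
      ENNReal.ofReal (exp (1 / 2 * (c ⬝ᵥ G *ᵥ c))) * ∫⁻ x, gw Q x := by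
  rw [← lintegral_const_mul _ (measurable_gw Q),
    ← lintegral_add_right_eq_self (fun x => ENNReal.ofReal (exp (c ⬝ᵥ x)) * gw Q x) (G *ᵥ c)]
  refine lintegral_congr fun x => ?_
  unfold gw
  rw [← ENNReal.ofReal_mul (exp_pos _).le, ← ENNReal.ofReal_mul (exp_pos _).le, ← exp_add,
    ← exp_add, quadForm_add hQ, mulVec_mulVec, hG, one_mulVec, dotProduct_add,
    dotProduct_comm x c, dotProduct_comm (G *ᵥ c) c]
  congr 2
  ring

/-- A random vector all of whose marginals are Gaussian has a Gaussian density. -/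
lemma Precision.law_eq (hQ : Precision Q δ) (hG : Q * G = 1) (μ : Measure (ι → ℝ))
    [IsProbabilityMeasure μ]
    (hμ : ∀ c : ι → ℝ, μ.map (fun x => c ⬝ᵥ x) = gaussianReal 0 (Real.toNNReal (c ⬝ᵥ G *ᵥ c))) :
    μ = (∫⁻ x, gw Q x)⁻¹ • volume.withDensity (gw Q) := by
  obtain ⟨Z, hZ⟩ : ∃ Z, Z = ∫⁻ x, gw Q x := ⟨_, rfl⟩
  have Z1 : Z ≠ ⊤ := hZ ▸ hQ.lintegral_gw_ne_top
  have Z0 : Z ≠ 0 := by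
    rw [hZ]
    refine lintegral_ofReal_exp_ne_zero ?_
    have := measurable_quadForm Q
    fun_prop
  have mdot : ∀ c : ι → ℝ, Measurable fun x : ι → ℝ => c ⬝ᵥ x := fun c => by
    unfold dotProduct; fun_prop
  have qpos : ∀ c, 0 ≤ c ⬝ᵥ G *ᵥ c := fun c => by
    have := hQ.nonneg (G *ᵥ c)
    rwa [mulVec_mulVec, hG, one_mulVec, dotProduct_comm] at this
  obtain ⟨ρ, hρ⟩ : ∃ ρ : Measure (ι → ℝ), ρ = Z⁻¹ • volume.withDensity (gw Q) := ⟨_, rfl⟩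
  rw [← hZ, ← hρ]
  have lint : ∀ F : (ι → ℝ) → ℝ≥0∞, Measurable F → ∫⁻ x, F x ∂ρ = Z⁻¹ * ∫⁻ x, F x * gw Q x := by
    intro F hF
    rw [hρ, lintegral_smul_measure, lintegral_withDensity_eq_lintegral_mul _ (measurable_gw Q) hF]
    simp [mul_comm]
  have hρp : IsProbabilityMeasure ρ := ⟨by
    rw [← lintegral_one, lint _ measurable_const]
    simp only [one_mul]
    rw [← hZ, ENNReal.inv_mul_cancel Z0 Z1]⟩
  refine Measure.ext_of_charFunDual (funext fun L => ?_)
  obtain ⟨c, hc⟩ : ∃ c : ι → ℝ, ∀ x, L x = c ⬝ᵥ x := by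
    refine ⟨fun i => L (Pi.single i 1), fun x => ?_⟩
    conv_lhs => rw [pi_eq_sum_univ' x]
    rw [map_sum]
    refine Finset.sum_congr rfl fun i _ => ?_
    rw [map_smul, smul_eq_mul, mul_comm]
  have hL : (L : (ι → ℝ) → ℝ) = fun x => c ⬝ᵥ x := funext hc
  rw [charFunDual_eq_charFun_map_one, charFunDual_eq_charFun_map_one, hL, hμ c]
  congr 1
  have hpm : IsProbabilityMeasure (ρ.map fun x => c ⬝ᵥ x) :=
    Measure.isProbabilityMeasure_map (mdot c).aemeasurable
  refine Measure.ext_of_complexMGF_id_eq ?_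
  have hm : mgf id (gaussianReal 0 (Real.toNNReal (c ⬝ᵥ G *ᵥ c))) =
      mgf id (ρ.map fun x => c ⬝ᵥ x) := by
    rw [mgf_id_gaussianReal, mgf_id_map (mdot c).aemeasurable]
    ext t
    rw [mgf, integral_eq_lintegral_of_nonneg_ae (.of_forall fun _ => (exp_pos _).le)
      (by have := mdot c; fun_prop), lint _ (by have := mdot c; fun_prop)]
    have := lintegral_exp_mul_gw hQ.symm hG (t • c)
    simp only [smul_dotProduct, mulVec_smul, dotProduct_smul, smul_eq_mul] at this
    rw [this, ← hZ, mul_comm _ Z, ← mul_assoc, ENNReal.inv_mul_cancel Z0 Z1, one_mul,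
      ENNReal.toReal_ofReal (exp_pos _).le, Real.coe_toNNReal _ (qpos c)]
    congr 1
    ring
  have := eqOn_complexMGF_of_mgf hm
  rw [integrableExpSet_id_gaussianReal] at this
  ext z
  exact this (by simp)

end GaussianLaw

namespace Model

variable {M : Model}

instance (M : Model) : IsProbabilityMeasure M.P := M.Pprob

lemma aemeasurable_sum (s : Finset M.V) (c : M.V → ℝ) :
    AEMeasurable (fun ω => ∑ x ∈ s, c x * M.φ ω x) M.P :=
  (Finset.measurable_fun_sum _ fun x _ => (M.φ_meas x).const_mul _).aemeasurable

lemma memLp_sum (s : Finset M.V) (c : M.V → ℝ) :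
    MemLp (fun ω => ∑ x ∈ s, c x * M.φ ω x) 2 M.P := by
  have h := memLp_id_gaussianReal (μ := 0)
    (v := Real.toNNReal (∑ x ∈ s, ∑ y ∈ s, c x * c y * M.toWGraph.green x y)) 2
  rw [← M.φ_gauss s c] at h
  exact h.comp_of_map (aemeasurable_sum s c)

lemma memLp_field (x : M.V) : MemLp (fun ω => M.φ ω x) 2 M.P := by
  simpa using memLp_sum {x} fun _ => (1 : ℝ)

lemma variance_sum (s : Finset M.V) (c : M.V → ℝ) :
    Var[fun ω => ∑ x ∈ s, c x * M.φ ω x; M.P] =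
      Real.toNNReal (∑ x ∈ s, ∑ y ∈ s, c x * c y * M.toWGraph.green x y) := by
  rw [← variance_id_gaussianReal (μ := 0), ← M.φ_gauss s c,
    variance_map aemeasurable_id (aemeasurable_sum s c)]
  rfl

lemma covariance_eq (hsymm : ∀ x y, M.toWGraph.green x y = M.toWGraph.green y x) (x y : M.V) :
    cov[fun ω => M.φ ω x, fun ω => M.φ ω y; M.P] = M.toWGraph.green x y := by
  have g0 := WGraph.green_nonneg (M := M.toWGraph)
  have v1 : ∀ x, Var[fun ω => M.φ ω x; M.P] = M.toWGraph.green x x := fun x => by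
    have := variance_sum {x} fun _ => (1 : ℝ)
    simpa [g0 x x] using this
  rcases eq_or_ne x y with rfl | hxy
  · rw [covariance_self (M.φ_meas x).aemeasurable, v1]
  have v2 := variance_sum {x, y} fun _ => (1 : ℝ)
  rw [Real.coe_toNNReal _ (Finset.sum_nonneg fun a _ => Finset.sum_nonneg fun b _ => by
    simpa using g0 a b)] at v2
  simp only [Finset.sum_pair hxy, one_mul] at v2
  rw [variance_fun_add (memLp_field x) (memLp_field y), v1, v1, hsymm y x] at v2
  linarith

lemma greenPSD (hsymm : ∀ x y, M.toWGraph.green x y = M.toWGraph.green y x) :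
    M.toWGraph.GreenPSD := by
  intro s c
  have h : Var[fun ω => ∑ x ∈ s, c x * M.φ ω x; M.P] =
      ∑ x ∈ s, ∑ y ∈ s, c x * c y * M.toWGraph.green x y := by
    rw [variance_fun_sum' fun x _ => (memLp_field x).const_mul (c x)]
    refine Finset.sum_congr rfl fun x _ => Finset.sum_congr rfl fun y _ => ?_
    rw [covariance_const_mul_left, covariance_const_mul_right, covariance_eq hsymm]
    ring
  rw [← h]
  exact variance_nonneg _ _

open Matrix in
lemma field_law {K : ℝ} (H : M.toWGraph.Reg K) (D : Finset M.V) :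
    M.P.map (fun ω (u : D) => M.φ ω u.1) =
      (∫⁻ x, gw (M.toWGraph.qmat D) x)⁻¹ • volume.withDensity (gw (M.toWGraph.qmat D)) := by
  have hm : Measurable fun ω (u : D) => M.φ ω u.1 := measurable_pi_lambda _ fun u => M.φ_meas u.1
  have : IsProbabilityMeasure (M.P.map fun ω (u : D) => M.φ ω u.1) :=
    Measure.isProbabilityMeasure_map hm.aemeasurable
  refine (H.precision (greenPSD H.green_symm) D).law_eq
    (by convert! H.qmat_mul_gmat D) _ fun c => ?_
  rw [Measure.map_map (by unfold dotProduct; fun_prop) hm]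
  have h1 : (fun x : D → ℝ => c ⬝ᵥ x) ∘ (fun ω (u : D) => M.φ ω u.1) =
      fun ω => ∑ x ∈ D, WGraph.ext0 c x * M.φ ω x := by
    ext ω
    rw [← Finset.sum_coe_sort]
    exact Finset.sum_congr rfl fun u _ => by rw [WGraph.ext0_coe]
  rw [h1, M.φ_gauss, WGraph.gmat_quadForm, WGraph.energy_eq]

lemma prob_between_le {K : ℝ} (H : M.toWGraph.Reg K) (o : M.V) (b : ℝ) :
    M.P {ω | 0 < M.φ ω o ∧ M.φ ω o ≤ b} ≤ ENNReal.ofReal (K * b) := by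
  have h1 := M.φ_gauss {o} fun _ => 1
  simp only [Finset.sum_singleton, one_mul] at h1
  have h2 : {ω | 0 < M.φ ω o ∧ M.φ ω o ≤ b} = (fun ω => M.φ ω o) ⁻¹' Set.Ioc 0 b := rfl
  have g1 := H.green_diag_lb o
  have K1 := H.one_le
  have g0 : 0 < M.toWGraph.green o o := (inv_pos.2 H.K_pos).trans_le g1
  have v0 : Real.toNNReal (M.toWGraph.green o o) ≠ 0 := by simpa using g0
  rw [h2, ← Measure.map_apply (M.φ_meas o) measurableSet_Ioc, h1,
    gaussianReal_apply _ v0]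
  calc _ ≤ ∫⁻ _ in Set.Ioc 0 b, ENNReal.ofReal K := by
        refine lintegral_mono fun x => ENNReal.ofReal_le_ofReal ?_
        rw [gaussianPDFReal, Real.coe_toNNReal _ g0.le]
        have e1 : exp (-(x - 0) ^ 2 / (2 * M.toWGraph.green o o)) ≤ 1 := by
          refine exp_le_one_iff.2 (div_nonpos_of_nonpos_of_nonneg ?_ (by positivity))
          have := sq_nonneg (x - 0)
          linarith
        have e2 : (√(2 * π * M.toWGraph.green o o))⁻¹ ≤ K := by
          rw [inv_le_comm₀ (by positivity) H.K_pos]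
          refine Real.le_sqrt_of_sq_le ?_
          have := pi_gt_three
          have k1 : K⁻¹ ≤ 1 := inv_le_one_of_one_le₀ K1
          have k0 : 0 < K⁻¹ := inv_pos.2 H.K_pos
          nlinarith
        calc _ ≤ K * 1 := mul_le_mul e2 e1 (exp_pos _).le H.K_pos.le
          _ = K := mul_one K
    _ = _ := by
        rw [setLIntegral_const, Real.volume_Ioc, sub_zero, ENNReal.ofReal_mul H.K_pos.le]

end Model

/-! ## Reduction to a finite number of clusters -/

section Reduction

open Matrix

variable {ι : Type} [Fintype ι] {Q : Matrix ι ι ℝ} {δ : ℝ}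

lemma exists_oriented (ι : Type) [Fintype ι] : ∃ E : Finset (ι × ι), Oriented E := by
  refine ⟨Finset.univ.filter fun e => Fintype.equivFin ι e.1 < Fintype.equivFin ι e.2, ?_, ?_, ?_⟩
  · intro e he h
    rw [Finset.mem_filter, h] at he
    exact lt_irrefl _ he.2
  · intro u v huv
    simp only [Finset.mem_filter, Finset.mem_univ, true_and]
    exact lt_or_gt_of_ne fun h => huv ((Fintype.equivFin ι).injective h)
  · intro u v h1 h2
    rw [Finset.mem_filter] at h1 h2
    exact lt_asymm h1.2 h2.2

/-- The probability that an increasing property of the cluster of `o` holds is at most the sum of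
the normalized cluster masses. -/
lemma Precision.prob_cluster_le (hQ : Precision Q δ) {E : Finset (ι × ι)} (hE : Oriented E) (o : ι)
    {Ω : Type} [MeasurableSpace Ω] (P : Measure Ω) {X : Ω → ι → ℝ} (hX : Measurable X)
    (hlaw : P.map X = (∫⁻ x, gw Q x)⁻¹ • volume.withDensity (gw Q)) {l : ι × ι → ℝ}
    (hl0 : ∀ e, 0 ≤ l e) (hl : ∀ e ∈ E, l e ≤ -Q e.1 e.2) {s : Ω → Finset (ι × ι)}
    (hsE : ∀ ω, s ω ⊆ E) {q : Ω → ι × ι → ℝ}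
    (hq : ∀ ω e, q ω e = 1 - exp (-(2 * l e * max (X ω e.1) 0 * max (X ω e.2) 0)))
    (hs : ∀ t ⊆ E, P {ω | s ω = t} ≤
      ∫⁻ ω, ENNReal.ofReal ((∏ e ∈ t, q ω e) * ∏ e ∈ E \ t, (1 - q ω e)) ∂P)
    {T : Finset (Finset ι)} (hT : ∀ S ∈ T, ∀ S', S ⊆ S' → S' ∈ T) (hTo : {o} ∉ T) :
    P {ω | cluster o (s ω) ∈ T} ≤ ∑ S ∈ T, (∫⁻ x, gw Q x)⁻¹ * clusterMass Q o E S := by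
  have q0 : ∀ ω e, 0 ≤ q ω e := fun ω e => by
    rw [hq]
    refine sub_nonneg.2 (exp_le_one_iff.2 (neg_nonpos.2 ?_))
    have := hl0 e
    positivity
  have q1 : ∀ ω e, q ω e ≤ 1 := fun ω e => by
    rw [hq]
    exact sub_le_self _ (exp_pos _).le
  have mq : ∀ e, Measurable fun ω => q ω e := fun e => by
    simp_rw [hq]
    have h1 : Measurable fun ω => X ω e.1 := (measurable_pi_apply e.1).comp hX
    have h2 : Measurable fun ω => X ω e.2 := (measurable_pi_apply e.2).comp hX
    fun_prop
  have step : ∀ ω, bern E (q ω) (fun t => if cluster o t ∈ T then 1 else 0) ≤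
      if 0 < X ω o then
        bern E (edgeProb Q (X ω)) (fun t => if cluster o t ∈ T then 1 else 0) else 0 := by
    intro ω
    split_ifs with h
    · refine bern_mono_prob (fun e _ => q0 ω e) (fun e he => ?_)
        (fun e _ => edgeProb_le_one Q _ e) fun t t' htt => ?_
      · rw [hq, edgeProb]
        refine sub_le_sub_left (exp_le_exp.2 ?_) _
        have h1 := hl e he
        have h2 := mul_nonneg (le_max_right (X ω e.1) 0) (le_max_right (X ω e.2) 0)
        nlinarith
      · have := cluster_mono o htt
        by_cases h1 : cluster o t ∈ T
        · rw [if_pos h1, if_pos (hT _ h1 _ this)]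
        · rw [if_neg h1]
          split_ifs <;> norm_num
    · refine (Finset.sum_eq_zero fun t ht => ?_).le
      dsimp only
      by_cases h1 : cluster o t ∈ T
      · have h2 : ∃ e ∈ t, e.1 = o ∨ e.2 = o := by
          by_contra hne
          push Not at hne
          refine hTo ?_
          convert h1
          ext y
          rw [Finset.mem_singleton, mem_cluster]
          constructor
          · rintro rfl
            exact .refl
          · intro hy
            rcases hy.cases_head with rfl | ⟨z, hz, -⟩
            · rfl
            · rcases hz with hz | hz
              · exact absurd rfl (hne _ hz).1
              · exact absurd rfl (hne _ hz).2
        obtain ⟨e, he, heo⟩ := h2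
        have h3 : q ω e = 0 := by
          rw [hq]
          rcases heo with rfl | rfl <;> rw [max_eq_right (not_lt.1 h)] <;> simp
        rw [Finset.prod_eq_zero he h3, zero_mul, zero_mul]
      · rw [if_neg h1, mul_zero]
  have mb : ∀ t, Measurable fun ω =>
      ENNReal.ofReal ((∏ e ∈ t, q ω e) * ∏ e ∈ E \ t, (1 - q ω e)) := fun t => by
    have h1 := Finset.measurable_fun_prod t fun e _ => mq e
    have h2 := Finset.measurable_fun_prod (E \ t) fun e _ => (mq e).const_sub 1
    fun_prop
  calc P {ω | cluster o (s ω) ∈ T}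
      ≤ P (⋃ t ∈ E.powerset.filter fun t => cluster o t ∈ T, {ω | s ω = t}) := by
        refine measure_mono fun ω hω => ?_
        simp only [Set.mem_iUnion]
        exact ⟨s ω, Finset.mem_filter.2 ⟨Finset.mem_powerset.2 (hsE ω), hω⟩, rfl⟩
    _ ≤ ∑ t ∈ E.powerset.filter fun t => cluster o t ∈ T, P {ω | s ω = t} :=
        measure_biUnion_finset_le _ _
    _ ≤ ∑ t ∈ E.powerset.filter fun t => cluster o t ∈ T,
          ∫⁻ ω, ENNReal.ofReal ((∏ e ∈ t, q ω e) * ∏ e ∈ E \ t, (1 - q ω e)) ∂P :=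
        Finset.sum_le_sum fun t ht => hs t (Finset.mem_powerset.1 (Finset.mem_filter.1 ht).1)
    _ = ∫⁻ ω, ENNReal.ofReal (bern E (q ω) fun t => if cluster o t ∈ T then 1 else 0) ∂P := by
        rw [← lintegral_finsetSum _ fun t _ => mb t]
        refine lintegral_congr fun ω => ?_
        rw [← ENNReal.ofReal_sum_of_nonneg fun t _ => mul_nonneg
          (Finset.prod_nonneg fun e _ => q0 ω e)
          (Finset.prod_nonneg fun e _ => sub_nonneg.2 (q1 ω e)), bern, Finset.sum_filter]
        refine congrArg _ (Finset.sum_congr rfl fun t _ => ?_)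
        split_ifs <;> simp
    _ ≤ ∫⁻ ω, onPos o (fun x => bern E (edgeProb Q x)
          fun t => if cluster o t ∈ T then 1 else 0) (X ω) ∂P := by
        refine lintegral_mono fun ω => ?_
        refine (ENNReal.ofReal_le_ofReal (step ω)).trans ?_
        unfold onPos
        split_ifs <;> simp
    _ = (∫⁻ x, gw Q x)⁻¹ * ∑ S ∈ T, clusterMass Q o E S := by
        have mo : Measurable (onPos o fun x => bern E (edgeProb Q x)
          fun t => if cluster o t ∈ T then 1 else 0) :=
          measurable_onPos o (measurable_bern E (measurable_edgeProb Q) _)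
        rw [← lintegral_map mo hX, hlaw, lintegral_smul_measure,
          lintegral_withDensity_eq_lintegral_mul _ (measurable_gw Q) mo]
        unfold clusterMass
        rw [hQ.sum_lintegral_clusterProb hE o T (measurable_gw Q), smul_eq_mul]
        simp_rw [Pi.mul_apply, mul_comm (gw Q _)]
    _ = _ := Finset.mul_sum _ _ _

end Reduction

namespace WGraph

/-- `S` meets every shell of width `K` around `o` up to distance `R`. -/
def Arm (M : WGraph) (K : ℝ) (o : M.V) (R : ℝ) (S : Finset M.V) : Prop :=
  ∀ t, 0 ≤ t → t ≤ R → ∃ y ∈ S, t ≤ M.d o y ∧ M.d o y ≤ t + K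

end WGraph

namespace Model

variable {M : Model} {K : ℝ}

/-- The open edges among the pairs in `E`. -/
def openEdges {D : Finset M.V} (E : Finset (D × D)) (ω : M.Ω) : Finset (D × D) :=
  E.filter fun e => M.opn 0 ω e.1.1 e.2.1

lemma arm_cluster (H : M.toWGraph.Reg K) {o : M.V} {R : ℝ} {D : Finset M.V} (ho : o ∈ D)
    (hD : ∀ y, M.d o y ≤ R + K → y ∈ D) {E : Finset (D × D)} (hE : Oriented E) {ω : M.Ω}
    (hω : ω ∈ M.armEvent o R) :
    M.toWGraph.Arm K o R
      ((_root_.cluster ⟨o, ho⟩ (openEdges E ω)).map (Function.Embedding.subtype _)) := by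
  intro t ht0 htR
  obtain ⟨y, hy, hc⟩ := hω
  have key : ∀ z, Relation.ReflTransGen (M.opn 0 ω) o z →
      (∃ hz : z ∈ D, (⟨z, hz⟩ : D) ∈ _root_.cluster ⟨o, ho⟩ (openEdges E ω) ∧ M.d o z < t) ∨
      ∃ w : D, w ∈ _root_.cluster ⟨o, ho⟩ (openEdges E ω) ∧ t ≤ M.d o w.1 ∧ M.d o w.1 ≤ t + K := by
    intro z hz
    induction hz with
    | refl =>
      have ho' : (⟨o, ho⟩ : D) ∈ _root_.cluster ⟨o, ho⟩ (openEdges E ω) := mem_cluster.2 .refl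
      rcases ht0.eq_or_lt with h | h
      · right
        have := M.d_self o
        have := H.K_pos
        exact ⟨⟨o, ho⟩, ho', by simp only; linarith, by simp only; linarith⟩
      · left
        exact ⟨ho, ho', by rw [M.d_self]; exact h⟩
    | @tail b c _ hbc ih =>
      rcases ih with ⟨hb, hbc', hbt⟩ | h
      · have hl := M.opn_edge 0 ω b c hbc
        have hj := H.jump b c hl
        have htri := M.d_triangle o b c
        have hcD : c ∈ D := hD c (by linarith)
        have hcc : (⟨c, hcD⟩ : D) ∈ _root_.cluster ⟨o, ho⟩ (openEdges E ω) := by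
          by_cases hbc2 : (⟨b, hb⟩ : D) = ⟨c, hcD⟩
          · rw [← hbc2]; exact hbc'
          · rw [mem_cluster] at hbc' ⊢
            refine hbc'.tail ?_
            rcases hE.total _ _ hbc2 with h | h
            · exact Or.inl (Finset.mem_filter.2 ⟨h, hbc⟩)
            · exact Or.inr (Finset.mem_filter.2 ⟨h, M.opn_symm 0 ω b c hbc⟩)
        by_cases h : M.d o c < t
        · exact Or.inl ⟨hcD, hcc, h⟩
        · exact Or.inr ⟨⟨c, hcD⟩, hcc, not_lt.1 h, by simp only; linarith⟩
      · exact Or.inr h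
  rcases key y hc with ⟨_, _, h⟩ | ⟨w, hw, h⟩
  · linarith
  · exact ⟨w.1, Finset.mem_map.2 ⟨w, hw, rfl⟩, h⟩

lemma prob_openEdges (M : Model) {D : Finset M.V} {E : Finset (D × D)} (hE : Oriented E)
    {t : Finset (D × D)} (ht : t ⊆ E) (q : M.Ω → D × D → ℝ)
    (hq : ∀ ω e, q ω e = 1 - exp (-(2 * M.lam e.1.1 e.2.1 * max (M.φ ω e.1.1) 0 *
      max (M.φ ω e.2.1) 0))) :
    M.P {ω | openEdges E ω = t} ≤
      ∫⁻ ω, ENNReal.ofReal ((∏ e ∈ t, q ω e) * ∏ e ∈ E \ t, (1 - q ω e)) ∂M.P := by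
  obtain ⟨j, hj⟩ : ∃ j : D × D ↪ M.V × M.V, ∀ e, j e = (e.1.1, e.2.1) :=
    ⟨(Function.Embedding.subtype _).prodMap (Function.Embedding.subtype _), fun e => rfl⟩
  have hdis : Disjoint (t.map j) ((E \ t).map j) :=
    (Finset.disjoint_map j).2 Finset.disjoint_sdiff
  have hlaw := M.opn_law 0 (t.map j) ((E \ t).map j) hdis (by
    rw [← Finset.map_union, Finset.union_sdiff_of_subset ht]
    intro e he f hf hef
    obtain ⟨e, heE, rfl⟩ := Finset.mem_map.1 he
    obtain ⟨f, hfE, rfl⟩ := Finset.mem_map.1 hf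
    intro h
    rw [hj, hj, Prod.swap_prod_mk, Prod.mk.injEq] at h
    have h1 : e.1 = f.2 := Subtype.ext h.1
    have h2 : e.2 = f.1 := Subtype.ext h.2
    refine hE.asymm e.1 e.2 heE ?_
    rw [h1, h2]
    exact hfE) Set.univ MeasurableSet.univ
  simp only [Set.mem_univ, Set.ofPred_true, Set.univ_inter, Measure.restrict_univ, sub_zero,
    Finset.prod_map, Finset.forall_mem_map, hj] at hlaw
  calc _ ≤ _ := measure_mono fun ω hω => ?_
    _ = _ := hlaw
    _ = _ := by simp only [hq, sub_sub_cancel]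
  have hω' : openEdges E ω = t := hω
  constructor
  · intro e he
    rw [← hω'] at he
    exact (Finset.mem_filter.1 he).2
  · intro e he ho
    obtain ⟨he1, he2⟩ := Finset.mem_sdiff.1 he
    rw [← hω'] at he2
    exact he2 (Finset.mem_filter.2 ⟨he1, ho⟩)

open Matrix in
/-- The probability of an arm is bounded by a sum over finite clusters `S`, and few clusters avoid
an obstacle `s` while having a large energy with respect to a function `f` that is superharmonic
off `s`. -/
theorem exists_clusterLaw (H : M.toWGraph.Reg K) (o : M.V) {R : ℝ} (hR : 0 < R) {D : Finset M.V}
    (hD : ∀ y, M.d o y ≤ R + K → y ∈ D) :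
    ∃ cm : Finset M.V → ℝ, (∀ S, 0 ≤ cm S) ∧
      M.prob (M.armEvent o R) ≤ ∑ S ∈ D.powerset.filter (M.toWGraph.Arm K o R), cm S ∧
      ∀ s ⊆ D, ∀ f : M.V → ℝ, (∀ x, 0 ≤ f x) → (∀ x ∉ s, M.toWGraph.avg f x ≤ f x) →
        ∀ T ⊆ D.powerset, (∀ S ∈ T, Disjoint S s ∧ ∃ μ : M.V → ℝ, 0 < ∑ y ∈ S, μ y * f y ∧
          M.toWGraph.energy S μ ≤ (∑ y ∈ S, μ y * f y) ^ 2) →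
        ∑ S ∈ T, cm S ≤ 3 * (K * f o) := by
  have ho : o ∈ D := hD o (by rw [M.d_self]; linarith [H.K_pos])
  obtain ⟨E, hE⟩ := exists_oriented D
  have hQ := H.precision (greenPSD H.green_symm) D
  obtain ⟨Q, hQd⟩ : ∃ Q, Q = M.toWGraph.qmat D := ⟨_, rfl⟩
  rw [← hQd] at hQ
  obtain ⟨Z, hZ⟩ : ∃ Z, Z = ∫⁻ x, gw Q x := ⟨_, rfl⟩
  have Z1 : Z ≠ ⊤ := hZ ▸ hQ.lintegral_gw_ne_top
  have Z0 : Z ≠ 0 := by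
    rw [hZ]
    refine lintegral_ofReal_exp_ne_zero ?_
    have := measurable_quadForm Q
    fun_prop
  obtain ⟨m, hm⟩ : ∃ m : Finset D → ℝ≥0∞, m = fun S => Z⁻¹ * clusterMass Q ⟨o, ho⟩ E S := ⟨_, rfl⟩
  have hmt : ∀ T : Finset (Finset D), ∑ S ∈ T, m S ≠ ⊤ := fun T => by
    rw [hm, ← Finset.mul_sum]
    exact ENNReal.mul_ne_top (ENNReal.inv_ne_top.2 Z0) (hQ.sum_clusterMass_ne_top hE _ T)
  have hmt1 : ∀ S, m S ≠ ⊤ := fun S => by simpa using hmt {S}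
  obtain ⟨sub, hsub⟩ : ∃ sub : Finset M.V → Finset D, sub = fun S => S.subtype (· ∈ D) := ⟨_, rfl⟩
  have sub_mem : ∀ S (u : D), u ∈ sub S ↔ u.1 ∈ S := fun S u => by rw [hsub]; simp
  have sub_inj : ∀ T ⊆ D.powerset, Set.InjOn sub T := by
    intro T hT S hS S' hS' h
    ext y
    constructor
    · intro hy
      have := (sub_mem S ⟨y, Finset.mem_powerset.1 (hT hS) hy⟩).2 hy
      rw [h] at this
      exact (sub_mem _ _).1 this
    · intro hy
      have := (sub_mem S' ⟨y, Finset.mem_powerset.1 (hT hS') hy⟩).2 hy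
      rw [← h] at this
      exact (sub_mem _ _).1 this
  have sum_sub : ∀ T ⊆ D.powerset,
      ∑ S ∈ T, (m (sub S)).toReal = (∑ S ∈ T.image sub, m S).toReal := by
    intro T hT
    rw [ENNReal.toReal_sum fun S _ => hmt1 S, Finset.sum_image (sub_inj T hT)]
  obtain ⟨X, hX⟩ : ∃ X : M.Ω → D → ℝ, X = fun ω u => M.φ ω u.1 := ⟨_, rfl⟩
  have mX : Measurable X := by rw [hX]; exact measurable_pi_lambda _ fun u => M.φ_meas u.1
  have lawX := field_law H D
  rw [← hX, ← hQd] at lawX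
  refine ⟨fun S => (m (sub S)).toReal, fun S => ENNReal.toReal_nonneg, ?_, ?_⟩
  · rw [sum_sub _ (Finset.filter_subset _ _)]
    unfold prob
    rw [ENNReal.toReal_le_toReal (measure_ne_top _ _) (hmt _)]
    obtain ⟨T, hT⟩ : ∃ T, T = (D.powerset.filter (M.toWGraph.Arm K o R)).image sub := ⟨_, rfl⟩
    have memT : ∀ S, S ∈ T ↔ M.toWGraph.Arm K o R (S.map (Function.Embedding.subtype _)) := by
      intro S
      have e : sub (S.map (Function.Embedding.subtype _)) = S := by
        ext u
        rw [sub_mem]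
        simp
      rw [hT, Finset.mem_image]
      constructor
      · rintro ⟨S', hS', rfl⟩
        obtain ⟨h1, h2⟩ := Finset.mem_filter.1 hS'
        convert h2
        refine sub_inj D.powerset subset_rfl (Finset.mem_coe.2 (Finset.mem_powerset.2 ?_)) h1 e
        intro y hy
        obtain ⟨u, -, rfl⟩ := Finset.mem_map.1 hy
        exact u.2
      · intro h
        refine ⟨_, Finset.mem_filter.2 ⟨Finset.mem_powerset.2 ?_, h⟩, e⟩
        intro y hy
        obtain ⟨u, -, rfl⟩ := Finset.mem_map.1 hy
        exact u.2
    rw [← hT]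
    have hmono : ∀ S ∈ T, ∀ S', S ⊆ S' → S' ∈ T := by
      intro S hS S' hSS
      rw [memT] at hS ⊢
      intro t h1 h2
      obtain ⟨y, hy, h3⟩ := hS t h1 h2
      exact ⟨y, Finset.map_subset_map.2 hSS hy, h3⟩
    have hTo : {(⟨o, ho⟩ : D)} ∉ T := by
      rw [memT]
      intro h
      obtain ⟨y, hy, h1, -⟩ := h R hR.le le_rfl
      simp only [Finset.map_singleton, Finset.mem_singleton, Function.Embedding.subtype_apply] at hy
      rw [hy, M.d_self] at h1
      linarith
    have key := hQ.prob_cluster_le hE ⟨o, ho⟩ M.P mX lawX (l := fun e => M.lam e.1.1 e.2.1)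
      (fun e => M.lam_nonneg _ _) (fun e he => ?_) (s := openEdges E)
      (fun ω => Finset.filter_subset _ _)
      (q := fun ω e => 1 - exp (-(2 * M.lam e.1.1 e.2.1 * max (X ω e.1) 0 * max (X ω e.2) 0)))
      (fun ω e => rfl) (fun t ht => ?_) hmono hTo
    · rw [← hZ] at key
      refine le_trans (measure_mono fun ω hω => ?_) (key.trans (by rw [hm]))
      exact (memT _).2 (arm_cluster H ho hD hE hω)
    · have := H.qmat_off_diag (hE.ne e he)
      rw [hQd]
      linarith
    · have h := M.prob_openEdges hE ht (fun ω e => 1 - exp (-(2 * M.lam e.1.1 e.2.1 *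
        max (X ω e.1) 0 * max (X ω e.2) 0))) fun ω e => by rw [hX]
      convert! h
  · intro s hs f hf hsup T hT hTS
    rw [sum_sub T hT]
    have key := hQ.sum_clusterMass_le hE ⟨o, ho⟩ (sub s) (f := fun u => f u.1) (fun u => hf u.1)
      (fun u hu => ?_) (T.image sub) ?_
    · refine ENNReal.toReal_le_of_le_ofReal ?_ ?_
      · have := H.K_pos; have := hf o; positivity
      rw [hm, ← Finset.mul_sum]
      have hI : ∫⁻ x, (if 0 < x ⟨o, ho⟩ ∧ x ⟨o, ho⟩ ≤ f o then 1 else 0) * gw Q x =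
          Z * M.P {ω | 0 < M.φ ω o ∧ M.φ ω o ≤ f o} := by
        have ms : MeasurableSet {x : D → ℝ | 0 < x ⟨o, ho⟩ ∧ x ⟨o, ho⟩ ≤ f o} :=
          (measurableSet_lt measurable_const (measurable_pi_apply _)).inter
            (measurableSet_le (measurable_pi_apply _) measurable_const)
        have e1 : {ω | 0 < M.φ ω o ∧ M.φ ω o ≤ f o} =
            X ⁻¹' {x : D → ℝ | 0 < x ⟨o, ho⟩ ∧ x ⟨o, ho⟩ ≤ f o} := by rw [hX]; rfl
        rw [e1, ← Measure.map_apply mX ms, lawX, Measure.smul_apply, withDensity_apply _ ms,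
          smul_eq_mul, ← hZ, ← mul_assoc, ENNReal.mul_inv_cancel Z0 Z1, one_mul,
          ← lintegral_indicator ms]
        refine lintegral_congr fun x => ?_
        simp only [Set.indicator_apply, Set.mem_ofPred_eq, ite_mul, one_mul, zero_mul]
      rw [hI] at key
      calc _ ≤ Z⁻¹ * (3 * (Z * M.P {ω | 0 < M.φ ω o ∧ M.φ ω o ≤ f o})) := by gcongr
        _ = (Z⁻¹ * Z) * (3 * M.P {ω | 0 < M.φ ω o ∧ M.φ ω o ≤ f o}) := by ring
        _ = 3 * M.P {ω | 0 < M.φ ω o ∧ M.φ ω o ≤ f o} := by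
            rw [ENNReal.inv_mul_cancel Z0 Z1, one_mul]
        _ ≤ 3 * ENNReal.ofReal (K * f o) := by gcongr; exact prob_between_le H o _
        _ = _ := by
            rw [ENNReal.ofReal_mul (by norm_num : (0 : ℝ) ≤ 3)]
            norm_num
    · rw [hQd]
      exact H.qmat_mulVec_nonneg hf (fun x hx => hsup x fun h => hx (hs h)) u
        (hsup u.1 fun h => hu ((sub_mem _ _).2 h))
    · intro S' hS'
      obtain ⟨S, hS, rfl⟩ := Finset.mem_image.1 hS'
      obtain ⟨hd, μ, hμ1, hμ2⟩ := hTS S hS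
      have hSD := Finset.mem_powerset.1 (hT hS)
      refine ⟨?_, ?_⟩
      · rw [Finset.disjoint_left] at hd ⊢
        intro u h1 h2
        exact hd ((sub_mem _ _).1 h1) ((sub_mem _ _).1 h2)
      · obtain ⟨ν, hν⟩ : ∃ ν : D → ℝ, ν = fun u => if u.1 ∈ S then μ u.1 else 0 := ⟨_, rfl⟩
        have e1 : Q *ᵥ (M.toWGraph.gmat D *ᵥ ν) = ν := by
          rw [Matrix.mulVec_mulVec, hQd, H.qmat_mul_gmat]
          convert! Matrix.one_mulVec ν
        have e2 : ∀ F : M.V → ℝ, ∑ u : D, F u.1 * ν u = ∑ y ∈ S, μ y * F y := by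
          intro F
          calc _ = ∑ u : D, (fun y => if y ∈ S then μ y * F y else 0) u.1 := by
                refine Finset.sum_congr rfl fun u _ => ?_
                rw [hν]
                dsimp only
                split_ifs <;> ring
            _ = _ := by
                rw [Finset.sum_coe_sort D fun y => if y ∈ S then μ y * F y else 0,
                  Finset.sum_ite_mem, Finset.inter_eq_right.2 hSD]
        refine ⟨M.toWGraph.gmat D *ᵥ ν, ?_, ?_, ?_⟩
        · intro v hv
          rw [e1, hν]
          exact if_neg fun h => hv ((sub_mem _ _).2 h)
        · rw [e1]
          exact (e2 f).trans_ne hμ1.ne'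
        · rw [e1]
          refine le_of_eq_of_le ?_ (hμ2.trans_eq ?_)
          · refine Eq.trans (Finset.sum_congr rfl fun u _ => ?_) (e2 (M.toWGraph.pot S μ))
            exact congrArg (· * ν u) (e2 (M.green u.1))
          · exact congrArg (· ^ 2) (e2 f).symm

end Model

/-! ## Escape probabilities and energies of clusters -/

namespace WGraph

variable {M : WGraph} {K : ℝ}

/-- The probability that the walk leaves `Λ` before hitting `S`. -/
def escLim (M : WGraph) (S : Finset M.V) (Λ : Set M.V) (x : M.V) : ℝ := ⨆ n, M.esc S Λ n x

lemma Reg.tendsto_esc (H : M.Reg K) (S : Finset M.V) (Λ : Set M.V) (x : M.V) :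
    Tendsto (fun n => M.esc S Λ n x) atTop (𝓝 (M.escLim S Λ x)) :=
  tendsto_atTop_ciSup (esc_monotone S Λ x) ⟨1, by rintro _ ⟨n, rfl⟩; exact H.esc_le_one S Λ n x⟩

lemma Reg.escLim_nonneg (H : M.Reg K) (S : Finset M.V) (Λ : Set M.V) (x : M.V) :
    0 ≤ M.escLim S Λ x :=
  ge_of_tendsto' (H.tendsto_esc S Λ x) fun n => esc_nonneg S Λ n x

lemma Reg.escLim_le_one (H : M.Reg K) (S : Finset M.V) (Λ : Set M.V) (x : M.V) :
    M.escLim S Λ x ≤ 1 :=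
  le_of_tendsto' (H.tendsto_esc S Λ x) fun n => H.esc_le_one S Λ n x

lemma escLim_of_notMem {S : Finset M.V} {Λ : Set M.V} {x : M.V} (hx : x ∉ S) (hΛ : x ∉ Λ) :
    M.escLim S Λ x = 1 := by
  unfold escLim
  simp [esc_of_notMem hx hΛ]

lemma Reg.avg_escLim_le (H : M.Reg K) {S : Finset M.V} (Λ : Set M.V) {x : M.V} (hx : x ∉ S) :
    M.avg (M.escLim S Λ) x ≤ M.escLim S Λ x := by
  by_cases hΛ : x ∈ Λ
  · have h1 : Tendsto (fun n => M.avg (M.esc S Λ n) x) atTop (𝓝 (M.avg (M.escLim S Λ) x)) :=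
      tendsto_finsetSum _ fun y _ => (H.tendsto_esc S Λ y).const_mul _
    have h2 := (tendsto_add_atTop_iff_nat 1).2 (H.tendsto_esc S Λ x)
    simp_rw [esc_succ hx hΛ] at h2
    exact (tendsto_nhds_unique h1 h2).le
  · rw [escLim_of_notMem hx hΛ, ← H.avg_const 1 x]
    exact avg_mono fun y _ => H.escLim_le_one S Λ y

lemma Reg.E_escLim_le (H : M.Reg K) {X : RSet M.V} {Λ : Set M.V} {x : M.V} {p : ℝ}
    (h : ∀ m, X.E (fun s => M.esc s Λ m x) ≤ p) : X.E (fun s => M.escLim s Λ x) ≤ p :=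
  le_of_tendsto' (tendsto_finsetSum _ fun i _ => (H.tendsto_esc (X.s i) Λ x).const_mul _) h

/-- The energy of a superposition of charges carried by well separated annuli. -/
lemma Reg.energy_sum_le (H : M.Reg K) (hp : M.GreenPSD) {S B : Finset M.V} {A : M.V → Finset M.V}
    {L κ N₀ : ℝ} (hL : 0 < L) {μ : M.V → M.V → ℝ} (μ0 : ∀ b y, 0 ≤ μ b y)
    (hμA : ∀ b, ∀ y ∉ A b, μ b y = 0)
    (hA : ∀ b ∈ B, ∀ y ∈ A b, 2 * L ≤ M.d b y ∧ M.d b y ≤ κ * L)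
    (hpot : ∀ b x, M.pot S (μ b) x ≤ M.green b x)
    (hN : ∀ b, ((B.filter fun b' => M.d b b' ≤ (2 * κ + 1) * L).card : ℝ) ≤ N₀) {T : ℝ}
    (hT : T = ∑ b ∈ B, ∑ y ∈ S, μ b y) :
    M.energy S (fun y => ∑ b ∈ B, μ b y) ≤ K / L * (T ^ 2 + N₀ * T) := by
  have hK := H.K_pos
  obtain ⟨τ, hτ⟩ : ∃ τ : M.V → ℝ, τ = fun b => ∑ y ∈ S, μ b y := ⟨_, rfl⟩
  have τ0 : ∀ b, 0 ≤ τ b := fun b => by rw [hτ]; exact Finset.sum_nonneg fun y _ => μ0 b y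
  have hTτ : T = ∑ b ∈ B, τ b := by rw [hT, hτ]
  obtain ⟨I, hI⟩ : ∃ I : M.V → M.V → ℝ, I = fun b b' => ∑ y ∈ S, μ b' y * M.pot S (μ b) y :=
    ⟨_, rfl⟩
  have e1 : M.energy S (fun y => ∑ b ∈ B, μ b y) = ∑ b ∈ B, ∑ b' ∈ B, I b b' := by
    have e2 : ∀ y, M.pot S (fun y => ∑ b ∈ B, μ b y) y = ∑ b ∈ B, M.pot S (μ b) y := by
      intro y
      unfold pot
      simp_rw [Finset.sum_mul]
      exact Finset.sum_comm
    unfold energy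
    simp_rw [e2, hI, Finset.sum_mul_sum]
    rw [Finset.sum_comm (s := S)]
    refine Eq.trans (Finset.sum_congr rfl fun b' _ => Finset.sum_comm) Finset.sum_comm
  have self : ∀ b ∈ B, M.energy S (μ b) ≤ K / (2 * L) * τ b := by
    intro b hb
    rw [hτ]
    dsimp only
    rw [Finset.mul_sum]
    refine Finset.sum_le_sum fun y _ => ?_
    by_cases hy : y ∈ A b
    · rw [mul_comm]
      exact mul_le_mul_of_nonneg_right ((hpot b y).trans
        (H.green_ub' (by positivity) (hA b hb y hy).1)) (μ0 b y)
    · rw [hμA b y hy]; simp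
  have pair : ∀ b ∈ B, ∀ b' ∈ B, I b b' ≤ K / L * (τ b * τ b') +
      if M.d b b' ≤ (2 * κ + 1) * L then K / (4 * L) * (τ b + τ b') else 0 := by
    intro b hb b' hb'
    have h0 : 0 ≤ K / L * (τ b * τ b') :=
      mul_nonneg (by positivity) (mul_nonneg (τ0 b) (τ0 b'))
    split_ifs with hn
    · have h1 := H.mutual_le hp S (μ b) (μ b')
      have h2 := self b hb
      have h3 := self b' hb'
      have h4 : K / (2 * L) = 2 * (K / (4 * L)) := by field_simp; norm_num
      rw [h4] at h2 h3
      rw [hI]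
      dsimp only
      linarith
    · rw [hI, add_zero]
      dsimp only
      have h1 : ∀ y ∈ S, μ b' y * M.pot S (μ b) y ≤ μ b' y * (K / L * τ b) := by
        intro y _
        by_cases hy : y ∈ A b'
        · refine mul_le_mul_of_nonneg_left ?_ (μ0 b' y)
          rw [hτ]
          dsimp only
          rw [Finset.mul_sum]
          refine Finset.sum_le_sum fun x _ => ?_
          by_cases hx : x ∈ A b
          · rw [mul_comm]
            refine mul_le_mul_of_nonneg_right (H.green_ub' hL ?_) (μ0 b x)
            have t1 := M.d_triangle b x b'
            have t2 := M.d_triangle x y b'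
            have t3 := (hA b hb x hx).2
            have t4 := (hA b' hb' y hy).2
            rw [M.d_symm y b'] at t2
            rw [M.d_symm y x]
            linarith
          · rw [hμA b x hx]; simp
        · rw [hμA b' y hy]; simp
      refine (Finset.sum_le_sum h1).trans_eq ?_
      rw [← Finset.sum_mul, hτ]
      ring
  have near : ∀ b, ∑ b' ∈ B, (if M.d b b' ≤ (2 * κ + 1) * L then τ b else 0) ≤ N₀ * τ b := by
    intro b
    rw [← Finset.sum_filter, Finset.sum_const, nsmul_eq_mul]
    exact mul_le_mul_of_nonneg_right (hN b) (τ0 b)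
  have near1 : ∑ b ∈ B, ∑ b' ∈ B, (if M.d b b' ≤ (2 * κ + 1) * L then τ b else 0) ≤ N₀ * T := by
    rw [hTτ, Finset.mul_sum]
    exact Finset.sum_le_sum fun b _ => near b
  have near2 : ∑ b ∈ B, ∑ b' ∈ B, (if M.d b b' ≤ (2 * κ + 1) * L then τ b' else 0) ≤ N₀ * T := by
    rw [Finset.sum_comm]
    simp_rw [M.d_symm _ _] at near1 ⊢
    convert near1 using 6
  rw [e1]
  calc _ ≤ ∑ b ∈ B, ∑ b' ∈ B, (K / L * (τ b * τ b') +
        if M.d b b' ≤ (2 * κ + 1) * L then K / (4 * L) * (τ b + τ b') else 0) :=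
        Finset.sum_le_sum fun b hb => Finset.sum_le_sum fun b' hb' => pair b hb b' hb'
    _ = K / L * T ^ 2 + K / (4 * L) *
        (∑ b ∈ B, ∑ b' ∈ B, (if M.d b b' ≤ (2 * κ + 1) * L then τ b else 0) +
          ∑ b ∈ B, ∑ b' ∈ B, (if M.d b b' ≤ (2 * κ + 1) * L then τ b' else 0)) := by
        rw [hTτ, sq, Finset.sum_mul_sum, Finset.mul_sum, ← Finset.sum_add_distrib, Finset.mul_sum,
          ← Finset.sum_add_distrib]
        refine Finset.sum_congr rfl fun b _ => ?_
        rw [Finset.mul_sum, ← Finset.sum_add_distrib, Finset.mul_sum, ← Finset.sum_add_distrib]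
        refine Finset.sum_congr rfl fun b' _ => ?_
        split_ifs <;> ring
    _ ≤ K / L * T ^ 2 + K / (4 * L) * (N₀ * T + N₀ * T) := by gcongr
    _ ≤ _ := by
        have h4 : K / L = 4 * (K / (4 * L)) := by field_simp
        have h5 : 0 ≤ K / (4 * L) := by positivity
        have h6 : 0 ≤ T := hTτ ▸ Finset.sum_nonneg fun b _ => τ0 b
        rw [h4]
        by_cases hB : B = ∅
        · have : T = 0 := by rw [hTτ, hB, Finset.sum_empty]
          rw [this]; simp
        · obtain ⟨b, -⟩ := Finset.nonempty_iff_ne_empty.2 hB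
          have h7 : 0 ≤ N₀ := (Nat.cast_nonneg _).trans (hN b)
          nlinarith [mul_nonneg h5 (mul_nonneg h7 h6)]

lemma sum_inv_le (n : ℕ) : ∑ i ∈ Finset.range n, ((i : ℝ) + 1)⁻¹ ≤ 1 + log n := by
  have := harmonic_le_one_add_log n
  simpa [harmonic] using this

lemma sum_inv_abs_le {N k : ℕ} (hk : k < N) {C : ℝ} (hC : 0 ≤ C) {G : ℕ → ℝ} (h0 : G k ≤ C)
    (h : ∀ l, l ≠ k → G l ≤ C * |(k : ℝ) - l|⁻¹) :
    ∑ l ∈ Finset.range N, G l ≤ C * (3 + 2 * log N) := by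
  obtain ⟨m, rfl⟩ : ∃ m, N = k + 1 + m := ⟨N - (k + 1), by omega⟩
  have hlog : ∀ n ≤ k + 1 + m, ∑ i ∈ Finset.range n, ((i : ℝ) + 1)⁻¹ ≤
      1 + log ((k + 1 + m : ℕ) : ℝ) := by
    intro n hn
    refine (Finset.sum_le_sum_of_subset_of_nonneg (Finset.range_subset_range.2 hn)
      fun i _ _ => by positivity).trans (sum_inv_le _)
  rw [Finset.sum_range_add, Finset.sum_range_succ]
  have h1 : ∑ l ∈ Finset.range k, G l ≤ C * ∑ i ∈ Finset.range k, ((i : ℝ) + 1)⁻¹ := by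
    rw [← Finset.sum_range_reflect (fun i : ℕ => ((i : ℝ) + 1)⁻¹), Finset.mul_sum]
    refine Finset.sum_le_sum fun l hl => ?_
    have hl' := Finset.mem_range.1 hl
    refine (h l hl'.ne).trans_eq ?_
    congr 2
    have : ((k - 1 - l : ℕ) : ℝ) + 1 = k - l := by
      rw [Nat.cast_sub (by omega), Nat.cast_sub (by omega)]; push_cast; ring
    rw [this, abs_of_nonneg]
    have : (l : ℝ) < k := by exact_mod_cast hl'
    linarith
  have h2 : ∑ j ∈ Finset.range m, G (k + 1 + j) ≤ C * ∑ i ∈ Finset.range m, ((i : ℝ) + 1)⁻¹ := by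
    rw [Finset.mul_sum]
    refine Finset.sum_le_sum fun j _ => (h _ (by omega)).trans_eq ?_
    congr 2
    push_cast
    rw [show (k : ℝ) - (k + 1 + j) = -(j + 1) by ring, abs_neg, abs_of_nonneg (by positivity)]
  have h3 := mul_le_mul_of_nonneg_left (hlog k (by omega)) hC
  have h4 := mul_le_mul_of_nonneg_left (hlog m (by omega)) hC
  linarith

/-- A set that meets all shells up to distance `R` carries a unit charge far from the centre whose
energy is at most of order `log R / R`. -/
lemma Reg.exists_arm_charge (H : M.Reg K) {o : M.V} {R : ℝ} (hR : 3 ≤ R) (hRK : 8 * K ≤ R)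
    {S : Finset M.V} (hS : M.Arm K o R S) : ∃ μ : M.V → ℝ,
      (∀ y, M.d o y < R / 2 → μ y = 0) ∧ ∑ y ∈ S, μ y = 1 ∧
        M.energy S μ ≤ 40 * K ^ 2 * log R / R := by
  have hK := H.K_pos
  have hK1 := H.one_le
  obtain ⟨N, hN⟩ : ∃ N, N = ⌊R / (4 * K)⌋₊ := ⟨_, rfl⟩
  have hN1 : (N : ℝ) ≤ R / (4 * K) := hN ▸ Nat.floor_le (by positivity)
  have hN2 : R / (4 * K) < N + 1 := hN ▸ Nat.lt_floor_add_one _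
  have hN3 : R / (8 * K) ≤ N := by
    have h1 : R / (4 * K) = 2 * (R / (8 * K)) := by field_simp; norm_num
    have h2 : 1 ≤ R / (8 * K) := by rwa [le_div_iff₀ (by positivity), one_mul]
    linarith
  have hN0 : 0 < (N : ℝ) := lt_of_lt_of_le (by positivity) hN3
  have hNR : (N : ℝ) ≤ R := hN1.trans (div_le_self (by linarith) (by linarith))
  have hNK : 4 * K * N ≤ R := by rwa [le_div_iff₀ (by positivity), mul_comm] at hN1
  have hex : ∀ k : ℕ, ∃ y, k < N → y ∈ S ∧ R / 2 + 2 * K * k ≤ M.d o y ∧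
      M.d o y ≤ R / 2 + 2 * K * k + K := by
    intro k
    by_cases hk : k < N
    · have hk' : (k : ℝ) ≤ N := by exact_mod_cast hk.le
      obtain ⟨y, hy⟩ := hS (R / 2 + 2 * K * k) (by positivity) (by nlinarith)
      exact ⟨y, fun _ => hy⟩
    · exact ⟨o, fun h => absurd h hk⟩
  choose y hy using hex
  have sep : ∀ k l, k < N → l < N → l < k → (k : ℝ) - l ≤ M.d (y k) (y l) := by
    intro k l hk hl hlk
    have h1 := (hy k hk).2.1
    have h2 := (hy l hl).2.2
    have h3 := M.d_triangle o (y l) (y k)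
    rw [M.d_symm (y l)] at h3
    have h4 : (l : ℝ) + 1 ≤ k := by exact_mod_cast hlk
    nlinarith
  have sep' : ∀ k l, k < N → l < N → l ≠ k → |(k : ℝ) - l| ≤ M.d (y k) (y l) := by
    intro k l hk hl hlk
    rcases lt_or_gt_of_ne hlk with h | h
    · rw [abs_of_nonneg (sub_nonneg.2 (by exact_mod_cast h.le))]
      exact sep k l hk hl h
    · rw [abs_sub_comm, abs_of_nonneg (sub_nonneg.2 (by exact_mod_cast h.le)), M.d_symm]
      exact sep l k hl hk h
  have hinj : Set.InjOn y (Finset.range N) := by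
    intro k hk l hl hkl
    by_contra hne
    have h1 := sep' k l (Finset.mem_range.1 hk) (Finset.mem_range.1 hl) (Ne.symm hne)
    rw [hkl, M.d_self] at h1
    have : (0 : ℝ) < |(k : ℝ) - l| := abs_pos.2 (sub_ne_zero.2 (by exact_mod_cast hne))
    linarith
  obtain ⟨U, hU⟩ : ∃ U, U = (Finset.range N).image y := ⟨_, rfl⟩
  have hUS : U ⊆ S := by
    rw [hU]
    intro z hz
    obtain ⟨k, hk, rfl⟩ := Finset.mem_image.1 hz
    exact (hy k (Finset.mem_range.1 hk)).1
  obtain ⟨μ, hμ⟩ : ∃ μ : M.V → ℝ, μ = fun z => if z ∈ U then (N : ℝ)⁻¹ else 0 := ⟨_, rfl⟩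
  have sum_eq : ∀ F : M.V → ℝ, ∑ z ∈ S, μ z * F z =
      (N : ℝ)⁻¹ * ∑ k ∈ Finset.range N, F (y k) := by
    intro F
    rw [← Finset.sum_image (f := F) hinj, ← hU, Finset.mul_sum, hμ]
    simp_rw [ite_mul, zero_mul]
    rw [Finset.sum_ite_mem, Finset.inter_eq_right.2 hUS]
  refine ⟨μ, fun z hz => ?_, ?_, ?_⟩
  · rw [hμ]
    refine if_neg fun h => ?_
    rw [hU] at h
    obtain ⟨k, hk, rfl⟩ := Finset.mem_image.1 h
    have := (hy k (Finset.mem_range.1 hk)).2.1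
    have : 0 ≤ 2 * K * k := by positivity
    linarith
  · have := sum_eq fun _ => 1
    simp only [mul_one, Finset.sum_const, Finset.card_range, nsmul_eq_mul] at this
    rw [this, inv_mul_cancel₀ hN0.ne']
  · have hlogN : log N ≤ log R := log_le_log hN0 hNR
    have hlog1 : 1 ≤ log R := by
      rw [le_log_iff_exp_le (by linarith)]
      exact (exp_one_lt_d9.le.trans (by norm_num)).trans hR
    have row : ∀ k ∈ Finset.range N, M.pot S μ (y k) ≤ (N : ℝ)⁻¹ * (K * (5 * log R)) := by
      intro k hk
      have hk' := Finset.mem_range.1 hk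
      unfold pot
      rw [sum_eq]
      refine mul_le_mul_of_nonneg_left ?_ (by positivity)
      have h1 := sum_inv_abs_le hk' hK.le (G := fun l => if l < N then M.green (y k) (y l) else 0)
        (by rw [if_pos hk']; exact H.green_le _ _) (fun l hl => by
          split_ifs with h
          · refine H.green_ub' (abs_pos.2 (sub_ne_zero.2 ?_)) (sep' k l hk' h hl)
            exact_mod_cast hl.symm
          · positivity)
      have h2 : ∑ l ∈ Finset.range N, (if l < N then M.green (y k) (y l) else 0) =
          ∑ l ∈ Finset.range N, M.green (y k) (y l) :=
        Finset.sum_congr rfl fun l hl => if_pos (Finset.mem_range.1 hl)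
      rw [h2] at h1
      refine h1.trans (mul_le_mul_of_nonneg_left ?_ hK.le)
      linarith
    unfold energy
    rw [sum_eq]
    calc _ ≤ (N : ℝ)⁻¹ * ∑ k ∈ Finset.range N, (N : ℝ)⁻¹ * (K * (5 * log R)) :=
          mul_le_mul_of_nonneg_left (Finset.sum_le_sum row) (by positivity)
      _ = (N : ℝ)⁻¹ * (K * (5 * log R)) := by
          rw [Finset.sum_const, Finset.card_range, nsmul_eq_mul, mul_inv_cancel_left₀ hN0.ne']
      _ ≤ (R / (8 * K))⁻¹ * (K * (5 * log R)) := by gcongr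
      _ = _ := by field_simp; norm_num

end WGraph

/-! ## The one-arm estimate -/

namespace Model

variable {M : Model} {K : ℝ}

/-- The one-arm bound in terms of the number `n` and the thickness `L` of the levels. -/
theorem exists_arm_bound (H : M.toWGraph.Reg K) :
    ∃ C₁ c N₀ : ℝ, 1 ≤ C₁ ∧ 0 < c ∧ c ≤ 1 ∧ 0 ≤ N₀ ∧
      ∀ (L : ℝ) (o : M.V) (n : ℕ) (R : ℝ), 2 ≤ L → n * (C₁ * L) = R / 2 → 3 ≤ R → 8 * K ≤ R →
        M.prob (M.armEvent o R) ≤ 3 * (K * √(K / L * (1 + 2 * N₀))) +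
          2 * (3 * (K * (√(40 * K ^ 2 * log R / R) * (1 - c) ^ n))) := by
  have hK := H.K_pos
  have hp := greenPSD H.green_symm
  obtain ⟨κ, C₁, c, N₀, hκ, hC₁, hc, hc1, hN₀, hlev⟩ := H.exists_levels hp
  refine ⟨C₁, c, N₀, hC₁, hc, hc1, hN₀, fun L o n R hL hn hR hRK => ?_⟩
  have hL0 : 0 < L := by linarith
  obtain ⟨X, B, A, N, hA, hX, hesc, hhit, hN⟩ := hlev L hL o n
  rw [hn] at hX hesc
  obtain ⟨Λ, hΛ⟩ : ∃ Λ : Set M.V, Λ = {y | M.d o y < R / 2} := ⟨_, rfl⟩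
  rw [← hΛ] at hesc
  obtain ⟨D, hD⟩ : ∃ D, D = H.bl o (R + K) := ⟨_, rfl⟩
  have memD : ∀ y, M.d o y ≤ R + K → y ∈ D := fun y hy => by rw [hD]; exact H.mem_bl.2 hy
  have hXD : ∀ i, X.s i ⊆ D := fun i y hy => memD y (by linarith [hX i y hy])
  obtain ⟨cm, cm0, hprob, hcm⟩ := exists_clusterLaw H o (by linarith : 0 < R) memD
  obtain ⟨F, hF⟩ : ∃ F, F = D.powerset.filter (M.toWGraph.Arm K o R) := ⟨_, rfl⟩
  rw [← hF] at hprob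
  have hFD : F ⊆ D.powerset := hF ▸ Finset.filter_subset _ _
  have hFA : ∀ S ∈ F, M.toWGraph.Arm K o R S := fun S hS => by
    rw [hF] at hS; exact (Finset.mem_filter.1 hS).2
  obtain ⟨T, hT⟩ : ∃ T : Finset M.V → ℝ,
      T = fun S => ∑ b ∈ B, (H.trace (A b) (N b) b).hitProb S := ⟨_, rfl⟩
  have hitT : ∀ S, X.hitProb S ≤ T S := fun S => by rw [hT]; exact hhit S
  have fat : ∑ S ∈ F.filter (fun S => 1 / 2 ≤ T S), cm S ≤
      3 * (K * √(K / L * (1 + 2 * N₀))) := by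
    have ha : 0 < K / L * (1 + 2 * N₀) := by positivity
    refine hcm ∅ (Finset.empty_subset _) (fun _ => √(K / L * (1 + 2 * N₀)))
      (fun _ => Real.sqrt_nonneg _) (fun x _ => (H.avg_const _ x).le) _
      ((Finset.filter_subset _ _).trans hFD) fun S hS => ⟨Finset.disjoint_empty_right _, ?_⟩
    have hS2 := (Finset.mem_filter.1 hS).2
    choose μ μ0 μA μT μpot using fun b => H.trace_hitProb (A b) (N b) b S
    have hTμ : T S = ∑ b ∈ B, ∑ y ∈ S, μ b y := by
      rw [hT]; exact Finset.sum_congr rfl fun b _ => (μT b).symm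
    have hsum : ∑ y ∈ S, (∑ b ∈ B, μ b y) * √(K / L * (1 + 2 * N₀)) =
        T S * √(K / L * (1 + 2 * N₀)) := by
      rw [← Finset.sum_mul, hTμ, Finset.sum_comm]
    refine ⟨fun y => ∑ b ∈ B, μ b y, ?_, ?_⟩
    · rw [hsum]
      exact mul_pos (by linarith) (Real.sqrt_pos.2 ha)
    · rw [hsum, mul_pow, Real.sq_sqrt ha.le]
      refine (H.energy_sum_le hp hL0 μ0 μA hA μpot hN hTμ).trans ?_
      have h1 : N₀ * T S ≤ N₀ * (2 * T S ^ 2) :=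
        mul_le_mul_of_nonneg_left (by nlinarith) hN₀
      calc K / L * (T S ^ 2 + N₀ * T S) ≤ K / L * (T S ^ 2 + N₀ * (2 * T S ^ 2)) := by gcongr
        _ = _ := by ring
  obtain ⟨a, ha⟩ : ∃ a, a = √(40 * K ^ 2 * log R / R) := ⟨_, rfl⟩
  have hlog : 0 < log R := Real.log_pos (by linarith)
  have ha0 : 0 < a := by rw [ha]; exact Real.sqrt_pos.2 (by positivity)
  have ha2 : a ^ 2 = 40 * K ^ 2 * log R / R := by rw [ha, Real.sq_sqrt (by positivity)]
  rw [← ha]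
  obtain ⟨G, hG⟩ : ∃ G, G = F.filter (fun S => ¬ 1 / 2 ≤ T S) := ⟨_, rfl⟩
  have hGF : G ⊆ F := hG ▸ Finset.filter_subset _ _
  have avoid : ∀ i, ∑ S ∈ G.filter (fun S => Disjoint S (X.s i)), cm S ≤
      3 * (K * (a * M.toWGraph.escLim (X.s i) Λ o)) := by
    intro i
    refine hcm (X.s i) (hXD i) (fun y => a * M.toWGraph.escLim (X.s i) Λ y)
      (fun y => mul_nonneg ha0.le (H.escLim_nonneg _ _ _)) (fun y hy => ?_) _
      (((Finset.filter_subset _ _).trans hGF).trans hFD) fun S hS => ?_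
    · rw [WGraph.avg_smul]
      exact mul_le_mul_of_nonneg_left (H.avg_escLim_le Λ hy) ha0.le
    · obtain ⟨hSG, hdis⟩ := Finset.mem_filter.1 hS
      obtain ⟨μ, μ0, μ1, μe⟩ := H.exists_arm_charge hR hRK (hFA S (hGF hSG))
      have hsum : ∑ y ∈ S, μ y * (a * M.toWGraph.escLim (X.s i) Λ y) = a := by
        calc _ = ∑ y ∈ S, μ y * a := by
              refine Finset.sum_congr rfl fun y hy => ?_
              by_cases hy' : M.d o y < R / 2
              · rw [μ0 y hy']; simp
              · rw [WGraph.escLim_of_notMem (Finset.disjoint_left.1 hdis hy)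
                  (by rw [hΛ]; exact hy'), mul_one]
          _ = a := by rw [← Finset.sum_mul, μ1, one_mul]
      refine ⟨hdis, μ, ?_, ?_⟩
      · rw [hsum]; exact ha0
      · rw [hsum, ha2]; exact μe
  have thin : ∑ S ∈ G, cm S ≤ 2 * (3 * (K * (a * (1 - c) ^ n))) := by
    have h1 : ∀ S ∈ G, cm S ≤ 2 * ∑ i, X.w i * if Disjoint S (X.s i) then cm S else 0 := by
      intro S hS
      rw [hG] at hS
      have hS2 := (Finset.mem_filter.1 hS).2
      have h2 : X.hitProb S < 1 / 2 := (hitT S).trans_lt (not_le.1 hS2)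
      have h3 : ∑ i, X.w i * (if Disjoint S (X.s i) then cm S else 0) =
          (1 - X.hitProb S) * cm S := by
        rw [← X.w_sum, RSet.hitProb, RSet.E, ← Finset.sum_sub_distrib, Finset.sum_mul]
        refine Finset.sum_congr rfl fun i _ => ?_
        have h4 : Disjoint S (X.s i) ↔ ¬ (X.s i ∩ S).Nonempty := by
          rw [Finset.not_nonempty_iff_eq_empty, ← Finset.disjoint_iff_inter_eq_empty, disjoint_comm]
        by_cases h : (X.s i ∩ S).Nonempty
        · rw [if_pos h, if_neg (fun h' => h4.1 h' h)]; ring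
        · rw [if_neg h, if_pos (h4.2 h)]; ring
      rw [h3]
      nlinarith [cm0 S]
    calc ∑ S ∈ G, cm S ≤ ∑ S ∈ G, 2 * ∑ i, X.w i * if Disjoint S (X.s i) then cm S else 0 :=
          Finset.sum_le_sum h1
      _ = 2 * ∑ i, X.w i * ∑ S ∈ G.filter (fun S => Disjoint S (X.s i)), cm S := by
          rw [← Finset.mul_sum, Finset.sum_comm]
          simp_rw [Finset.sum_filter, Finset.mul_sum]
      _ ≤ 2 * ∑ i, X.w i * (3 * (K * (a * M.toWGraph.escLim (X.s i) Λ o))) := by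
          gcongr with i
          · exact X.w_nonneg i
          · exact avoid i
      _ = 2 * (3 * (K * (a * X.E fun s => M.toWGraph.escLim s Λ o))) := by
          simp only [RSet.E, Finset.mul_sum]
          exact Finset.sum_congr rfl fun i _ => by ring
      _ ≤ _ := by
          gcongr
          exact H.E_escLim_le hesc
  calc M.prob (M.armEvent o R) ≤ ∑ S ∈ F, cm S := hprob
    _ = ∑ S ∈ F.filter (fun S => 1 / 2 ≤ T S), cm S + ∑ S ∈ G, cm S := by
        rw [hG, Finset.sum_filter_add_sum_filter_not]
    _ ≤ _ := add_le_add fat thin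

/-- The one-arm bound with exponent `1 / 2` on the logarithmic correction, for large radii. -/
theorem exists_arm_bound_of_large (H : M.toWGraph.Reg K) :
    ∃ R₀ C₀ : ℝ, 3 ≤ R₀ ∧ 0 < C₀ ∧ ∀ (o : M.V) (R : ℝ), R₀ ≤ R → 1 ≤ log (log R) ∧
      M.prob (M.armEvent o R) ≤ C₀ * √(log (log R)) * (√R)⁻¹ := by
  have hK := H.K_pos
  obtain ⟨C₁, c, N₀, hC₁, hc, hc1, hN₀, harm⟩ := exists_arm_bound H
  obtain ⟨q, hq⟩ : ∃ q : ℝ, q = 1 / (2 * c) + 1 := ⟨_, rfl⟩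
  have hq0 : 0 < q := by rw [hq]; positivity
  refine ⟨max 3 (max (Real.exp (Real.exp 1)) (max (8 * K) ((8 * q * C₁) ^ 2))),
    3 * (K * √(2 * K * q * C₁ * (1 + 2 * N₀))) + 2 * (3 * (K * √(40 * K ^ 2))),
    le_max_left _ _, by positivity, fun o R hR => ?_⟩
  simp only [max_le_iff] at hR
  obtain ⟨hR3, hRe, hRK, hRq⟩ := hR
  have hR0 : 0 < R := by linarith
  have hlog : Real.exp 1 ≤ log R := (Real.le_log_iff_exp_le hR0).2 hRe
  have hlog0 : 0 < log R := (Real.exp_pos 1).trans_le hlog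
  obtain ⟨l, hl⟩ : ∃ l, l = log (log R) := ⟨_, rfl⟩
  rw [← hl]
  have hl1 : 1 ≤ l := by rw [hl]; exact (Real.le_log_iff_exp_le hlog0).2 hlog
  refine ⟨hl1, ?_⟩
  have hs : 0 < √R := Real.sqrt_pos.2 hR0
  have hss : √R * √R = R := Real.mul_self_sqrt hR0.le
  have hlR : l ≤ 2 * √R := by
    have h1 : l ≤ log R := by rw [hl]; exact (Real.log_le_self hlog0.le)
    have h2 : log R = 2 * log (√R) := by rw [Real.log_sqrt hR0.le]; ring
    have h3 := Real.log_le_self hs.le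
    linarith
  obtain ⟨n, hn⟩ : ∃ n, n = ⌈l / (2 * c)⌉₊ := ⟨_, rfl⟩
  have hn1 : l / (2 * c) ≤ n := hn ▸ Nat.le_ceil _
  have hn0 : (0 : ℝ) < n := (by positivity : 0 < l / (2 * c)).trans_le hn1
  have hn2 : (n : ℝ) ≤ q * l := by
    have h1 : (n : ℝ) < l / (2 * c) + 1 := hn ▸ Nat.ceil_lt_add_one (by positivity)
    have h2 : q * l = l / (2 * c) + l := by rw [hq]; ring
    linarith
  have hnR : 4 * (n * C₁) ≤ R := by
    have h1 : 8 * q * C₁ ≤ √R := Real.le_sqrt_of_sq_le hRq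
    calc 4 * (n * C₁) ≤ 4 * ((q * (2 * √R)) * C₁) := by
          have := hn2.trans (mul_le_mul_of_nonneg_left hlR hq0.le)
          gcongr
      _ = (8 * q * C₁) * √R := by ring
      _ ≤ √R * √R := by gcongr
      _ = R := hss
  have hnC : 0 < n * C₁ := by positivity
  refine (harm (R / (2 * (n * C₁))) o n R ?_ ?_ hR3 hRK).trans ?_
  · rw [le_div_iff₀ (by positivity)]; linarith
  · field_simp
  have fat : √(K / (R / (2 * (n * C₁))) * (1 + 2 * N₀)) ≤
      √(2 * K * q * C₁ * (1 + 2 * N₀)) * √l * (√R)⁻¹ := by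
    rw [← Real.sqrt_inv, ← Real.sqrt_mul (by positivity), ← Real.sqrt_mul (by positivity)]
    refine Real.sqrt_le_sqrt ?_
    calc K / (R / (2 * (n * C₁))) * (1 + 2 * N₀) = 2 * K * n * C₁ * (1 + 2 * N₀) * R⁻¹ := by
          field_simp
      _ ≤ 2 * K * (q * l) * C₁ * (1 + 2 * N₀) * R⁻¹ := by gcongr
      _ = _ := by ring
  have thin : √(40 * K ^ 2 * log R / R) * (1 - c) ^ n ≤ √(40 * K ^ 2) * √l * (√R)⁻¹ := by
    have h1 : (1 - c) ^ n ≤ (√(log R))⁻¹ := by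
      have h2 : √(log R) = Real.exp (l / 2) := by
        rw [← Real.exp_log hlog0, ← hl, Real.exp_half]
      rw [h2, ← Real.exp_neg]
      calc (1 - c) ^ n ≤ Real.exp (-c) ^ n := by
            gcongr
            exact Real.one_sub_le_exp_neg c
        _ = Real.exp (-(n * c)) := by rw [← Real.exp_nat_mul]; congr 1; ring
        _ ≤ _ := by
            refine Real.exp_le_exp.2 (neg_le_neg ?_)
            rw [div_le_iff₀ (by positivity)] at hn1
            linarith
    have h3 : 0 < √(log R) := Real.sqrt_pos.2 hlog0
    have h4 : 1 ≤ √l := Real.one_le_sqrt.2 hl1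
    calc √(40 * K ^ 2 * log R / R) * (1 - c) ^ n
        ≤ √(40 * K ^ 2 * log R / R) * (√(log R))⁻¹ := by gcongr
      _ = √(40 * K ^ 2) * 1 * (√R)⁻¹ := by
          rw [Real.sqrt_div (by positivity), Real.sqrt_mul (by positivity)]
          field_simp
      _ ≤ _ := by gcongr
  calc _ ≤ 3 * (K * (√(2 * K * q * C₁ * (1 + 2 * N₀)) * √l * (√R)⁻¹)) +
        2 * (3 * (K * (√(40 * K ^ 2) * √l * (√R)⁻¹))) := by gcongr
    _ = _ := by ring

end Model

/-- **Refined one-arm bound when `ν = 1` (consequence of (4.16)).** -/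
theorem one_arm_refined_nu_one (M : Model) (hS : M.toWGraph.Standing)
    (hν : M.ν = 1) (hα : 3 ≤ M.α) :
    ∀ ε > (0:ℝ), ∃ C > (0:ℝ), ∀ (x : M.V) (R : ℝ), 3 ≤ R →
      M.prob (M.armEvent x R) ≤
        C * Real.log (Real.log R) ^ (2 / 3 + ε) * R ^ (-(1 / 2) : ℝ) := by
  intro ε hε
  obtain ⟨K, H⟩ := WGraph.exists_reg hS hν hα
  obtain ⟨R₀, C₀, hR₀, hC₀, harm⟩ := Model.exists_arm_bound_of_large H
  have hR₀0 : 0 < R₀ := by linarith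
  have h3 : 0 < log (log 3) := by
    refine Real.log_pos ?_
    rw [Real.lt_log_iff_exp_lt (by norm_num)]
    exact Real.exp_one_lt_d9.trans (by norm_num)
  obtain ⟨p, hp⟩ : ∃ p : ℝ, p = log (log 3) ^ (2 / 3 + ε) * R₀ ^ (-(1 / 2) : ℝ) := ⟨_, rfl⟩
  have hp0 : 0 < p := by rw [hp]; positivity
  refine ⟨max C₀ p⁻¹, by positivity, fun x R hR => ?_⟩
  have hR0 : 0 < R := by linarith
  have hlog3 : 0 < log 3 := Real.log_pos (by norm_num)
  have hmono : log (log 3) ≤ log (log R) :=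
    Real.log_le_log hlog3 (Real.log_le_log (by norm_num) hR)
  have hl0 : 0 < log (log R) := h3.trans_le hmono
  rcases le_total R₀ R with h | h
  · obtain ⟨hl, hb⟩ := harm x R h
    refine hb.trans ?_
    have e1 : (√R)⁻¹ = R ^ (-(1 / 2) : ℝ) := by rw [Real.sqrt_eq_rpow, Real.rpow_neg hR0.le]
    have e2 : √(log (log R)) ≤ log (log R) ^ (2 / 3 + ε) := by
      rw [Real.sqrt_eq_rpow]
      exact Real.rpow_le_rpow_of_exponent_le hl (by linarith)
    rw [e1]
    gcongr
    exact le_max_left _ _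
  · have h1 : M.prob (M.armEvent x R) ≤ 1 := by
      have := M.Pprob
      exact measureReal_le_one
    have h2 : p ≤ log (log R) ^ (2 / 3 + ε) * R ^ (-(1 / 2) : ℝ) := by
      rw [hp]
      refine mul_le_mul (Real.rpow_le_rpow h3.le hmono (by linarith))
        (Real.rpow_le_rpow_of_nonpos hR0 h (by norm_num)) (by positivity) (by positivity)
    calc _ ≤ 1 := h1
      _ = p⁻¹ * p := (inv_mul_cancel₀ hp0.ne').symm
      _ ≤ max C₀ p⁻¹ * (log (log R) ^ (2 / 3 + ε) * R ^ (-(1 / 2) : ℝ)) :=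
          mul_le_mul (le_max_right _ _) h2 hp0.le (by positivity)
      _ = _ := by ring
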